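/- For every integer m ≥ 1 there exists a constant K > 0 such that for every integer d > 1 and every Borel set G ⊆ S^m, the number N_{Y_d}(G) of zeros of the homogeneous KSS field Y_d in G satisfies Var(N_{Y_d}(G)) − E(N_{Y_d}(G)) ≤ K · Vol(G) · d^{m/2}, where Vol(G) is the m-dimensional surface measure of G. -/

import Mathlib

open MeasureTheory ProbabilityTheory Real Filter Nat

/-- Index set for the coefficients of the homogeneous `m × m` KSS field of degree `d`:
a pair of an equation index `ℓ ∈ {1,…,m}` and a multi-index `j ∈ ℕ^{m+1}` with `|j| = d`
(encoded with entries in `Fin (d+1)`). -/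
abbrev hkssIndex (m d : ℕ) :=
  Fin m × {j : Fin (m + 1) → Fin (d + 1) // (∑ k, (j k : ℕ)) = d}

/-- Variance `d! / (j_0! ⋯ j_m!)` of the coefficient `a^{(ℓ)}_j`. -/
noncomputable def hkssVar (m d : ℕ) (i : hkssIndex m d) : NNReal :=
  (d ! : NNReal) / ((∏ k, ((i.2.1 k : ℕ))! : ℕ) : NNReal)

/-- The law of the coefficients: product of independent centered Gaussian measures. -/
noncomputable def hkssMeasure (m d : ℕ) : Measure (hkssIndex m d → ℝ) :=
  Measure.pi fun i => gaussianReal 0 (hkssVar m d i)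

/-- The homogeneous polynomial `Y_ℓ(t) = ∑_{|j| = d} a^{(ℓ)}_j t^j`, `t ∈ ℝ^{m+1}`. -/
noncomputable def hkssPoly (m d : ℕ) (ω : hkssIndex m d → ℝ) (ℓ : Fin m)
    (t : Fin (m + 1) → ℝ) : ℝ :=
  ∑ j : {j : Fin (m + 1) → Fin (d + 1) // (∑ k, (j k : ℕ)) = d},
    ω (ℓ, j) * ∏ k, t k ^ (j.1 k : ℕ)
/-- The number of zeros of the homogeneous KSS field `Y_d` in a subset `G` of the unit
sphere `S^m ⊂ ℝ^{m+1}`. -/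
noncomputable def hkssCountIn (m d : ℕ) (G : Set (EuclideanSpace ℝ (Fin (m + 1))))
    (ω : hkssIndex m d → ℝ) : ℕ :=
  Set.ncard {t : EuclideanSpace ℝ (Fin (m + 1)) |
    t ∈ G ∧ ∀ ℓ, hkssPoly m d ω ℓ (fun k => t k) = 0}

set_option linter.unusedSectionVars false

open Set in
/-- The number of solutions in a disjoint union of injectivity domains is a sum of indicators. -/
theorem encard_fiber_eq_tsum_indicator {α β : Type*} {s : Set α} {f : α → β} {t : ℕ → Set α}
    (hd : Pairwise (Function.onFun Disjoint t)) (hst : s ⊆ ⋃ n, t n)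
    (hinj : ∀ n, InjOn f (s ∩ t n)) (w : β) :
    ((s ∩ f ⁻¹' {w}).encard : ENNReal)
      = ∑' n, (f '' (s ∩ t n)).indicator (fun _ => (1 : ENNReal)) w := by
  classical
  have h1 : ∀ n, (f '' (s ∩ t n)).indicator (fun _ => (1 : ENNReal)) w
      = ∑' x : α, (s ∩ f ⁻¹' {w} ∩ t n).indicator (fun _ => (1 : ENNReal)) x := by
    intro n
    rw [← tsum_subtype, ENNReal.tsum_set_one]
    by_cases hw : w ∈ f '' (s ∩ t n)
    · obtain ⟨x, hx, rfl⟩ := hw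
      have : s ∩ f ⁻¹' {f x} ∩ t n = {x} := by
        ext y
        simp only [mem_inter_iff, mem_preimage, mem_singleton_iff]
        constructor
        · rintro ⟨⟨h1, h2⟩, h3⟩
          exact hinj n ⟨h1, h3⟩ hx h2
        · rintro rfl
          exact ⟨⟨hx.1, rfl⟩, hx.2⟩
      rw [this, indicator_of_mem (mem_image_of_mem _ hx)]
      simp
    · have : s ∩ f ⁻¹' {w} ∩ t n = ∅ := by
        ext y
        simp only [mem_inter_iff, mem_preimage, mem_singleton_iff, mem_empty_iff_false, iff_false]
        rintro ⟨⟨h1, h2⟩, h3⟩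
        exact hw ⟨y, ⟨h1, h3⟩, h2⟩
      rw [this, indicator_of_notMem hw]
      simp
  simp_rw [h1]
  rw [ENNReal.tsum_comm, ← ENNReal.tsum_set_one, tsum_subtype _ (fun _ => (1 : ENNReal))]
  congr 1
  ext x
  by_cases hx : x ∈ s ∩ f ⁻¹' {w}
  · obtain ⟨n, hn⟩ := mem_iUnion.1 (hst hx.1)
    rw [indicator_of_mem hx, tsum_eq_single n]
    · rw [indicator_of_mem (mem_inter hx hn)]
    · intro k hk
      rw [indicator_of_notMem]
      rintro ⟨-, h⟩
      exact Set.disjoint_left.1 (hd hk) h hn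
  · rw [indicator_of_notMem hx]
    symm
    simp only [ENNReal.tsum_eq_zero]
    intro n
    rw [indicator_of_notMem]
    exact fun h => hx h.1

section AreaFormula

variable {E : Type*} [NormedAddCommGroup E] [NormedSpace ℝ E] [FiniteDimensional ℝ E]
  [MeasurableSpace E] [BorelSpace E]

open Set in
theorem exists_injOn_partition {f : E → E} {s : Set E} {f' : E → E →L[ℝ] E}
    (hf : ∀ x ∈ s, HasFDerivWithinAt f (f' x) s x) (hdet : ∀ x ∈ s, (f' x).det ≠ 0) :
    ∃ t : ℕ → Set E, Pairwise (Function.onFun Disjoint t) ∧ (∀ n, MeasurableSet (t n)) ∧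
      s ⊆ ⋃ n, t n ∧ ∀ n, InjOn f (s ∩ t n) := by
  have key : ∀ A : E →L[ℝ] E, ∃ c : NNReal, c ≠ 0 ∧ (A.det ≠ 0 → ∀ t : Set E,
      ApproximatesLinearOn f A t c → InjOn f t) := by
    intro A
    by_cases hA : A.det ≠ 0
    · let B := A.toContinuousLinearEquivOfDetNeZero hA
      rcases subsingleton_or_nontrivial E with hE | hE
      · exact ⟨1, one_ne_zero, fun _ t _ x _ y _ _ => Subsingleton.elim _ _⟩
      · have hpos : 0 < ‖(B.symm : E →L[ℝ] E)‖₊⁻¹ := by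
          simp only [inv_pos]
          exact B.subsingleton_or_nnnorm_symm_pos.resolve_left (not_subsingleton E)
        refine ⟨‖(B.symm : E →L[ℝ] E)‖₊⁻¹ / 2, (half_pos hpos).ne', fun _ t ht => ?_⟩
        have ht' : ApproximatesLinearOn f (B : E →L[ℝ] E) t (‖(B.symm : E →L[ℝ] E)‖₊⁻¹ / 2) := ht
        exact ht'.injOn (Or.inr (half_lt_self hpos))
    · exact ⟨1, one_ne_zero, fun h => absurd h hA⟩
  choose r hr hinj using key
  obtain ⟨t, A, h1, h2, h3, h4, h5⟩ :=
    exists_partition_approximatesLinearOn_of_hasFDerivWithinAt f s f' hf r hr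
  refine ⟨t, h1, h2, h3, fun n => ?_⟩
  rcases s.eq_empty_or_nonempty with rfl | hs
  · simp
  · obtain ⟨y, hy, hAy⟩ := h5 hs n
    exact hinj (A n) (hAy ▸ hdet y hy) _ (h4 n)

open Set in
/-- Area formula, counting multiplicities, for differentiable maps between spaces of the same
dimension. -/
theorem area_formula (μ : Measure E) [μ.IsAddHaarMeasure] {f : E → E} {s : Set E}
    (hs : MeasurableSet s) (hf : ∀ x ∈ s, DifferentiableAt ℝ f x) :
    AEMeasurable (fun w => ((s ∩ f ⁻¹' {w}).encard : ENNReal)) μ ∧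
    ∀ g : E → ENNReal, Measurable g →
      ∫⁻ w, ((s ∩ f ⁻¹' {w}).encard : ENNReal) * g w ∂μ
        = ∫⁻ x in s, ENNReal.ofReal |(fderiv ℝ f x).det| * g (f x) ∂μ := by
  have hdetm : Measurable fun x => (fderiv ℝ f x).det :=
    ContinuousLinearMap.continuous_det.measurable.comp (measurable_fderiv ℝ f)
  set s₀ := s ∩ {x | (fderiv ℝ f x).det = 0} with hs₀
  set s₁ := s ∩ {x | (fderiv ℝ f x).det = 0}ᶜ with hs₁
  have m0 : MeasurableSet {x | (fderiv ℝ f x).det = 0} :=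
    hdetm (measurableSet_singleton (0 : ℝ))
  have hs₁m : MeasurableSet s₁ := hs.inter m0.compl
  have hfs : ∀ x ∈ s, HasFDerivWithinAt f (fderiv ℝ f x) s x := fun x hx =>
    (hf x hx).hasFDerivAt.hasFDerivWithinAt
  have hf1 : ∀ x ∈ s₁, HasFDerivWithinAt f (fderiv ℝ f x) s₁ x := fun x hx =>
    (hfs x hx.1).mono inter_subset_left
  have hnull : μ (f '' s₀) = 0 :=
    addHaar_image_eq_zero_of_det_fderivWithin_eq_zero μ
      (fun x hx => (hfs x hx.1).mono inter_subset_left) (fun x hx => hx.2)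
  obtain ⟨t, ht1, ht2, ht3, ht4⟩ := exists_injOn_partition hf1 (fun x hx => hx.2)
  have hae : (fun w => ((s ∩ f ⁻¹' {w}).encard : ENNReal)) =ᵐ[μ]
      fun w => ∑' n, (f '' (s₁ ∩ t n)).indicator (fun _ => (1 : ENNReal)) w := by
    filter_upwards [compl_mem_ae_iff.2 hnull] with w hw
    rw [← encard_fiber_eq_tsum_indicator ht1 ht3 ht4]
    congr 2
    ext x
    simp only [mem_inter_iff, mem_preimage, mem_singleton_iff]
    constructor
    · rintro ⟨h1, h2⟩
      refine ⟨⟨h1, fun h3 => hw ⟨x, ⟨h1, h3⟩, h2⟩⟩, h2⟩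
    · rintro ⟨h1, h2⟩
      exact ⟨h1.1, h2⟩
  have hfm : ∀ n, ∀ x ∈ s₁ ∩ t n, HasFDerivWithinAt f (fderiv ℝ f x) (s₁ ∩ t n) x := fun n x hx =>
    (hf1 x hx.1).mono inter_subset_left
  have him : ∀ n, MeasurableSet (f '' (s₁ ∩ t n)) := fun n =>
    measurable_image_of_fderivWithin (hs₁m.inter (ht2 n)) (hfm n) (ht4 n)
  refine ⟨(Measurable.tsum fun n => measurable_const.indicator (him n)).aemeasurable.congr
    hae.symm, fun g hg => ?_⟩
  have e1 : ∫⁻ w, ((s ∩ f ⁻¹' {w}).encard : ENNReal) * g w ∂μ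
      = ∫⁻ w, ∑' n, (f '' (s₁ ∩ t n)).indicator g w ∂μ := by
    refine lintegral_congr_ae ?_
    filter_upwards [hae] with w hw
    rw [hw, ← ENNReal.tsum_mul_right]
    congr 1
    ext n
    by_cases h : w ∈ f '' (s₁ ∩ t n) <;> simp [h]
  rw [e1, lintegral_tsum fun n => (hg.indicator (him n)).aemeasurable]
  have e2 : ∀ n, ∫⁻ w, (f '' (s₁ ∩ t n)).indicator g w ∂μ
      = ∫⁻ x in s₁ ∩ t n, ENNReal.ofReal |(fderiv ℝ f x).det| * g (f x) ∂μ := by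
    intro n
    rw [lintegral_indicator (him n), lintegral_image_eq_lintegral_abs_det_fderiv_mul μ
      (hs₁m.inter (ht2 n)) (hfm n) (ht4 n)]
  simp_rw [e2]
  rw [← lintegral_iUnion (fun n => hs₁m.inter (ht2 n))
    (fun i j hij => (ht1 hij).mono inter_subset_right inter_subset_right), ← inter_iUnion,
    inter_eq_left.2 ht3, ← lintegral_indicator hs₁m, ← lintegral_indicator hs]
  refine lintegral_congr fun x => ?_
  by_cases h1 : x ∈ s
  · by_cases h2 : (fderiv ℝ f x).det = 0
    · rw [indicator_of_notMem (fun h => h.2 h2), indicator_of_mem h1, h2]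
      simp
    · rw [indicator_of_mem h1, indicator_of_mem (mem_inter h1 h2)]
  · rw [indicator_of_notMem h1, indicator_of_notMem (fun h => h1 h.1)]

end AreaFormula

section
variable {E : Type*} [NormedAddCommGroup E] [InnerProductSpace ℝ E] [FiniteDimensional ℝ E]
  [MeasurableSpace E] [BorelSpace E]

/-- The density of the standard Gaussian law with respect to Lebesgue measure. -/
noncomputable def gaussDensity (E : Type*) [NormedAddCommGroup E] [InnerProductSpace ℝ E]
    (x : E) : ENNReal :=
  ENNReal.ofReal ((2 * π) ^ (-(Module.finrank ℝ E : ℝ) / 2) * rexp (-‖x‖ ^ 2 / 2))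

theorem measurable_gaussDensity : Measurable (gaussDensity E) := by
  unfold gaussDensity; fun_prop

theorem stdGaussian_eq_withDensity :
    stdGaussian E = (volume : Measure E).withDensity (gaussDensity E) := by
  have hintegrable : Integrable (fun x : E =>
      (2 * π) ^ (-(Module.finrank ℝ E : ℝ) / 2) * rexp (-‖x‖ ^ 2 / 2)) := by
    have := (GaussianFourier.integrable_cexp_neg_mul_sq_norm_add (V := E) (b := 1/2) (by simp) 0 0).norm
    refine (this.congr (Eventually.of_forall fun x => ?_)).const_mul _
    simp [Complex.norm_exp]
    norm_cast
    ring_nf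
  have : IsFiniteMeasure ((volume : Measure E).withDensity (gaussDensity E)) :=
    isFiniteMeasure_withDensity_ofReal hintegrable.2
  apply Measure.ext_of_charFun
  ext t
  rw [charFun_stdGaussian, charFun_apply]
  unfold gaussDensity
  rw [integral_withDensity_eq_integral_toReal_smul (by fun_prop) (by simp)]
  have := GaussianFourier.integral_cexp_neg_mul_sq_norm_add (V := E) (b := 1/2) (by simp) Complex.I t
  have h2 : ∀ x : E, (ENNReal.ofReal ((2 * π) ^ (-(Module.finrank ℝ E : ℝ) / 2) * rexp (-‖x‖ ^ 2 / 2))).toReal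
      • Complex.exp (inner ℝ x t * Complex.I) = ((2 * π) ^ (-(Module.finrank ℝ E : ℝ) / 2) : ℝ) *
        Complex.exp (-(1/2) * ‖x‖^2 + Complex.I * inner ℝ t x) := by
    intro x
    rw [ENNReal.toReal_ofReal (by positivity), Complex.exp_add, real_inner_comm]
    simp only [Complex.real_smul]
    push_cast
    rw [mul_comm Complex.I]
    ring_nf
  simp_rw [h2]
  rw [integral_const_mul, this, ← mul_assoc]
  have h3 : (((2 * π) ^ (-(Module.finrank ℝ E : ℝ) / 2) : ℝ) : ℂ) * ((π : ℂ) / (1/2)) ^ ((Module.finrank ℝ E : ℂ) / 2) = 1 := by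
    have : ((π : ℂ) / (1/2)) = ((2 * π : ℝ) : ℂ) := by push_cast; ring
    rw [this, show ((Module.finrank ℝ E : ℂ) / 2) = (((Module.finrank ℝ E : ℝ) / 2 : ℝ) : ℂ) by push_cast; rfl,
      ← Complex.ofReal_cpow (by positivity), ← Complex.ofReal_mul, ← Real.rpow_add (by positivity)]
    simp; ring_nf; simp
  rw [h3, one_mul, Complex.I_sq]
  congr 1
  ring

theorem lintegral_stdGaussian {f : E → ENNReal} (hf : Measurable f) :
    ∫⁻ x, f x ∂(stdGaussian E) = ∫⁻ x, gaussDensity E x * f x := by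
  rw [stdGaussian_eq_withDensity, lintegral_withDensity_eq_lintegral_mul _ measurable_gaussDensity hf]
  rfl
end

section
variable {W : Type*} [NormedAddCommGroup W] [InnerProductSpace ℝ W] [FiniteDimensional ℝ W]
  [MeasurableSpace W] [BorelSpace W]
variable {Ω : Type*} [NormedAddCommGroup Ω] [InnerProductSpace ℝ Ω] [FiniteDimensional ℝ Ω]
  [MeasurableSpace Ω] [BorelSpace Ω]
variable {Ω' : Type*} [NormedAddCommGroup Ω'] [InnerProductSpace ℝ Ω'] [FiniteDimensional ℝ Ω']
  [MeasurableSpace Ω'] [BorelSpace Ω']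

theorem charFun_map_stdGaussian (X : Ω →L[ℝ] W) (w : W) :
    charFun ((stdGaussian Ω).map X) w = Complex.exp (-‖X.adjoint w‖ ^ 2 / 2) := by
  rw [charFun_apply, integral_map (by fun_prop) (by fun_prop), ← charFun_stdGaussian, charFun_apply]
  simp_rw [ContinuousLinearMap.adjoint_inner_right]

theorem map_stdGaussian_eq_of_norm (X : Ω →L[ℝ] W) (Y : Ω' →L[ℝ] W)
    (h : ∀ w, ‖X.adjoint w‖ = ‖Y.adjoint w‖) :
    (stdGaussian Ω).map X = (stdGaussian Ω').map Y := by
  have := Measure.isProbabilityMeasure_map (μ := stdGaussian Ω) (f := X) (by fun_prop)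
  have := Measure.isProbabilityMeasure_map (μ := stdGaussian Ω') (f := Y) (by fun_prop)
  apply Measure.ext_of_charFun
  ext w
  rw [charFun_map_stdGaussian, charFun_map_stdGaussian, h]

theorem exists_end_norm_eq (T : W →L[ℝ] Ω) (hT : Function.Injective T) :
    ∃ R : W →L[ℝ] W, ∀ w, ‖R w‖ = ‖T w‖ := by
  have hr : Module.finrank ℝ T.range = Module.finrank ℝ W := by
    exact LinearMap.finrank_range_of_inj (f := (T : W →ₗ[ℝ] Ω)) hT
  let e : T.range ≃ₗᵢ[ℝ] W := ((stdOrthonormalBasis ℝ T.range).reindex (finCongr hr)).repr.trans (stdOrthonormalBasis ℝ W).repr.symm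
  refine ⟨LinearMap.toContinuousLinearMap (e.toLinearEquiv.toLinearMap ∘ₗ (T : W →ₗ[ℝ] Ω).rangeRestrict), fun w => ?_⟩
  simp

theorem det_adjoint (R : W →L[ℝ] W) : R.adjoint.det = R.det := by
  let b := (stdOrthonormalBasis ℝ W)
  have := LinearMap.toMatrix_adjoint b b (R : W →ₗ[ℝ] W)
  rw [ContinuousLinearMap.det, ContinuousLinearMap.det, ← LinearMap.det_toMatrix b.toBasis,
    ← LinearMap.det_toMatrix b.toBasis (R : W →ₗ[ℝ] W)]
  have h2 : ((R.adjoint : W →L[ℝ] W) : W →ₗ[ℝ] W) = LinearMap.adjoint (R : W →ₗ[ℝ] W) := by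
    ext; simp [LinearMap.adjoint_eq_toCLM_adjoint]; rfl
  rw [h2, this, Matrix.det_conjTranspose]
  simp

theorem pow_le_abs_det (f : W →L[ℝ] W) {a : ℝ} (ha : 0 < a) (h : ∀ v, a * ‖v‖ ≤ ‖f v‖) :
    a ^ (Module.finrank ℝ W) ≤ |f.det| := by
  have hinj : Function.Injective f := by
    refine (injective_iff_map_eq_zero f).2 fun v hv => ?_
    have := h v
    rw [hv, norm_zero] at this
    have : ‖v‖ ≤ 0 := by
      by_contra! h0
      nlinarith
    exact norm_le_zero_iff.1 this
  have hsurj : Function.Surjective f := by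
    exact (LinearMap.injective_iff_surjective (f := (f : W →ₗ[ℝ] W))).1 hinj
  have hb : Metric.ball (0 : W) a ⊆ f '' Metric.ball 0 1 := by
    intro y hy
    obtain ⟨x, rfl⟩ := hsurj y
    refine ⟨x, ?_, rfl⟩
    simp at hy ⊢
    have := h x
    by_contra! h1
    nlinarith
  have h1 := measure_mono (μ := (volume : Measure W)) hb
  rw [Measure.addHaar_image_continuousLinearMap, Measure.addHaar_ball_of_pos _ _ ha] at h1
  have h3 := (ENNReal.mul_le_mul_iff_left (Metric.measure_ball_pos volume (0:W) one_pos).ne' measure_ball_lt_top.ne).1 h1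
  rwa [ENNReal.ofReal_le_ofReal_iff (abs_nonneg _)] at h3

theorem lintegral_le_of_contraction (C : W →L[ℝ] W) {a : ℝ} (ha : 0 < a) (h1 : ∀ v, a * ‖v‖ ≤ ‖C v‖)
    (h2 : ∀ v, ‖C v‖ ≤ ‖v‖) {h : W → ENNReal} (hh : Measurable h) :
    ENNReal.ofReal (a ^ (Module.finrank ℝ W)) * ∫⁻ x, h (C.adjoint x) ∂(stdGaussian W) ≤ ∫⁻ x, h x ∂(stdGaussian W) := by
  have hdet : a ^ (Module.finrank ℝ W) ≤ |C.adjoint.det| := by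
    rw [det_adjoint]; exact pow_le_abs_det C ha h1
  have hn : ∀ v, ‖C.adjoint v‖ ≤ ‖v‖ := by
    intro v
    have : ‖C.adjoint‖ ≤ 1 := by
      rw [LinearIsometryEquiv.norm_map]
      exact C.opNorm_le_bound zero_le_one (by simpa using h2)
    simpa using C.adjoint.le_of_opNorm_le this v
  have hd0 : C.adjoint.det ≠ 0 := by
    intro h0
    rw [h0, abs_zero] at hdet
    have := pow_pos ha (Module.finrank ℝ W)
    linarith
  rw [lintegral_stdGaussian (by fun_prop), lintegral_stdGaussian hh]
  have hm := Measure.map_linearMap_addHaar_eq_smul_addHaar (volume : Measure W) (f := (C.adjoint : W →ₗ[ℝ] W)) hd0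
  have hg : ∀ x, gaussDensity W x ≤ gaussDensity W (C.adjoint x) := by
    intro x
    unfold gaussDensity
    apply ENNReal.ofReal_le_ofReal
    gcongr
    exact hn x
  calc ENNReal.ofReal (a ^ (Module.finrank ℝ W)) * ∫⁻ x, gaussDensity W x * h (C.adjoint x)
      ≤ ENNReal.ofReal |C.adjoint.det| * ∫⁻ x, gaussDensity W (C.adjoint x) * h (C.adjoint x) := by
        gcongr with x
        exact hg x
    _ = ENNReal.ofReal |C.adjoint.det| * ∫⁻ x, gaussDensity W x * h x ∂(Measure.map (C.adjoint : W →ₗ[ℝ] W) volume) := by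
        rw [lintegral_map (f := fun x => gaussDensity W x * h x) (measurable_gaussDensity.mul hh) (by exact C.adjoint.measurable)]
        rfl
    _ = _ := by
        rw [hm, lintegral_smul_measure, smul_eq_mul, ← mul_assoc, ← ENNReal.ofReal_mul (abs_nonneg _)]
        change ENNReal.ofReal (|C.adjoint.det| * |C.adjoint.det⁻¹|) * _ = _
        rw [abs_inv, mul_inv_cancel₀ (abs_ne_zero.2 hd0), ENNReal.ofReal_one, one_mul]

/-- Comparison of Gaussian expectations when the covariances are close. -/
theorem lintegral_stdGaussian_comparison (X : Ω →L[ℝ] W) (Y : Ω' →L[ℝ] W)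
    (hY : Function.Injective Y.adjoint) {r : ℝ} (hr0 : 0 ≤ r) (hr1 : r < 1)
    (hl : ∀ w, (1 - r) * ‖Y.adjoint w‖ ^ 2 ≤ ‖X.adjoint w‖ ^ 2)
    (hu : ∀ w, ‖X.adjoint w‖ ^ 2 ≤ (1 + r) * ‖Y.adjoint w‖ ^ 2)
    {h : W → ENNReal} (hh : Measurable h) :
    ENNReal.ofReal (√((1 - r) / (1 + r)) ^ (Module.finrank ℝ W)) * ∫⁻ x, h (X x) ∂(stdGaussian Ω)
      ≤ ∫⁻ x, h (√(1 + r) • Y x) ∂(stdGaussian Ω') := by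
  have hX : Function.Injective X.adjoint := by
    refine (injective_iff_map_eq_zero _).2 fun v hv => ?_
    have := hl v
    rw [hv, norm_zero] at this
    have h0 : ‖Y.adjoint v‖ ^ 2 ≤ 0 := by
      by_contra! h0
      nlinarith
    have : ‖Y.adjoint v‖ = 0 := by nlinarith [norm_nonneg (Y.adjoint v)]
    exact (injective_iff_map_eq_zero _).1 hY v (norm_eq_zero.1 this)
  obtain ⟨T, hT⟩ := exists_end_norm_eq X.adjoint hX
  obtain ⟨R, hR⟩ := exists_end_norm_eq Y.adjoint hY
  have hRinj : Function.Injective (R : W →ₗ[ℝ] W) := by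
    refine (injective_iff_map_eq_zero _).2 fun v hv => ?_
    have : ‖R v‖ = 0 := by rw [show R v = 0 from hv, norm_zero]
    rw [hR] at this
    exact (injective_iff_map_eq_zero _).1 hY v (norm_eq_zero.1 this)
  let R' := LinearEquiv.ofInjectiveEndo (R : W →ₗ[ℝ] W) hRinj
  have hs : 0 < √(1 + r) := Real.sqrt_pos.2 (by linarith)
  let C : W →L[ℝ] W := (√(1 + r))⁻¹ • (T ∘L LinearMap.toContinuousLinearMap R'.symm.toLinearMap)
  have hC : ∀ w, C (R w) = (√(1 + r))⁻¹ • T w := by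
    intro w
    have : R'.symm (R w) = w := R'.symm_apply_apply w
    simp [C, this]
  have hRs : ∀ v, ∃ w, R w = v := fun v => ⟨R'.symm v, R'.apply_symm_apply v⟩
  have hTC : T = √(1 + r) • (C ∘L R) := by
    ext w
    simp [hC, smul_smul, mul_inv_cancel₀ hs.ne']
  have hXm : (stdGaussian Ω).map X = (stdGaussian W).map T.adjoint := by
    apply map_stdGaussian_eq_of_norm
    simp [hT]
  have hYm : (stdGaussian Ω').map Y = (stdGaussian W).map R.adjoint := by
    apply map_stdGaussian_eq_of_norm
    simp [hR]
  have hnC : ∀ w, ‖C (R w)‖ = (√(1 + r))⁻¹ * ‖T w‖ := by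
    intro w
    rw [hC, norm_smul, norm_inv, Real.norm_of_nonneg hs.le]
  have key := lintegral_le_of_contraction C (a := √((1 - r) / (1 + r)))
    (Real.sqrt_pos.2 (div_pos (by linarith) (by linarith)))
    (by
      intro v
      obtain ⟨w, rfl⟩ := hRs v
      rw [hnC, hT, hR, Real.sqrt_div' _ (by linarith), div_eq_inv_mul, mul_assoc]
      gcongr
      rw [← Real.sqrt_sq (norm_nonneg (X.adjoint w)), ← Real.sqrt_sq (norm_nonneg (Y.adjoint w)), ← Real.sqrt_mul (by linarith)]
      exact Real.sqrt_le_sqrt (hl w))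
    (by
      intro v
      obtain ⟨w, rfl⟩ := hRs v
      rw [hnC, hT, hR, inv_mul_le_iff₀ hs]
      rw [← Real.sqrt_sq (norm_nonneg (X.adjoint w)), ← Real.sqrt_sq (norm_nonneg (Y.adjoint w)), ← Real.sqrt_mul (by linarith)]
      exact Real.sqrt_le_sqrt (hu w)) (h := fun x => h (√(1 + r) • R.adjoint x)) (by fun_prop)
  have e1 : ∫⁻ x, h (X x) ∂(stdGaussian Ω) = ∫⁻ x, h (√(1 + r) • R.adjoint (C.adjoint x)) ∂(stdGaussian W) := by
    rw [← lintegral_map hh X.measurable, hXm, lintegral_map hh T.adjoint.measurable]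
    have : T.adjoint = √(1 + r) • (R.adjoint ∘L C.adjoint) := by
      conv_lhs => rw [hTC]
      rw [map_smulₛₗ, ContinuousLinearMap.adjoint_comp]
      simp
    simp [this]
  have e2 : ∫⁻ x, h (√(1 + r) • Y x) ∂(stdGaussian Ω') = ∫⁻ x, h (√(1 + r) • R.adjoint x) ∂(stdGaussian W) := by
    have hh' : Measurable fun y => h (√(1 + r) • y) := by fun_prop
    rw [← lintegral_map hh' Y.measurable, hYm, lintegral_map hh' R.adjoint.measurable]
  rw [e1, e2]
  exact key

/-- Comparison of Gaussian expectations for families of linear forms with close Gram matrices. -/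
theorem lintegral_inner_comparison {κ : Type*} [Fintype κ] (a : κ → Ω) (b : κ → Ω')
    (hb : ∀ w : κ → ℝ, ∑ k, w k • b k = 0 → w = 0) {r : ℝ} (hr0 : 0 ≤ r) (hr1 : r < 1)
    (hl : ∀ w : κ → ℝ, (1 - r) * ‖∑ k, w k • b k‖ ^ 2 ≤ ‖∑ k, w k • a k‖ ^ 2)
    (hu : ∀ w : κ → ℝ, ‖∑ k, w k • a k‖ ^ 2 ≤ (1 + r) * ‖∑ k, w k • b k‖ ^ 2)
    {h : (κ → ℝ) → ENNReal} (hh : Measurable h) :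
    ENNReal.ofReal (√((1 - r) / (1 + r)) ^ (Fintype.card κ)) *
        ∫⁻ x, h (fun k => inner ℝ (a k) x) ∂(stdGaussian Ω)
      ≤ ∫⁻ x, h (fun k => √(1 + r) * inner ℝ (b k) x) ∂(stdGaussian Ω') := by
  let X : Ω →L[ℝ] EuclideanSpace ℝ κ :=
    (EuclideanSpace.equiv κ ℝ).symm.toContinuousLinearMap ∘L ContinuousLinearMap.pi fun k => innerSL ℝ (a k)
  let Y : Ω' →L[ℝ] EuclideanSpace ℝ κ :=
    (EuclideanSpace.equiv κ ℝ).symm.toContinuousLinearMap ∘L ContinuousLinearMap.pi fun k => innerSL ℝ (b k)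
  have hXa : ∀ w, X.adjoint w = ∑ k, w k • a k := by
    intro w
    refine ext_inner_right ℝ fun x => ?_
    rw [ContinuousLinearMap.adjoint_inner_left, sum_inner, PiLp.inner_apply]
    refine Finset.sum_congr rfl fun k _ => ?_
    simp [X, inner_smul_left, mul_comm]
  have hYa : ∀ w, Y.adjoint w = ∑ k, w k • b k := by
    intro w
    refine ext_inner_right ℝ fun x => ?_
    rw [ContinuousLinearMap.adjoint_inner_left, sum_inner, PiLp.inner_apply]
    refine Finset.sum_congr rfl fun k _ => ?_
    simp [Y, inner_smul_left, mul_comm]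
  have := lintegral_stdGaussian_comparison X Y (by
      refine (injective_iff_map_eq_zero _).2 fun v hv => ?_
      rw [hYa] at hv
      ext k
      exact congrFun (hb _ hv) k) hr0 hr1 (by intro w; rw [hXa, hYa]; exact hl _)
      (by intro w; rw [hXa, hYa]; exact hu _) (h := fun w => h (fun k => w k)) (by fun_prop)
  rw [finrank_euclideanSpace] at this
  exact this
end

section
variable {Z : Type*} [NormedAddCommGroup Z] [NormedSpace ℝ Z] [FiniteDimensional ℝ Z]
  [MeasurableSpace Z] [BorelSpace Z]
variable {Ω : Type*} [NormedAddCommGroup Ω] [InnerProductSpace ℝ Ω] [FiniteDimensional ℝ Ω]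
  [MeasurableSpace Ω] [BorelSpace Ω]

theorem lintegral_comp_clm (μ : Measure Z) [μ.IsAddHaarMeasure] (f : Z →L[ℝ] Z) (hf : f.det ≠ 0)
    {h : Z → ENNReal} (hh : Measurable h) :
    ∫⁻ x, h (f x) ∂μ = ENNReal.ofReal |f.det|⁻¹ * ∫⁻ x, h x ∂μ := by
  have := Measure.map_linearMap_addHaar_eq_smul_addHaar μ (f := (f : Z →ₗ[ℝ] Z)) hf
  rw [← lintegral_map hh f.measurable]
  change ∫⁻ x, h x ∂(Measure.map (f : Z →ₗ[ℝ] Z) μ) = _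
  rw [this, lintegral_smul_measure, smul_eq_mul, abs_inv]

/-- Two weights in the complementary directions can be exchanged. -/
theorem lintegral_weight_exchange (μ : Measure Z) [μ.IsAddHaarMeasure] (J : Z →L[ℝ] Ω) (M : Ω →L[ℝ] Z)
    (hMJ : ∀ z, M (J z) = z) {H : Ω → ENNReal} (hH : Measurable H) (hJ : ∀ ω z, H (ω + J z) = H ω)
    {k k' : Z → ENNReal} (hk : Measurable k) (hk' : Measurable k') :
    (∫⁻ ω, H ω * k (M ω)) * ∫⁻ z, k' z ∂μ = (∫⁻ ω, H ω * k' (M ω)) * ∫⁻ z, k z ∂μ := by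
  have e1 : (∫⁻ ω, H ω * k (M ω)) * ∫⁻ z, k' z ∂μ
      = ∫⁻ ω, ∫⁻ z, H ω * k (M ω) * k' (z + M ω) ∂μ := by
    rw [← lintegral_mul_const _ (by fun_prop)]
    refine lintegral_congr fun ω => ?_
    rw [lintegral_const_mul _ (by fun_prop), lintegral_add_right_eq_self (μ := μ)]
  rw [e1, lintegral_lintegral_swap (by fun_prop)]
  have e2 : ∀ z, ∫⁻ ω, H ω * k (M ω) * k' (z + M ω) = ∫⁻ ω, H ω * k (M ω - z) * k' (M ω) := by
    intro z
    rw [← lintegral_add_right_eq_self (μ := (volume : Measure Ω)) (fun ω => H ω * k (M ω - z) * k' (M ω)) (J z)]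
    refine lintegral_congr fun ω => ?_
    simp [hJ, hMJ, add_comm]
  simp_rw [e2]
  rw [lintegral_lintegral_swap (by fun_prop), ← lintegral_mul_const _ (by fun_prop)]
  refine lintegral_congr fun ω => ?_
  have e3 : ∀ z, H ω * k (M ω - z) * k' (M ω) = H ω * k' (M ω) * k (M ω - z) := fun z => by ring
  simp_rw [e3]
  rw [lintegral_const_mul _ (by fun_prop), lintegral_sub_left_eq_self (μ := μ)]

theorem abs_det_one_add_comp (U : Z →L[ℝ] Ω) (J : Z →L[ℝ] Ω) (M : Ω →L[ℝ] Z)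
    (hMJ : ∀ z, M (J z) = z) (hMU : ∀ z, M (U z) = 0) :
    |(ContinuousLinearMap.id ℝ Ω + U ∘L M).det| = 1 := by
  let A : Ω →ₗ[ℝ] Ω := ((ContinuousLinearMap.id ℝ Ω - (2 : ℝ) • (J ∘L M) : Ω →L[ℝ] Ω) : Ω →ₗ[ℝ] Ω)
  let K : Ω →ₗ[ℝ] Ω := (U ∘L M : Ω →L[ℝ] Ω)
  have hA : A * A = 1 := by
    ext ω
    simp [A, hMJ]
    module
  have hAK : A * (1 + K) * A = 1 - K := by
    ext ω
    simp [A, K, hMJ, hMU]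
    module
  have hK : (1 + K) * (1 - K) = 1 := by
    ext ω
    simp [K, hMU]
  have h1 := congrArg LinearMap.det hA
  have h2 := congrArg LinearMap.det hAK
  have h3 := congrArg LinearMap.det hK
  simp only [map_mul, map_one] at h1 h2 h3
  have h4 : LinearMap.det (1 + K) * LinearMap.det (1 + K) = 1 := by
    rw [← h2] at h3
    linear_combination h3 - LinearMap.det (1 + K) * LinearMap.det (1 + K) * h1
  change |LinearMap.det (1 + K)| = 1
  have h5 : |LinearMap.det (1 + K)| * |LinearMap.det (1 + K)| = 1 := by rw [← abs_mul, h4, abs_one]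
  nlinarith [abs_nonneg (LinearMap.det (1 + K))]

theorem gaussDensity_eq_of_sq {ω ω' : Ω} {s : ℝ} (h : ‖ω‖ ^ 2 = ‖ω'‖ ^ 2 + s) :
    gaussDensity Ω ω = gaussDensity Ω ω' * ENNReal.ofReal (rexp (-s / 2)) := by
  unfold gaussDensity
  rw [← ENNReal.ofReal_mul (by positivity), mul_assoc, ← Real.exp_add, h]
  congr 3
  ring

theorem lintegral_projection (μ : Measure Z) [μ.IsAddHaarMeasure] (S J : Z →L[ℝ] Ω) (M : Ω →L[ℝ] Z)
    (hMJ : ∀ z, M (J z) = z) (V : Z →L[ℝ] Z) (hV : ∀ z, M (S (V z)) = z) (q : Z → ℝ)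
    (hqm : Measurable q)
    (hq : ∀ ω, ‖ω‖ ^ 2 = ‖ω - J (M ω)‖ ^ 2 + q (M ω)) {h : Ω → ENNReal} (hh : Measurable h)
    {κ : Z → ENNReal} (hκ : Measurable κ) (hκ1 : ∫⁻ z, κ z ∂μ = 1) :
    (∫⁻ ω, h (ω - S (V (M ω))) * κ (- V (M ω)) * gaussDensity Ω (ω - S (V (M ω)))) *
      ∫⁻ z, ENNReal.ofReal (rexp (-q z / 2)) ∂μ
     = ENNReal.ofReal |V.det|⁻¹ * ∫⁻ ω, h (ω - J (M ω)) ∂(stdGaussian Ω) := by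
  have hd := abs_det_one_add_comp (S ∘L V - J) J M hMJ (by simp [hV, hMJ])
  set T := ContinuousLinearMap.id ℝ Ω + (S ∘L V - J) ∘L M with hT
  have hVd : V.det ≠ 0 := by
    have h1 : (M ∘L S : Z →L[ℝ] Z).toLinearMap * V.toLinearMap = 1 := by ext z; simp [hV]
    have h2 := congrArg LinearMap.det h1
    rw [map_mul, map_one] at h2
    exact right_ne_zero_of_mul_eq_one h2
  have hVd' : (-V).det ≠ 0 := by
    have : IsUnit V.toLinearMap := (LinearMap.isUnit_iff_isUnit_det _).2 (isUnit_iff_ne_zero.2 hVd)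
    have h2 := (LinearMap.isUnit_iff_isUnit_det _).1 this.neg
    exact h2.ne_zero
  have habs : |(-V).det| = |V.det| := by
    have : -V.toLinearMap = (-1 : ℝ) • V.toLinearMap := by simp
    change |LinearMap.det (-V.toLinearMap)| = |LinearMap.det V.toLinearMap|
    rw [this, LinearMap.det_smul, abs_mul]
    simp
  have hg : Measurable (gaussDensity Ω) := measurable_gaussDensity
  have e1 : ∫⁻ ω, h (ω - S (V (M ω))) * κ (- V (M ω)) * gaussDensity Ω (ω - S (V (M ω)))
      = ∫⁻ ω, (h (ω - J (M ω)) * gaussDensity Ω (ω - J (M ω))) * κ (- V (M ω)) := by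
    have := lintegral_comp_clm (volume : Measure Ω) T (by intro h0; simp [h0] at hd)
      (h := fun ω => h (ω - S (V (M ω))) * κ (- V (M ω)) * gaussDensity Ω (ω - S (V (M ω)))) (by fun_prop)
    rw [hd, inv_one, ENNReal.ofReal_one, one_mul] at this
    rw [← this]
    refine lintegral_congr fun ω => ?_
    have hMT : M (T ω) = M ω := by simp [hT, hV, hMJ]
    have hπ : T ω - S (V (M (T ω))) = ω - J (M ω) := by rw [hMT]; simp [hT]; abel
    rw [hπ, hMT]
    ring
  rw [e1, lintegral_weight_exchange μ J M hMJ (k := fun z => κ (- V z)) (by fun_prop) (by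
    intro ω z; simp [hMJ]) (by fun_prop) (by fun_prop), mul_comm]
  have e2 : ∫⁻ z, κ (-V z) ∂μ = ENNReal.ofReal |V.det|⁻¹ := by
    have := lintegral_comp_clm μ (-V) hVd' hκ
    rw [hκ1, mul_one, habs] at this
    exact this
  rw [e2, lintegral_stdGaussian (by fun_prop)]
  congr 1
  refine lintegral_congr fun ω => ?_
  rw [gaussDensity_eq_of_sq (hq ω)]
  ring
end

section
variable {Z : Type*} [NormedAddCommGroup Z] [NormedSpace ℝ Z] [FiniteDimensional ℝ Z]
  [MeasurableSpace Z] [BorelSpace Z]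
variable {Ω : Type*} [NormedAddCommGroup Ω] [InnerProductSpace ℝ Ω] [FiniteDimensional ℝ Ω]
  [MeasurableSpace Ω] [BorelSpace Ω]

theorem lintegral_stdGaussian₀ {f : Ω → ENNReal} (hf : AEMeasurable f) :
    ∫⁻ x, f x ∂(stdGaussian Ω) = ∫⁻ x, gaussDensity Ω x * f x := by
  rw [stdGaussian_eq_withDensity,
    lintegral_withDensity_eq_lintegral_mul₀ measurable_gaussDensity.aemeasurable hf]
  rfl

/-- The translation along `S` that moves a zero of `ω` to the point `z`. -/
noncomputable def zeroShift (L : Z → Ω →L[ℝ] Z) (S : Z →L[ℝ] Ω) (z : Z) (ω : Ω) : Z :=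
  - (Ring.inverse (L z ∘L S) (L z ω))

variable {L : Z → Ω →L[ℝ] Z} {L' : Z → Z →L[ℝ] (Ω →L[ℝ] Z)} {S : Z →L[ℝ] Ω}

theorem apply_inverse_of_isUnit {T : Z →L[ℝ] Z} (hT : IsUnit T) (v : Z) : T (Ring.inverse T v) = v := by
  have := congrArg (fun U : Z →L[ℝ] Z => U v) (Ring.mul_inverse_cancel _ hT)
  simpa using this

theorem inverse_apply_of_isUnit {T : Z →L[ℝ] Z} (hT : IsUnit T) (v : Z) : Ring.inverse T (T v) = v := by
  have := congrArg (fun U : Z →L[ℝ] Z => U v) (Ring.inverse_mul_cancel _ hT)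
  simpa using this

theorem apply_add_zeroShift {z : Z} (hz : IsUnit (L z ∘L S)) (ω : Ω) :
    L z (ω + S (zeroShift L S z ω)) = 0 := by
  have := apply_inverse_of_isUnit hz (L z ω)
  simp only [ContinuousLinearMap.comp_apply] at this
  simp [zeroShift, this]

theorem zeroShift_eq_iff {z : Z} (hz : IsUnit (L z ∘L S)) (ω : Ω) (ξ : Z) :
    zeroShift L S z ω = ξ ↔ L z (ω + S ξ) = 0 := by
  refine ⟨?_, fun h => ?_⟩
  · rintro rfl; exact apply_add_zeroShift hz ω
  · have h1 : L z ω = - (L z ∘L S) ξ := by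
      rw [map_add] at h; exact eq_neg_of_add_eq_zero_left h
    rw [zeroShift, h1, map_neg, inverse_apply_of_isUnit hz, neg_neg]

theorem differentiableAt_zeroShift (hL : ∀ z, HasFDerivAt L (L' z) z) {p : Z × Ω}
    (hz : IsUnit (L p.1 ∘L S)) : DifferentiableAt ℝ (fun p : Z × Ω => zeroShift L S p.1 p.2) p := by
  have h1 : DifferentiableAt ℝ (fun p : Z × Ω => L p.1) p :=
    (hL p.1).differentiableAt.comp p differentiableAt_fst
  have h2 : DifferentiableAt ℝ (fun p : Z × Ω => L p.1 ∘L S) p :=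
    h1.clm_comp (differentiableAt_const S)
  have h3 : DifferentiableAt ℝ (fun p : Z × Ω => Ring.inverse (L p.1 ∘L S)) p := h2.inverse hz
  exact (h3.clm_apply (h1.clm_apply differentiableAt_snd)).neg

theorem det_fderiv_zeroShift (hL : ∀ z, HasFDerivAt L (L' z) z) {z : Z} (hz : IsUnit (L z ∘L S)) (ω : Ω) :
    DifferentiableAt ℝ (fun z => zeroShift L S z ω) z ∧
    |(L z ∘L S).det| * |(fderiv ℝ (fun z => zeroShift L S z ω) z).det|
      = |((L' z).flip (ω + S (zeroShift L S z ω))).det| := by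
  have hd : DifferentiableAt ℝ (fun z => zeroShift L S z ω) z :=
    DifferentiableAt.comp (g := fun p : Z × Ω => zeroShift L S p.1 p.2) (f := fun z => (z, ω)) z
      (differentiableAt_zeroShift (p := (z, ω)) hL hz)
      (differentiableAt_fun_id.prodMk (differentiableAt_const ω))
  refine ⟨hd, ?_⟩
  have h1 := (hL z).clm_apply ((S.hasFDerivAt.comp z hd.hasFDerivAt).const_add ω)
  have hc : Continuous fun z => L z ∘L S := by
    have : Continuous L := continuous_iff_continuousAt.2 fun z => (hL z).continuousAt
    fun_prop
  have h2 : (fun y => L y (ω + (S ∘ fun z => zeroShift L S z ω) y)) =ᶠ[nhds z] fun _ => (0 : Z) := by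
    filter_upwards [hc.continuousAt.eventually (Units.isOpen.mem_nhds hz)] with y hy
    exact apply_add_zeroShift hy ω
  have h3 := h1.unique ((hasFDerivAt_const (0 : Z) z).congr_of_eventuallyEq h2)
  have h4 : (L z ∘L S) ∘L (fderiv ℝ (fun z => zeroShift L S z ω) z)
      = (-1 : ℝ) • (L' z).flip (ω + S (zeroShift L S z ω)) := by
    rw [neg_one_smul]
    exact eq_neg_of_add_eq_zero_left h3
  have h5 := congrArg (fun T : Z →L[ℝ] Z => |LinearMap.det (T : Z →ₗ[ℝ] Z)|) h4
  simp only [ContinuousLinearMap.toLinearMap_smul,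
    LinearMap.det_smul, abs_mul, abs_pow, abs_neg, abs_one, one_pow, one_mul] at h5
  rw [← abs_mul]
  refine Eq.trans (congrArg _ ?_) h5
  exact (LinearMap.det_comp _ _).symm

theorem aemeasurable_zeroCount_shift (μ : Measure Z) [μ.IsAddHaarMeasure] {B : Set Z}
    (hB : MeasurableSet B) (hL : ∀ z, HasFDerivAt L (L' z) z) (hS : ∀ z ∈ B, IsUnit (L z ∘L S)) :
    AEMeasurable (fun p : Z × Ω => ((B ∩ {z | L z (p.2 + S p.1) = 0}).encard : ENNReal))
      (μ.prod volume) := by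
  let Ψ : Z × Ω → Z × Ω := fun p => (zeroShift L S p.1 p.2, p.2)
  have := (area_formula (μ.prod (volume : Measure Ω)) (f := Ψ) (s := B ×ˢ Set.univ)
    (hB.prod MeasurableSet.univ) (by
      rintro p ⟨hp, -⟩
      exact (differentiableAt_zeroShift hL (hS _ hp)).prodMk differentiableAt_snd)).1
  refine this.congr (Eventually.of_forall fun p => ?_)
  have : B ×ˢ Set.univ ∩ Ψ ⁻¹' {p} = (fun z => (z, p.2)) '' (B ∩ {z | L z (p.2 + S p.1) = 0}) := by
    ext ⟨z, ω⟩
    simp only [Ψ, Set.mem_inter_iff, Set.mem_prod, Set.mem_univ, and_true, Set.mem_preimage,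
      Set.mem_singleton_iff, Set.mem_image, Set.mem_ofPred_eq, Prod.ext_iff]
    constructor
    · rintro ⟨hz, h1, rfl⟩
      exact ⟨z, ⟨hz, (zeroShift_eq_iff (hS z hz) _ _).1 h1⟩, rfl, rfl⟩
    · rintro ⟨z, ⟨hz, h1⟩, rfl, rfl⟩
      exact ⟨hz, (zeroShift_eq_iff (hS z hz) _ _).2 h1, rfl⟩
  simp only [this]
  rw [Function.Injective.encard_image (fun a b h => congrArg Prod.fst h)]

theorem aemeasurable_zeroCount (μ : Measure Z) [μ.IsAddHaarMeasure] {B : Set Z}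
    (hB : MeasurableSet B) (hL : ∀ z, HasFDerivAt L (L' z) z) (hS : ∀ z ∈ B, IsUnit (L z ∘L S)) :
    AEMeasurable (fun ω : Ω => ((B ∩ {z | L z ω = 0}).encard : ENNReal)) := by
  have h1 := aemeasurable_zeroCount_shift μ hB hL hS
  have hmp : MeasurePreserving (fun p : Z × Ω => (p.1, p.2 - S p.1)) (μ.prod volume) (μ.prod volume) :=
    (MeasurePreserving.id μ).skew_product (g := fun a b => b - S a) (by fun_prop)
      (Eventually.of_forall fun a => (measurePreserving_sub_right volume (S a)).map_eq)
  have h2 := h1.comp_quasiMeasurePreserving hmp.quasiMeasurePreserving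
  have h3 : AEMeasurable (fun p : Z × Ω => ((B ∩ {z | L z p.2 = 0}).encard : ENNReal)) (μ.prod volume) := by
    refine h2.congr (Eventually.of_forall fun p => ?_)
    simp
  exact (AEStronglyMeasurable.of_comp_snd (f := fun ω => ((B ∩ {z | L z ω = 0}).encard : ENNReal))
    h3.aestronglyMeasurable (NeZero.ne μ)).aemeasurable
end

section
variable {Z : Type*} [NormedAddCommGroup Z] [NormedSpace ℝ Z] [FiniteDimensional ℝ Z]
  [MeasurableSpace Z] [BorelSpace Z]
variable {Ω : Type*} [NormedAddCommGroup Ω] [InnerProductSpace ℝ Ω] [FiniteDimensional ℝ Ω]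
  [MeasurableSpace Ω] [BorelSpace Ω]
variable {L : Z → Ω →L[ℝ] Z} {L' : Z → Z →L[ℝ] (Ω →L[ℝ] Z)} {S : Z →L[ℝ] Ω}

theorem lintegral_zeroCount_eq (μ : Measure Z) [μ.IsAddHaarMeasure] {B : Set Z}
    (hB : MeasurableSet B) (hL : ∀ z, HasFDerivAt L (L' z) z) (hL' : Continuous L')
    (hS : ∀ z ∈ B, IsUnit (L z ∘L S)) {κ : Z → ENNReal} (hκ : Measurable κ) (hκ1 : ∫⁻ z, κ z ∂μ = 1) :
    ∫⁻ ω, ((B ∩ {z | L z ω = 0}).encard : ENNReal) ∂(stdGaussian Ω) =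
      ∫⁻ z in B, ENNReal.ofReal |(L z ∘L S).det|⁻¹ *
        (∫⁻ ω, ENNReal.ofReal |((L' z).flip (ω + S (zeroShift L S z ω))).det| *
          κ (zeroShift L S z ω) * gaussDensity Ω (ω + S (zeroShift L S z ω))) ∂μ := by
  set N : Ω → ENNReal := fun ω => ((B ∩ {z | L z ω = 0}).encard : ENNReal) with hN
  have hNm : AEMeasurable N := aemeasurable_zeroCount μ hB hL hS
  have hNs := aemeasurable_zeroCount_shift μ hB hL hS
  have hg : Measurable (gaussDensity Ω) := measurable_gaussDensity
  have hLc : Continuous L := continuous_iff_continuousAt.2 fun z => (hL z).continuousAt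
  rw [lintegral_stdGaussian₀ hNm]
  -- average over translations along `S`
  have e1 : ∫⁻ ω, gaussDensity Ω ω * N ω = ∫⁻ ξ, (∫⁻ ω, κ ξ * (gaussDensity Ω (ω + S ξ) * N (ω + S ξ))) ∂μ := by
    have : ∀ ξ, ∫⁻ ω, κ ξ * (gaussDensity Ω (ω + S ξ) * N (ω + S ξ)) = κ ξ * ∫⁻ ω, gaussDensity Ω ω * N ω := by
      intro ξ
      rw [lintegral_const_mul'' _ , lintegral_add_right_eq_self (fun ω => gaussDensity Ω ω * N ω) (S ξ)]
      exact (hg.aemeasurable.mul hNm).comp_quasiMeasurePreserving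
        (measurePreserving_add_right volume (S ξ)).quasiMeasurePreserving
    simp_rw [this]
    rw [lintegral_mul_const _ hκ, hκ1, one_mul]
  rw [e1, lintegral_lintegral_swap]
  swap
  · refine AEMeasurable.mul (by fun_prop) (AEMeasurable.mul (by fun_prop) hNs)
  have e2 : ∀ ω, ∫⁻ ξ, κ ξ * (gaussDensity Ω (ω + S ξ) * N (ω + S ξ)) ∂μ
      = ∫⁻ z in B, ENNReal.ofReal |(L z ∘L S).det|⁻¹ *
        (ENNReal.ofReal |((L' z).flip (ω + S (zeroShift L S z ω))).det| *
          κ (zeroShift L S z ω) * gaussDensity Ω (ω + S (zeroShift L S z ω))) ∂μ := by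
    intro ω
    have haf := (area_formula μ (f := fun z => zeroShift L S z ω) hB
      (fun z hz => (det_fderiv_zeroShift hL (hS z hz) ω).1)).2
      (fun ξ => κ ξ * gaussDensity Ω (ω + S ξ)) (by fun_prop)
    have : ∀ ξ, B ∩ (fun z => zeroShift L S z ω) ⁻¹' {ξ} = B ∩ {z | L z (ω + S ξ) = 0} := by
      intro ξ
      ext z
      simp only [Set.mem_inter_iff, Set.mem_preimage, Set.mem_singleton_iff, Set.mem_ofPred_eq]
      exact and_congr_right fun hz => zeroShift_eq_iff (hS z hz) ω ξ
    simp_rw [this] at haf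
    calc _ = ∫⁻ ξ, ((B ∩ {z | L z (ω + S ξ) = 0}).encard : ENNReal) * (κ ξ * gaussDensity Ω (ω + S ξ)) ∂μ := by
          refine lintegral_congr fun ξ => ?_
          simp only [hN]
          ring
      _ = _ := by
          rw [haf]
          refine setLIntegral_congr_fun hB fun z hz => ?_
          rw [← (det_fderiv_zeroShift hL (hS z hz) ω).2, ENNReal.ofReal_mul (abs_nonneg _)]
          have h0 : |(L z ∘L S).det| ≠ 0 := by
            have := (LinearMap.isUnit_iff_isUnit_det _).1
              (ContinuousLinearMap.isUnit_iff_isUnit_toLinearMap.1 (hS z hz))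
            exact abs_ne_zero.2 this.ne_zero
          simp only [← mul_assoc]
          rw [← ENNReal.ofReal_mul (by positivity), inv_mul_cancel₀ h0, ENNReal.ofReal_one, one_mul]
  simp_rw [e2]
  have hset : (B ×ˢ (Set.univ : Set Ω)) ⊆ {p : Z × Ω | IsUnit (L p.1 ∘L S)} := fun p hp => hS _ hp.1
  have hfc : ContinuousOn (fun p : Z × Ω => zeroShift L S p.1 p.2) (B ×ˢ (Set.univ : Set Ω)) :=
    fun p hp => (differentiableAt_zeroShift hL (hset hp)).continuousAt.continuousWithinAt
  have hms : MeasurableSet (B ×ˢ (Set.univ : Set Ω)) := hB.prod MeasurableSet.univ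
  have hrestr : (μ.restrict B).prod (volume : Measure Ω) = (μ.prod volume).restrict (B ×ˢ (Set.univ : Set Ω)) := by
    rw [← Measure.prod_restrict, Measure.restrict_univ]
  have hfm : AEMeasurable (fun p : Z × Ω => zeroShift L S p.1 p.2) ((μ.restrict B).prod volume) := by
    rw [hrestr]; exact hfc.aemeasurable hms
  have hdetc : Continuous fun T : Z →L[ℝ] Z => T.det := ContinuousLinearMap.continuous_det
  have hpm : AEMeasurable (fun p : Z × Ω => p.2 + S (zeroShift L S p.1 p.2)) ((μ.restrict B).prod volume) :=
    measurable_snd.aemeasurable.add (S.measurable.comp_aemeasurable hfm)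
  have hdm : AEMeasurable (fun p : Z × Ω => ENNReal.ofReal
      |((L' p.1).flip (p.2 + S (zeroShift L S p.1 p.2))).det|) ((μ.restrict B).prod volume) := by
    have hc : Continuous fun p : Z × Ω => ((L' p.1).flip p.2).det := by
      refine hdetc.comp ?_
      have : Continuous fun p : Z × Ω => (ContinuousLinearMap.flipₗᵢ ℝ Z Ω Z (L' p.1)) p.2 := by fun_prop
      exact this
    exact (hc.measurable.comp_aemeasurable (measurable_fst.aemeasurable.prodMk hpm)).abs.ennreal_ofReal
  have hLS : Continuous fun z => (L z ∘L S).det := hdetc.comp (by fun_prop)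
  have hLSm : Measurable fun z => ENNReal.ofReal |(L z ∘L S).det|⁻¹ := by
    exact ((continuous_abs.comp hLS).measurable.inv).ennreal_ofReal
  have hin : AEMeasurable (fun p : Z × Ω => ENNReal.ofReal |((L' p.1).flip (p.2 + S (zeroShift L S p.1 p.2))).det| *
          κ (zeroShift L S p.1 p.2) * gaussDensity Ω (p.2 + S (zeroShift L S p.1 p.2)))
          ((μ.restrict B).prod volume) :=
    (hdm.mul (hκ.comp_aemeasurable hfm)).mul (hg.comp_aemeasurable hpm)
  rw [← lintegral_lintegral_swap]
  swap
  · exact (hLSm.comp measurable_fst).aemeasurable.mul hin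
  refine lintegral_congr fun z => ?_
  rw [lintegral_const_mul' _ _ ENNReal.ofReal_ne_top]

/-- The Kac-Rice formula for the expected number of zeros of a linear family of Gaussian maps. -/
theorem kac_rice (μ : Measure Z) [μ.IsAddHaarMeasure] {B : Set Z}
    (hB : MeasurableSet B) (hL : ∀ z, HasFDerivAt L (L' z) z) (hL' : Continuous L')
    (hS : ∀ z ∈ B, IsUnit (L z ∘L S)) (J : Z → Z →L[ℝ] Ω) (M : Z → Ω →L[ℝ] Z)
    (hMJ : ∀ z ∈ B, ∀ v, M z (J z v) = v) (q : Z → ℝ) (hqm : Measurable q)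
    (hq : ∀ z ∈ B, ∀ ω, ‖ω‖ ^ 2 = ‖ω - J z (M z ω)‖ ^ 2 + q (M z ω))
    (hLM : ∀ z ∈ B, ∀ ω, L z (J z (M z ω)) = L z ω)
    (hc : ∫⁻ z, ENNReal.ofReal (rexp (-q z / 2)) ∂μ ≠ ⊤)  :
    AEMeasurable (fun ω => ((B ∩ {z | L z ω = 0}).encard : ENNReal)) (stdGaussian Ω) ∧
    ∫⁻ ω, ((B ∩ {z | L z ω = 0}).encard : ENNReal) ∂(stdGaussian Ω) =
      ∫⁻ z in B, ENNReal.ofReal |(L z ∘L J z).det|⁻¹ * (∫⁻ z, ENNReal.ofReal (rexp (-q z / 2)) ∂μ)⁻¹ *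
        (∫⁻ ω, ENNReal.ofReal |((L' z).flip (ω - J z (M z ω))).det| ∂(stdGaussian Ω)) ∂μ := by
  constructor
  · refine (aemeasurable_zeroCount μ hB hL hS).mono_ac ?_
    rw [stdGaussian_eq_withDensity]
    exact withDensity_absolutelyContinuous _ _
  set c := ∫⁻ z, ENNReal.ofReal (rexp (-q z / 2)) ∂μ with hcdef
  have hem : Measurable fun z => ENNReal.ofReal (rexp (-q z / 2)) := by fun_prop
  have hc0 : c ≠ 0 := by
    intro h0
    have h1 := (lintegral_eq_zero_iff hem).1 h0
    have h2 : ∀ᵐ z ∂μ, False := by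
      filter_upwards [h1] with z hz
      have := Real.exp_pos (-q z / 2)
      simp at hz
      linarith
    have : (μ : Measure Z) = 0 := by
      rw [← ae_eq_bot]; exact (eventually_false_iff_eq_bot).1 h2
    exact NeZero.ne μ this
  rw [lintegral_zeroCount_eq μ hB hL hL' hS (κ := fun z => c⁻¹ * ENNReal.ofReal (rexp (-q z / 2)))
    (by fun_prop) (by rw [lintegral_const_mul _ hem, ← hcdef, ENNReal.inv_mul_cancel hc0 hc])]
  refine setLIntegral_congr_fun hB fun z hz => ?_
  have hu := hS z hz
  have hdet0 : ((L z ∘L S).det) ≠ 0 := by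
    have := (LinearMap.isUnit_iff_isUnit_det _).1
      (ContinuousLinearMap.isUnit_iff_isUnit_toLinearMap.1 hu)
    exact this.ne_zero
  set V : Z →L[ℝ] Z := Ring.inverse (L z ∘L S) ∘L (L z ∘L J z) with hV
  have hcomp : (L z ∘L S) = (L z ∘L J z) ∘L (M z ∘L S) := by
    ext v; simp [hLM z hz]
  have hdetmul : (L z ∘L S).det = (L z ∘L J z).det * (M z ∘L S).det := by
    conv_lhs => rw [hcomp]
    exact LinearMap.det_comp _ _
  have hdJ : (L z ∘L J z).det ≠ 0 := by
    intro h0; rw [h0, zero_mul] at hdetmul; exact hdet0 hdetmul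
  have hinjJ : Function.Injective (L z ∘L J z) := by
    have : IsUnit ((L z ∘L J z : Z →L[ℝ] Z) : Z →ₗ[ℝ] Z) :=
      (LinearMap.isUnit_iff_isUnit_det _).2 (isUnit_iff_ne_zero.2 hdJ)
    exact ((Module.End.isUnit_iff _).1 this).1
  have hVz : ∀ v, M z (S (V v)) = v := by
    intro v
    apply hinjJ
    have h1 := apply_inverse_of_isUnit hu (L z (J z v))
    have h2 := congrArg (fun T : Z →L[ℝ] Z => T (V v)) hcomp
    simp only [ContinuousLinearMap.comp_apply] at h1 h2 ⊢
    rw [← h2, hV]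
    exact h1
  have hVM : ∀ ω, zeroShift L S z ω = - V (M z ω) := by
    intro ω
    simp [zeroShift, hV, hLM z hz]
  have hdetV : (L z ∘L S).det * V.det = (L z ∘L J z).det := by
    have : (L z ∘L S) ∘L V = L z ∘L J z := by
      ext v
      exact apply_inverse_of_isUnit hu (L z (J z v))
    rw [← this]
    exact (LinearMap.det_comp _ _).symm
  have hflip : Measurable fun ω => ENNReal.ofReal |((L' z).flip ω).det| := by
    have hc : Continuous fun ω => ((L' z).flip ω).det :=
      ContinuousLinearMap.continuous_det.comp (by fun_prop)
    exact hc.abs.measurable.ennreal_ofReal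
  have key := lintegral_projection μ S (J z) (M z) (hMJ z hz) V hVz q hqm (hq z hz)
    (h := fun ω => ENNReal.ofReal |((L' z).flip ω).det|) hflip
    (κ := fun z => c⁻¹ * ENNReal.ofReal (rexp (-q z / 2))) (by fun_prop)
    (by rw [lintegral_const_mul _ hem, ← hcdef, ENNReal.inv_mul_cancel hc0 hc])
  rw [← hcdef] at key
  simp_rw [hVM]
  simp only [map_neg, ← sub_eq_add_neg]
  have key2 := congrArg (fun a => ENNReal.ofReal |(L z ∘L S).det|⁻¹ * c⁻¹ * a) key
  rw [← hdetV, abs_mul, mul_inv, ENNReal.ofReal_mul (by positivity)]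
  calc _ = ENNReal.ofReal |(L z ∘L S).det|⁻¹ * c⁻¹ * (_ * c) := by
        rw [mul_assoc, mul_comm _ c, ← mul_assoc c⁻¹, ENNReal.inv_mul_cancel hc0 hc, one_mul]
    _ = _ := key2
    _ = _ := by ring
end

section
variable {K ι : Type*} [Fintype K] [Fintype ι] [DecidableEq K] [DecidableEq ι]
variable {H : Type*} [NormedAddCommGroup H] [InnerProductSpace ℝ H] [FiniteDimensional ℝ H]
  [MeasurableSpace H] [BorelSpace H]

theorem det_pi_lin (T : (K → ι → ℝ) →ₗ[ℝ] (K → ι → ℝ)) (G : Matrix K K ℝ)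
    (h : ∀ η a ℓ, T η a ℓ = ∑ b, G a b * η b ℓ) : LinearMap.det T = G.det ^ Fintype.card ι := by
  let e : (K → ι → ℝ) ≃ₗ[ℝ] (ι → K → ℝ) :=
    { toFun := fun η ℓ a => η a ℓ
      map_add' := fun _ _ => rfl
      map_smul' := fun _ _ => rfl
      invFun := fun η a ℓ => η ℓ a
      left_inv := fun _ => rfl
      right_inv := fun _ => rfl }
  rw [← LinearMap.det_conj T e]
  have : (e ∘ₗ T ∘ₗ (e.symm : (ι → K → ℝ) →ₗ[ℝ] (K → ι → ℝ))) =
      LinearMap.pi (fun ℓ => (Matrix.toLin' G) ∘ₗ LinearMap.proj ℓ) := by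
    refine LinearMap.ext fun η => ?_
    funext ℓ a
    simp only [LinearMap.comp_apply, LinearMap.pi_apply, LinearMap.proj_apply]
    change T _ a ℓ = _
    rw [h]
    rfl
  erw [this, LinearMap.det_pi]
  simp

theorem det_pi_block (T : (K → ι → ℝ) →ₗ[ℝ] (K → ι → ℝ)) (A : K → Matrix ι ι ℝ)
    (h : ∀ v a ℓ, T v a ℓ = ∑ i, A a ℓ i * v a i) : LinearMap.det T = ∏ a, (A a).det := by
  have : T = LinearMap.pi (fun a => (Matrix.toLin' (A a)) ∘ₗ LinearMap.proj a) := by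
    refine LinearMap.ext fun η => ?_
    funext a ℓ
    rw [h]
    rfl
  rw [this, LinearMap.det_pi]
  simp

theorem lintegral_gauss_pi :
    ∫⁻ z : K → ι → ℝ, ENNReal.ofReal (rexp (-(∑ a, ∑ ℓ, z a ℓ ^ 2) / 2)) =
      ENNReal.ofReal (√(2 * π)) ^ (Fintype.card K * Fintype.card ι) := by
  have h1 : Integrable (fun t : ℝ => rexp (-(1/2) * t ^ 2)) :=
    integrable_exp_neg_mul_sq (by norm_num)
  have h2 : Integrable (fun v : ι → ℝ => ∏ ℓ, rexp (-(1/2) * v ℓ ^ 2)) :=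
    Integrable.fintype_prod (fun _ => h1)
  have h3 : Integrable (fun v : K → ι → ℝ => ∏ a, ∏ ℓ, rexp (-(1/2) * v a ℓ ^ 2)) :=
    Integrable.fintype_prod (f := fun (_ : K) (v : ι → ℝ) => ∏ ℓ, rexp (-(1/2) * v ℓ ^ 2))
      (fun _ => h2)
  have h4 : ∀ z : K → ι → ℝ, rexp (-(∑ a, ∑ ℓ, z a ℓ ^ 2) / 2) =
      ∏ a, ∏ ℓ, rexp (-(1/2) * z a ℓ ^ 2) := by
    intro z
    simp_rw [← Real.exp_sum, ← Finset.mul_sum]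
    congr 1; ring
  simp_rw [h4]
  rw [← ofReal_integral_eq_lintegral_ofReal h3 (Eventually.of_forall fun z => by positivity),
    ← ENNReal.ofReal_pow (by positivity)]
  congr 1
  rw [integral_fintype_prod_volume_eq_pow (fun v : ι → ℝ => ∏ ℓ, rexp (-(1/2) * v ℓ ^ 2)),
    integral_fintype_prod_volume_eq_pow (fun t : ℝ => rexp (-(1/2) * t ^ 2)), integral_gaussian,
    ← pow_mul, mul_comm]
  congr 2
  ring

/-- Evaluation of a tuple of `H`-valued coefficients against a tuple of features. -/
noncomputable def pairingMap (K ι H : Type*) [Fintype K] [Fintype ι] [NormedAddCommGroup H]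
    [InnerProductSpace ℝ H] [FiniteDimensional ℝ H] :
    (K → H) →L[ℝ] (PiLp 2 (fun _ : ι => H) →L[ℝ] (K → ι → ℝ)) :=
  LinearMap.toContinuousLinearMap
    { toFun := fun f => LinearMap.toContinuousLinearMap
        { toFun := fun ω a ℓ => inner ℝ (f a) (ω ℓ)
          map_add' := fun x y => by ext; simp [inner_add_right]
          map_smul' := fun c x => by ext; simp [inner_smul_right] }
      map_add' := fun x y => by ext; simp [inner_add_left]
      map_smul' := fun c x => by ext; simp [inner_smul_left] }

@[simp] theorem pairingMap_apply (f : K → H) (ω : PiLp 2 (fun _ : ι => H)) (a : K) (ℓ : ι) :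
    pairingMap K ι H f ω a ℓ = inner ℝ (f a) (ω ℓ) := rfl

/-- Linear combination of fixed features. -/
noncomputable def combMap (ι : Type*) [Fintype ι] (s : K → H) :
    (K → ι → ℝ) →L[ℝ] PiLp 2 (fun _ : ι => H) :=
  LinearMap.toContinuousLinearMap
    { toFun := fun η => WithLp.toLp 2 (fun ℓ => ∑ b, η b ℓ • s b)
      map_add' := fun x y => by ext; simp [add_smul, Finset.sum_add_distrib]
      map_smul' := fun c x => by ext; simp [mul_smul, Finset.smul_sum] }

@[simp] theorem combMap_apply (s : K → H) (η : K → ι → ℝ) (ℓ : ι) :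
    combMap ι s η ℓ = ∑ b, η b ℓ • s b := rfl

theorem det_pairing_comb (f s : K → H) :
    ((pairingMap K ι H f ∘L combMap ι s)).det =
      (Matrix.of fun a b => inner ℝ (f a) (s b)).det ^ Fintype.card ι := by
  refine det_pi_lin _ _ fun η a ℓ => ?_
  change inner ℝ (f a) (∑ b, η b ℓ • s b) = _
  simp [inner_sum, inner_smul_right, mul_comm]

/-- An orthonormal basis of the span of a linearly independent family. -/
theorem exists_orthonormal_of_det_ne_zero (f s : K → H)
    (h : (Matrix.of fun a b => inner ℝ (f a) (s b)).det ≠ 0) :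
    ∃ u : K → H, Orthonormal ℝ u ∧
      (∀ x, (Submodule.span ℝ (Set.range f)).starProjection x = ∑ b, inner ℝ (u b) x • u b) := by
  have hli : LinearIndependent ℝ f := by
    rw [Fintype.linearIndependent_iff]
    intro g hg
    have h1 : Matrix.vecMul g (Matrix.of fun a b => inner ℝ (f a) (s b)) = 0 := by
      funext b
      have := congrArg (fun x => inner ℝ x (s b)) hg
      simpa [sum_inner, inner_smul_left, Matrix.vecMul, dotProduct] using this
    have := Matrix.eq_zero_of_vecMul_eq_zero h h1
    exact fun i => congrFun this i
  have hfr : Module.finrank ℝ (Submodule.span ℝ (Set.range f)) = Fintype.card K :=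
    finrank_span_eq_card hli
  let b := (stdOrthonormalBasis ℝ (Submodule.span ℝ (Set.range f))).reindex
    (Fintype.equivOfCardEq (by simp [hfr]) : _ ≃ K)
  refine ⟨fun k => b k, ?_, ?_⟩
  · have := b.orthonormal
    rw [orthonormal_iff_ite] at this ⊢
    exact this
  · intro x
    have := OrthonormalBasis.starProjection_eq_sum_rankOne b
    rw [this]
    simp [InnerProductSpace.rankOne_apply]

theorem abs_det_inner_of_projection (f u : K → H) (hu : Orthonormal ℝ u)
    (hf : ∀ a, ∑ b, inner ℝ (u b) (f a) • u b = f a) :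
    |(Matrix.of fun a b => inner ℝ (f a) (u b)).det| = √(Matrix.gram ℝ f).det := by
  have : Matrix.gram ℝ f = (Matrix.of fun a b => inner ℝ (f a) (u b)) *
      (Matrix.of fun a b => inner ℝ (f a) (u b)).transpose := by
    ext a b
    rw [Matrix.gram_apply, Matrix.mul_apply]
    conv_lhs => rw [← hf b]
    simp only [inner_sum, inner_smul_right, Matrix.of_apply, Matrix.transpose_apply]
    refine Finset.sum_congr rfl fun k _ => ?_
    rw [real_inner_comm (u k) (f b)]
    ring
  rw [this, Matrix.det_mul, Matrix.det_transpose, ← pow_two, Real.sqrt_sq_eq_abs]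

variable {F : (ι → ℝ) → H} {F' : (ι → ℝ) → (ι → ℝ) →L[ℝ] H}

/-- Kac-Rice formula for tuples of zeros of `card ι` independent Gaussian combinations of
a feature map. -/
theorem multi_kac_rice (hF : ∀ x, HasFDerivAt F (F' x) x) (hF' : Continuous F')
    {B : Set (K → ι → ℝ)} (hB : MeasurableSet B) (s : K → H)
    (hs : ∀ z ∈ B, (Matrix.of fun a b => inner ℝ (F (z a)) (s b)).det ≠ 0) :
    AEMeasurable (fun ω : PiLp 2 (fun _ : ι => H) =>
      ((B ∩ {z | ∀ a ℓ, inner ℝ (F (z a)) (ω ℓ) = 0}).encard : ENNReal)) (stdGaussian _) ∧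
    ∫⁻ ω, ((B ∩ {z | ∀ a ℓ, inner ℝ (F (z a)) (ω ℓ) = 0}).encard : ENNReal)
        ∂(stdGaussian (PiLp 2 (fun _ : ι => H))) =
      ∫⁻ z in B, ENNReal.ofReal ((√(Matrix.gram ℝ (fun a => F (z a))).det ^ Fintype.card ι)⁻¹) *
        (ENNReal.ofReal (√(2 * π)) ^ (Fintype.card K * Fintype.card ι))⁻¹ *
        (∫⁻ ω, ENNReal.ofReal (∏ a, |(Matrix.of fun ℓ i : ι =>
          (inner ℝ ((Submodule.span ℝ (Set.range fun a => F (z a)))ᗮ.starProjection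
            (F' (z a) (Pi.single i 1))) (ω ℓ) : ℝ)).det|)
          ∂(stdGaussian (PiLp 2 (fun _ : ι => H)))) := by
  classical
  have hcz : ∀ z ∈ B, ∃ u : K → H, Orthonormal ℝ u ∧
      (∀ x, (Submodule.span ℝ (Set.range fun a => F (z a))).starProjection x =
        ∑ b, inner ℝ (u b) x • u b) := fun z hz => exists_orthonormal_of_det_ne_zero _ s (hs z hz)
  choose! u hu hP using hcz
  let L : (K → ι → ℝ) → PiLp 2 (fun _ : ι => H) →L[ℝ] (K → ι → ℝ) :=
    fun z => pairingMap K ι H (fun a => F (z a))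
  let L' : (K → ι → ℝ) → (K → ι → ℝ) →L[ℝ] (PiLp 2 (fun _ : ι => H) →L[ℝ] (K → ι → ℝ)) :=
    fun z => pairingMap K ι H ∘L
      ContinuousLinearMap.pi (fun a => (F' (z a)) ∘L ContinuousLinearMap.proj a)
  have hL : ∀ z, HasFDerivAt L (L' z) z := by
    intro z
    have h1 : HasFDerivAt (fun (z : K → ι → ℝ) a => F (z a))
        (ContinuousLinearMap.pi (fun a => (F' (z a)) ∘L ContinuousLinearMap.proj a)) z :=
      hasFDerivAt_pi.2 fun a => (hF (z a)).comp z
        (ContinuousLinearMap.proj a : (K → ι → ℝ) →L[ℝ] (ι → ℝ)).hasFDerivAt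
    have h2 : HasFDerivAt (pairingMap K ι H) (pairingMap K ι H) (fun a => F (z a)) :=
      (pairingMap K ι H).hasFDerivAt
    exact HasFDerivAt.comp (E := K → ι → ℝ) (F := K → H)
      (G := PiLp 2 (fun _ : ι => H) →L[ℝ] (K → ι → ℝ)) z h2 h1
  have hpi : Continuous fun z : K → ι → ℝ =>
      (ContinuousLinearMap.pi (fun a => (F' (z a)) ∘L ContinuousLinearMap.proj a) :
        (K → ι → ℝ) →L[ℝ] (K → H)) := by
    have hc : ∀ a, Continuous fun z : K → ι → ℝ =>
        ((F' (z a)) ∘L ContinuousLinearMap.proj a : (K → ι → ℝ) →L[ℝ] H) := fun a =>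
      (hF'.comp (continuous_apply a)).clm_comp continuous_const
    rw [continuous_clm_apply]
    intro v
    refine continuous_pi fun a => ?_
    exact (hc a).clm_apply continuous_const
  have hL' : Continuous L' := by
    have h3 : Continuous fun _ : K → ι → ℝ => pairingMap K ι H := continuous_const
    exact Continuous.clm_comp (E := K → ι → ℝ) (F := K → H)
      (G := PiLp 2 (fun _ : ι => H) →L[ℝ] (K → ι → ℝ)) h3 hpi
  have hS : ∀ z ∈ B, IsUnit (L z ∘L combMap ι s) := by
    intro z hz
    rw [ContinuousLinearMap.isUnit_iff_isUnit_toLinearMap, LinearMap.isUnit_iff_isUnit_det,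
      isUnit_iff_ne_zero]
    have := det_pairing_comb (ι := ι) (fun a => F (z a)) s
    change (L z ∘L combMap ι s).det ≠ 0
    rw [this]
    exact pow_ne_zero _ (hs z hz)
  let M : (K → ι → ℝ) → PiLp 2 (fun _ : ι => H) →L[ℝ] (K → ι → ℝ) := fun z => pairingMap K ι H (u z)
  let J : (K → ι → ℝ) → (K → ι → ℝ) →L[ℝ] PiLp 2 (fun _ : ι => H) := fun z => combMap ι (u z)
  have hMJ : ∀ z ∈ B, ∀ v, M z (J z v) = v := by
    intro z hz v
    funext a ℓ
    change inner ℝ (u z a) (∑ b, v b ℓ • u z b) = _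
    exact (hu z hz).inner_right_fintype (fun b => v b ℓ) a
  have hJM : ∀ z ∈ B, ∀ ω ℓ, J z (M z ω) ℓ =
      (Submodule.span ℝ (Set.range fun a => F (z a))).starProjection (ω ℓ) := by
    intro z hz ω ℓ
    rw [hP z hz]; rfl
  have hPf : ∀ z ∈ B, ∀ a, ∑ b, inner ℝ (u z b) (F (z a)) • u z b = F (z a) := by
    intro z hz a
    rw [← hP z hz]
    exact Submodule.starProjection_eq_self_iff.2 (Submodule.subset_span ⟨a, rfl⟩)
  have hsub : ∀ z ∈ B, ∀ ω ℓ, (ω - J z (M z ω)) ℓ =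
      (Submodule.span ℝ (Set.range fun a => F (z a)))ᗮ.starProjection (ω ℓ) := by
    intro z hz ω ℓ
    rw [PiLp.sub_apply, hJM z hz, Submodule.starProjection_orthogonal_val]
  obtain ⟨h1, h2⟩ := kac_rice (volume : Measure (K → ι → ℝ)) hB hL hL' hS J M hMJ
    (fun η => ∑ a, ∑ ℓ, η a ℓ ^ 2) (by fun_prop) (by
      intro z hz ω
      rw [PiLp.norm_sq_eq_of_L2, PiLp.norm_sq_eq_of_L2, Finset.sum_comm (s := (Finset.univ : Finset K)),
        ← Finset.sum_add_distrib]
      refine Finset.sum_congr rfl fun ℓ _ => ?_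
      rw [hsub z hz, Submodule.norm_sq_eq_add_norm_sq_starProjection (ω ℓ)
        (Submodule.span ℝ (Set.range fun a => F (z a))), add_comm, hP z hz]
      congr 1
      rw [← real_inner_self_eq_norm_sq, (hu z hz).inner_sum]
      exact Finset.sum_congr rfl fun b _ => (pow_two _).symm) (by
      intro z hz ω
      funext a ℓ
      change inner ℝ (F (z a)) (J z (M z ω) ℓ) = inner ℝ (F (z a)) (ω ℓ)
      rw [hJM z hz]
      have hmem : F (z a) ∈ Submodule.span ℝ (Set.range fun a => F (z a)) :=
        Submodule.subset_span ⟨a, rfl⟩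
      rw [← Submodule.inner_starProjection_left_eq_right,
        Submodule.starProjection_eq_self_iff.2 hmem]) (by
      rw [lintegral_gauss_pi]
      exact ENNReal.pow_ne_top ENNReal.ofReal_ne_top)
  have hset : ∀ ω, {z | L z ω = 0} = {z | ∀ a ℓ, inner ℝ (F (z a)) (ω ℓ) = 0} := by
    intro ω; ext z
    simp only [Set.mem_ofPred_eq, funext_iff]
    rfl
  simp_rw [hset] at h1 h2
  refine ⟨h1, ?_⟩
  rw [h2]
  refine setLIntegral_congr_fun hB fun z hz => ?_
  beta_reduce
  rw [lintegral_gauss_pi]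
  congr 2
  · congr 1
    have : (L z ∘L J z).det = _ := det_pairing_comb (ι := ι) (fun a => F (z a)) (u z)
    rw [this, abs_pow, abs_det_inner_of_projection _ _ (hu z hz) (hPf z hz)]
  · funext ω
    congr 1
    rw [← Finset.abs_prod]
    congr 1
    refine det_pi_block _ _ fun v a ℓ => ?_
    change inner ℝ (F' (z a) (v a)) ((ω - J z (M z ω)) ℓ) = _
    rw [hsub z hz, ← Submodule.inner_starProjection_left_eq_right]
    have hv : v a = ∑ i, v a i • (Pi.single i 1 : ι → ℝ) := by
      funext i; simp [Finset.sum_apply, Pi.single_apply]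
    conv_lhs => rw [hv]
    simp [map_sum, sum_inner, inner_smul_left, mul_comm]
end

section
variable {ι : Type*} [Fintype ι] [DecidableEq ι]
variable {H : Type*} [NormedAddCommGroup H] [InnerProductSpace ℝ H] [FiniteDimensional ℝ H]
  [MeasurableSpace H] [BorelSpace H]

/-- Common zeros of the Gaussian combinations of the features. -/
def zeroSet (F : (ι → ℝ) → H) (ω : PiLp 2 (fun _ : ι => H)) : Set (ι → ℝ) :=
  {x | ∀ ℓ, inner ℝ (F x) (ω ℓ) = 0}

/-- One-point intensity of the zeros. -/
noncomputable def intensityOne (F : (ι → ℝ) → H) (F' : (ι → ℝ) → (ι → ℝ) →L[ℝ] H) (x : ι → ℝ) :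
    ENNReal :=
  ENNReal.ofReal ((‖F x‖ ^ Fintype.card ι)⁻¹) * (ENNReal.ofReal (√(2 * π)) ^ Fintype.card ι)⁻¹ *
    (∫⁻ ω, ENNReal.ofReal |(Matrix.of fun ℓ i : ι =>
      (inner ℝ ((Submodule.span ℝ {F x})ᗮ.starProjection (F' x (Pi.single i 1))) (ω ℓ) : ℝ)).det|
      ∂(stdGaussian (PiLp 2 (fun _ : ι => H))))

/-- Two-point intensity of the zeros. -/
noncomputable def intensityTwo (F : (ι → ℝ) → H) (F' : (ι → ℝ) → (ι → ℝ) →L[ℝ] H)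
    (x y : ι → ℝ) : ENNReal :=
  ENNReal.ofReal ((√(‖F x‖ ^ 2 * ‖F y‖ ^ 2 - (inner ℝ (F x) (F y)) ^ 2) ^ Fintype.card ι)⁻¹) *
    (ENNReal.ofReal (√(2 * π)) ^ (2 * Fintype.card ι))⁻¹ *
    (∫⁻ ω, ENNReal.ofReal (
      |(Matrix.of fun ℓ i : ι =>
      (inner ℝ ((Submodule.span ℝ {F x, F y})ᗮ.starProjection (F' x (Pi.single i 1))) (ω ℓ) : ℝ)).det|
      * |(Matrix.of fun ℓ i : ι =>
      (inner ℝ ((Submodule.span ℝ {F x, F y})ᗮ.starProjection (F' y (Pi.single i 1))) (ω ℓ) : ℝ)).det|)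
      ∂(stdGaussian (PiLp 2 (fun _ : ι => H))))

variable {F : (ι → ℝ) → H} {F' : (ι → ℝ) → (ι → ℝ) →L[ℝ] H}

theorem one_point_kac_rice (hF : ∀ x, HasFDerivAt F (F' x) x) (hF' : Continuous F')
    {B : Set (ι → ℝ)} (hB : MeasurableSet B) (s : H) (hs : ∀ x ∈ B, (inner ℝ (F x) s : ℝ) ≠ 0) :
    AEMeasurable (fun ω => ((B ∩ zeroSet F ω).encard : ENNReal)) (stdGaussian _) ∧
    ∫⁻ ω, ((B ∩ zeroSet F ω).encard : ENNReal) ∂(stdGaussian (PiLp 2 (fun _ : ι => H))) =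
      ∫⁻ x in B, intensityOne F F' x := by
  let e := MeasurableEquiv.funUnique (Fin 1) (ι → ℝ)
  have he : MeasurePreserving e := volume_preserving_funUnique (Fin 1) (ι → ℝ)
  have hev : ∀ z : Fin 1 → ι → ℝ, e z = z 0 := fun z => rfl
  obtain ⟨h1, h2⟩ := multi_kac_rice (K := Fin 1) hF hF' (e.measurable hB) (fun _ => s) (by
    intro z hz
    rw [Matrix.det_fin_one]
    exact hs _ hz)
  have hc : ∀ ω : PiLp 2 (fun _ : ι => H), (e ⁻¹' B ∩ {z | ∀ a ℓ, inner ℝ (F (z a)) (ω ℓ) = 0}).encard =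
      (B ∩ zeroSet F ω).encard := by
    intro ω
    have : e ⁻¹' B ∩ {z | ∀ a ℓ, inner ℝ (F (z a)) (ω ℓ) = 0} = e ⁻¹' (B ∩ zeroSet F ω) := by
      ext z
      simp [hev, zeroSet, Fin.forall_fin_one]
    rw [this]
    exact Set.encard_preimage_of_bijective e.bijective _
  simp_rw [hc] at h1 h2
  refine ⟨h1, ?_⟩
  rw [h2, ← he.setLIntegral_comp_preimage_emb e.measurableEmbedding]
  refine setLIntegral_congr_fun (e.measurable hB) fun z hz => ?_
  simp only [hev, intensityOne, Matrix.det_fin_one, Matrix.gram_apply, Fintype.card_fin, one_mul,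
    Finset.univ_unique, Finset.prod_singleton, Set.range_unique, real_inner_self_eq_norm_sq]
  rw [Real.sqrt_sq (norm_nonneg _)]
  rfl

theorem two_point_kac_rice (hF : ∀ x, HasFDerivAt F (F' x) x) (hF' : Continuous F')
    {C : Set ((ι → ℝ) × (ι → ℝ))} (hC : MeasurableSet C) (s₀ s₁ : H)
    (hs : ∀ p ∈ C, (inner ℝ (F p.1) s₀ * inner ℝ (F p.2) s₁ -
      inner ℝ (F p.1) s₁ * inner ℝ (F p.2) s₀ : ℝ) ≠ 0) :
    AEMeasurable (fun ω => ((C ∩ zeroSet F ω ×ˢ zeroSet F ω).encard : ENNReal)) (stdGaussian _) ∧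
    ∫⁻ ω, ((C ∩ zeroSet F ω ×ˢ zeroSet F ω).encard : ENNReal)
        ∂(stdGaussian (PiLp 2 (fun _ : ι => H))) =
      ∫⁻ p in C, intensityTwo F F' p.1 p.2 := by
  let e := MeasurableEquiv.piFinTwo (fun _ => ι → ℝ)
  have he : MeasurePreserving e := volume_preserving_piFinTwo (fun _ => ι → ℝ)
  have hev : ∀ z : Fin 2 → ι → ℝ, e z = (z 0, z 1) := fun z => rfl
  obtain ⟨h1, h2⟩ := multi_kac_rice (K := Fin 2) hF hF' (e.measurable hC) ![s₀, s₁] (by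
    intro z hz
    rw [Matrix.det_fin_two]
    exact hs _ hz)
  have hc : ∀ ω : PiLp 2 (fun _ : ι => H), (e ⁻¹' C ∩ {z | ∀ a ℓ, inner ℝ (F (z a)) (ω ℓ) = 0}).encard =
      (C ∩ zeroSet F ω ×ˢ zeroSet F ω).encard := by
    intro ω
    have : e ⁻¹' C ∩ {z | ∀ a ℓ, inner ℝ (F (z a)) (ω ℓ) = 0} =
        e ⁻¹' (C ∩ zeroSet F ω ×ˢ zeroSet F ω) := by
      ext z
      simp [hev, zeroSet, Fin.forall_fin_two]
    rw [this]
    exact Set.encard_preimage_of_bijective e.bijective _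
  simp_rw [hc] at h1 h2
  refine ⟨h1, ?_⟩
  rw [h2, ← he.setLIntegral_comp_preimage_emb e.measurableEmbedding]
  refine setLIntegral_congr_fun (e.measurable hC) fun z hz => ?_
  have hr : (Set.range fun a => F (z a)) = {F (z 0), F (z 1)} := by
    ext v; simp [Fin.exists_fin_two, eq_comm]
  simp only [hev, intensityTwo, Matrix.det_fin_two, Matrix.gram_apply, Fintype.card_fin,
    Fin.prod_univ_two, real_inner_self_eq_norm_sq, hr]
  rw [real_inner_comm (F (z 0)) (F (z 1)), ← pow_two]
end

section
variable {H : Type*} [NormedAddCommGroup H] [InnerProductSpace ℝ H] [FiniteDimensional ℝ H]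

theorem norm_orthogonal_le_of_sub_mem {U : Submodule ℝ H} {x y : H} (h : x - y ∈ U) :
    ‖Uᗮ.starProjection x‖ ≤ ‖y‖ := by
  have h1 : Uᗮ.starProjection x = Uᗮ.starProjection y := by
    rw [← sub_eq_zero, ← map_sub]
    rw [Submodule.starProjection_orthogonal_val, sub_eq_zero, eq_comm]
    exact Submodule.starProjection_eq_self_iff.2 h
  rw [h1]
  exact Submodule.norm_starProjection_apply_le _ _

theorem projection_sum_comparison {f g w w' : H} {r : ℝ} (hr : 0 ≤ r) (hr1 : r ≤ 1)
    (h : ∀ a b : ℝ, |inner ℝ (w + a • f) (w' + b • g)| ≤ r * (‖w + a • f‖ * ‖w' + b • g‖)) :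
    (1 - r) * (‖(Submodule.span ℝ {f})ᗮ.starProjection w‖ ^ 2 +
        ‖(Submodule.span ℝ {g})ᗮ.starProjection w'‖ ^ 2) ≤
      ‖(Submodule.span ℝ {f, g})ᗮ.starProjection (w + w')‖ ^ 2 ∧
    ‖(Submodule.span ℝ {f, g})ᗮ.starProjection (w + w')‖ ^ 2 ≤
      (1 + r) * (‖(Submodule.span ℝ {f})ᗮ.starProjection w‖ ^ 2 +
        ‖(Submodule.span ℝ {g})ᗮ.starProjection w'‖ ^ 2) := by
  have hform : ∀ (v x : H), ∃ a : ℝ, (Submodule.span ℝ {v})ᗮ.starProjection x = x + a • v := by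
    intro v x
    obtain ⟨a, ha⟩ := Submodule.mem_span_singleton.1
      ((Submodule.span ℝ {v}).starProjection_apply_mem x)
    exact ⟨-a, by rw [Submodule.starProjection_orthogonal_val, ← ha]; simp [sub_eq_add_neg]⟩
  have key : ∀ u v : H, |inner ℝ u v| ≤ r * (‖u‖ * ‖v‖) →
      (1 - r) * (‖u‖ ^ 2 + ‖v‖ ^ 2) ≤ ‖u + v‖ ^ 2 ∧ ‖u + v‖ ^ 2 ≤ (1 + r) * (‖u‖ ^ 2 + ‖v‖ ^ 2) := by
    intro u v huv
    have h0 : 0 ≤ r * (‖u‖ * ‖v‖) := (abs_nonneg _).trans huv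
    have h3 : r * (‖u‖ * ‖v‖) * 2 ≤ r * (‖u‖ ^ 2 + ‖v‖ ^ 2) := by
      nlinarith [mul_nonneg hr (sq_nonneg (‖u‖ - ‖v‖))]
    rw [norm_add_sq_real]
    have := abs_le.1 huv
    constructor <;> nlinarith
  constructor
  · obtain ⟨a, b, hab⟩ := Submodule.mem_span_pair.1
      ((Submodule.span ℝ {f, g}).starProjection_apply_mem (w + w'))
    have hQ : (Submodule.span ℝ {f, g})ᗮ.starProjection (w + w') = (w + (-a) • f) + (w' + (-b) • g) := by
      rw [Submodule.starProjection_orthogonal_val, ← hab]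
      module
    rw [hQ]
    refine le_trans ?_ (key _ _ (h _ _)).1
    have h1 : ‖(Submodule.span ℝ {f})ᗮ.starProjection w‖ ≤ ‖w + (-a) • f‖ :=
      norm_orthogonal_le_of_sub_mem (Submodule.mem_span_singleton.2 ⟨a, by module⟩)
    have h2 : ‖(Submodule.span ℝ {g})ᗮ.starProjection w'‖ ≤ ‖w' + (-b) • g‖ :=
      norm_orthogonal_le_of_sub_mem (Submodule.mem_span_singleton.2 ⟨b, by module⟩)
    have : 0 ≤ 1 - r := by linarith
    gcongr
  · obtain ⟨a, ha⟩ := hform f w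
    obtain ⟨b, hb⟩ := hform g w'
    have h1 : ‖(Submodule.span ℝ {f, g})ᗮ.starProjection (w + w')‖ ≤
        ‖(Submodule.span ℝ {f})ᗮ.starProjection w + (Submodule.span ℝ {g})ᗮ.starProjection w'‖ := by
      refine norm_orthogonal_le_of_sub_mem (Submodule.mem_span_pair.2 ⟨-a, -b, ?_⟩)
      rw [ha, hb]; module
    refine (pow_le_pow_left₀ (norm_nonneg _) h1 2).trans (key _ _ ?_).2
    rw [ha, hb]
    exact h _ _
end

section
variable {ι : Type*} [Fintype ι] [DecidableEq ι]
variable {Ω : Type*} [NormedAddCommGroup Ω] [InnerProductSpace ℝ Ω] [FiniteDimensional ℝ Ω]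
  [MeasurableSpace Ω] [BorelSpace Ω]

/-- Absolute moments of the standard real Gaussian law. -/
noncomputable def gaussMoment (n : ℕ) : ENNReal := ∫⁻ t : ℝ, ENNReal.ofReal (|t| ^ n) ∂gaussianReal 0 1

theorem gaussMoment_ne_top (n : ℕ) : gaussMoment n ≠ ⊤ := by
  have h := (memLp_id_gaussianReal (μ := 0) (v := 1) (n : NNReal)).integrable_norm_pow'
  have := h.lintegral_lt_top
  simpa [gaussMoment] using this.ne

theorem lintegral_abs_inner_pow (w : Ω) (hw : ‖w‖ = 1) (n : ℕ) :
    ∫⁻ ω, ENNReal.ofReal (|inner ℝ w ω| ^ n) ∂(stdGaussian Ω) = gaussMoment n := by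
  have h := IsGaussian.map_eq_gaussianReal (μ := stdGaussian Ω) (innerSL ℝ w)
  rw [variance_dual_stdGaussian, integral_strongDual_stdGaussian, innerSL_apply_norm, hw] at h
  have h1 : ((1 : ℝ) ^ 2).toNNReal = 1 := by simp
  rw [h1] at h
  rw [gaussMoment, ← h, lintegral_map (by fun_prop) (by fun_prop)]
  rfl

theorem prod_abs_le_sum_pow {κ : Type*} [Fintype κ] [Nonempty κ] (t : κ → ℝ) :
    ∏ k, |t k| ≤ ∑ k, |t k| ^ Fintype.card κ := by
  obtain ⟨k, -, hk⟩ := Finset.exists_max_image Finset.univ (fun k => |t k|) Finset.univ_nonempty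
  calc ∏ j, |t j| ≤ ∏ j : κ, |t k| := Finset.prod_le_prod (fun _ _ => abs_nonneg _) hk
    _ = |t k| ^ Fintype.card κ := by simp
    _ ≤ _ := Finset.single_le_sum (f := fun k => |t k| ^ Fintype.card κ)
      (fun _ _ => by positivity) (Finset.mem_univ k)

theorem lintegral_prod_abs_inner_le {κ : Type*} [Fintype κ] [Nonempty κ] (w : κ → Ω) :
    ∫⁻ ω, ENNReal.ofReal (∏ k, |inner ℝ (w k) ω|) ∂(stdGaussian Ω) ≤
      ENNReal.ofReal (∏ k, ‖w k‖) * (Fintype.card κ * gaussMoment (Fintype.card κ)) := by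
  by_cases h0 : ∃ k, w k = 0
  · obtain ⟨k, hk⟩ := h0
    have : ∀ ω, ∏ k, |inner ℝ (w k) ω| = 0 := fun ω =>
      Finset.prod_eq_zero (Finset.mem_univ k) (by simp [hk])
    simp [this]
  push Not at h0
  have hn : ∀ k, ‖w k‖ ≠ 0 := fun k => norm_ne_zero_iff.2 (h0 k)
  have h1 : ∀ ω, ENNReal.ofReal (∏ k, |inner ℝ (w k) ω|) ≤ ENNReal.ofReal (∏ k, ‖w k‖) *
      ∑ k, ENNReal.ofReal (|inner ℝ (‖w k‖⁻¹ • w k) ω| ^ Fintype.card κ) := by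
    intro ω
    rw [← ENNReal.ofReal_sum_of_nonneg (fun _ _ => by positivity),
      ← ENNReal.ofReal_mul (by positivity)]
    refine ENNReal.ofReal_le_ofReal ?_
    have : ∏ k, |inner ℝ (w k) ω| = (∏ k, ‖w k‖) * ∏ k, |inner ℝ (‖w k‖⁻¹ • w k) ω| := by
      rw [← Finset.prod_mul_distrib]
      refine Finset.prod_congr rfl fun k _ => ?_
      rw [real_inner_smul_left, abs_mul, abs_of_nonneg (by positivity : (0:ℝ) ≤ ‖w k‖⁻¹),
        ← mul_assoc, mul_inv_cancel₀ (hn k), one_mul]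
    rw [this]
    gcongr
    exact prod_abs_le_sum_pow _
  refine (lintegral_mono h1).trans ?_
  rw [lintegral_const_mul' _ _ ENNReal.ofReal_ne_top, lintegral_finsetSum _ (fun k _ => by fun_prop)]
  gcongr
  rw [Finset.sum_congr rfl fun k _ => lintegral_abs_inner_pow (‖w k‖⁻¹ • w k) (by
    rw [norm_smul, norm_inv, norm_norm, inv_mul_cancel₀ (hn k)]) _]
  simp

theorem abs_det_le_sum (A : Matrix ι ι ℝ) : |A.det| ≤ ∑ σ : Equiv.Perm ι, ∏ i, |A (σ i) i| := by
  rw [Matrix.det_apply']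
  refine (Finset.abs_sum_le_sum_abs _ _).trans (Finset.sum_le_sum fun σ _ => ?_)
  rw [abs_mul, Finset.abs_prod]
  rcases Int.units_eq_one_or (Equiv.Perm.sign σ) with h | h <;> simp [h]

variable {H : Type*} [NormedAddCommGroup H] [InnerProductSpace ℝ H] [FiniteDimensional ℝ H]
  [MeasurableSpace H] [BorelSpace H]

/-- Constant in the moment bound for products of two determinants. -/
noncomputable def detMoment (n : ℕ) : ENNReal :=
  (n ! : ENNReal) ^ 2 * ((2 * n : ℕ) * gaussMoment (2 * n))

theorem detMoment_ne_top (n : ℕ) : detMoment n ≠ ⊤ := by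
  have := gaussMoment_ne_top (2 * n)
  unfold detMoment
  finiteness

/-- The vector with a single nonzero block. -/
noncomputable def blockVec (ℓ : ι) (x : H) : PiLp 2 (fun _ : ι => H) := WithLp.toLp 2 (Pi.single ℓ x)

theorem inner_blockVec (ℓ : ι) (x : H) (ω : PiLp 2 (fun _ : ι => H)) :
    inner ℝ (blockVec ℓ x) ω = inner ℝ x (ω ℓ) := by
  rw [PiLp.inner_apply, Finset.sum_eq_single ℓ]
  · simp [blockVec]
  · intro b _ hb; simp [blockVec, hb]
  · simp

theorem norm_blockVec (ℓ : ι) (x : H) : ‖blockVec ℓ x‖ = ‖x‖ := by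
  have h := inner_blockVec ℓ x (blockVec ℓ x)
  rw [real_inner_self_eq_norm_sq] at h
  have h2 : (blockVec ℓ x) ℓ = x := by simp [blockVec]
  rw [h2, real_inner_self_eq_norm_sq] at h
  exact (sq_eq_sq₀ (norm_nonneg _) (norm_nonneg _)).1 h

theorem lintegral_det_mul_det_le [Nonempty ι] (a b : ι → H) :
    ∫⁻ ω, ENNReal.ofReal (|(Matrix.of fun ℓ i : ι => (inner ℝ (a i) (ω ℓ) : ℝ)).det| *
      |(Matrix.of fun ℓ i : ι => (inner ℝ (b i) (ω ℓ) : ℝ)).det|)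
      ∂(stdGaussian (PiLp 2 (fun _ : ι => H))) ≤
    detMoment (Fintype.card ι) * ENNReal.ofReal ((∏ i, ‖a i‖) * ∏ i, ‖b i‖) := by
  let w : Equiv.Perm ι × Equiv.Perm ι → ι ⊕ ι → PiLp 2 (fun _ : ι => H) := fun p k =>
    Sum.elim (fun i => blockVec (p.1 i) (a i)) (fun i => blockVec (p.2 i) (b i)) k
  have hw : ∀ p, ∏ k, ‖w p k‖ = (∏ i, ‖a i‖) * ∏ i, ‖b i‖ := by
    intro p
    simp [w, Fintype.prod_sum_type, norm_blockVec]
  have h1 : ∀ ω : PiLp 2 (fun _ : ι => H),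
      ENNReal.ofReal (|(Matrix.of fun ℓ i : ι => (inner ℝ (a i) (ω ℓ) : ℝ)).det| *
      |(Matrix.of fun ℓ i : ι => (inner ℝ (b i) (ω ℓ) : ℝ)).det|) ≤
      ∑ p, ENNReal.ofReal (∏ k, |inner ℝ (w p k) ω|) := by
    intro ω
    rw [← ENNReal.ofReal_sum_of_nonneg (fun _ _ => by positivity)]
    refine ENNReal.ofReal_le_ofReal ?_
    refine (mul_le_mul (abs_det_le_sum _) (abs_det_le_sum _) (abs_nonneg _)
      (Finset.sum_nonneg fun _ _ => by positivity)).trans (le_of_eq ?_)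
    rw [Finset.sum_mul_sum, ← Finset.sum_product', Finset.univ_product_univ]
    refine Finset.sum_congr rfl fun p _ => ?_
    simp [w, Fintype.prod_sum_type, inner_blockVec]
  refine (lintegral_mono h1).trans ?_
  rw [lintegral_finsetSum _ (fun k _ => by fun_prop)]
  refine (Finset.sum_le_sum fun p _ => lintegral_prod_abs_inner_le (w p)).trans (le_of_eq ?_)
  simp only [hw, Finset.sum_const, Finset.card_univ, Fintype.card_prod, Fintype.card_sum,
    Fintype.card_perm, detMoment, nsmul_eq_mul]
  push_cast
  rw [← two_mul]
  ring_nf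

theorem lintegral_det_le [Nonempty ι] (a : ι → H) :
    ∫⁻ ω, ENNReal.ofReal |(Matrix.of fun ℓ i : ι => (inner ℝ (a i) (ω ℓ) : ℝ)).det|
      ∂(stdGaussian (PiLp 2 (fun _ : ι => H))) ≤
    ((Fintype.card ι) ! * (Fintype.card ι * gaussMoment (Fintype.card ι))) *
      ENNReal.ofReal (∏ i, ‖a i‖) := by
  have h1 : ∀ ω : PiLp 2 (fun _ : ι => H),
      ENNReal.ofReal |(Matrix.of fun ℓ i : ι => (inner ℝ (a i) (ω ℓ) : ℝ)).det| ≤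
      ∑ p : Equiv.Perm ι, ENNReal.ofReal (∏ i, |inner ℝ (blockVec (p i) (a i)) ω|) := by
    intro ω
    rw [← ENNReal.ofReal_sum_of_nonneg (fun _ _ => by positivity)]
    refine ENNReal.ofReal_le_ofReal ((abs_det_le_sum _).trans (le_of_eq ?_))
    simp [inner_blockVec]
  refine (lintegral_mono h1).trans ?_
  rw [lintegral_finsetSum _ (fun k _ => by fun_prop)]
  refine (Finset.sum_le_sum fun p _ => lintegral_prod_abs_inner_le
    (fun i => blockVec (p i) (a i))).trans (le_of_eq ?_)
  simp only [norm_blockVec, Finset.sum_const, Finset.card_univ, Fintype.card_perm, nsmul_eq_mul]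
  ring
end

section
variable {ι : Type*} [Fintype ι] [DecidableEq ι]
variable {Ω : Type*} [NormedAddCommGroup Ω] [InnerProductSpace ℝ Ω] [FiniteDimensional ℝ Ω]
  [MeasurableSpace Ω] [BorelSpace Ω]
variable {H : Type*} [NormedAddCommGroup H] [InnerProductSpace ℝ H] [FiniteDimensional ℝ H]
  [MeasurableSpace H] [BorelSpace H]

theorem map_toLp_prod_stdGaussian :
    ((stdGaussian Ω).prod (stdGaussian Ω)).map (WithLp.toLp 2) = stdGaussian (WithLp 2 (Ω × Ω)) := by
  have := Measure.isProbabilityMeasure_map (μ := (stdGaussian Ω).prod (stdGaussian Ω))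
    (f := (WithLp.toLp 2 : Ω × Ω → WithLp 2 (Ω × Ω))) (by fun_prop)
  apply Measure.ext_of_charFun
  ext t
  rw [charFun_prod, charFun_stdGaussian, charFun_stdGaussian, charFun_stdGaussian, ← Complex.exp_add]
  congr 1
  have := WithLp.prod_norm_sq_eq_of_L2 t
  have h2 : ((‖t‖ : ℂ)) ^ 2 = (‖t.fst‖ : ℂ) ^ 2 + (‖t.snd‖ : ℂ) ^ 2 := by
    exact_mod_cast this
  rw [h2]
  change _ = _
  simp only [WithLp.ofLp_fst, WithLp.ofLp_snd]
  ring

theorem lintegral_stdGaussian_prod {u v : Ω → ENNReal} (hu : Measurable u) (hv : Measurable v) :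
    ∫⁻ p, u p.fst * v p.snd ∂(stdGaussian (WithLp 2 (Ω × Ω))) =
      (∫⁻ x, u x ∂(stdGaussian Ω)) * ∫⁻ x, v x ∂(stdGaussian Ω) := by
  rw [← map_toLp_prod_stdGaussian, lintegral_map (by fun_prop) (by fun_prop)]
  exact lintegral_prod_mul hu.aemeasurable hv.aemeasurable

theorem sum_smul_blockVec (T : (ι → ℝ) →L[ℝ] H) (c : ι × ι → ℝ) :
    ∑ p, c p • blockVec p.1 (T (Pi.single p.2 1)) = WithLp.toLp 2 (fun ℓ => T (fun i => c (ℓ, i))) := by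
  ext ℓ
  have hv : (fun i => c (ℓ, i)) = ∑ i, c (ℓ, i) • (Pi.single i 1 : ι → ℝ) := by
    funext i; simp [Finset.sum_apply, Pi.single_apply]
  rw [WithLp.ofLp_sum, Finset.sum_apply, Fintype.sum_prod_type, Finset.sum_eq_single ℓ]
  · simp only [blockVec, WithLp.ofLp_smul, Pi.smul_apply, Pi.single_eq_same]
    rw [hv, map_sum]
    simp
  · intro b _ hb
    simp [blockVec, hb.symm]
  · simp

theorem lintegral_det_mul_det_comparison {f g : H} {W W' : (ι → ℝ) →L[ℝ] H} {r : ℝ} (hr : 0 ≤ r)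
    (hr1 : r < 1)
    (h : ∀ v v' : ι → ℝ, ∀ a b : ℝ,
      |inner ℝ (W v + a • f) (W' v' + b • g)| ≤ r * (‖W v + a • f‖ * ‖W' v' + b • g‖))
    (hW : ∀ v, (Submodule.span ℝ {f})ᗮ.starProjection (W v) = 0 → v = 0)
    (hW' : ∀ v, (Submodule.span ℝ {g})ᗮ.starProjection (W' v) = 0 → v = 0) :
    ENNReal.ofReal (√((1 - r) / (1 + r)) ^ (2 * Fintype.card ι ^ 2)) *
      ∫⁻ ω, ENNReal.ofReal (
        |(Matrix.of fun ℓ i : ι => (inner ℝ ((Submodule.span ℝ {f, g})ᗮ.starProjection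
          (W (Pi.single i 1))) (ω ℓ) : ℝ)).det| *
        |(Matrix.of fun ℓ i : ι => (inner ℝ ((Submodule.span ℝ {f, g})ᗮ.starProjection
          (W' (Pi.single i 1))) (ω ℓ) : ℝ)).det|) ∂(stdGaussian (PiLp 2 (fun _ : ι => H))) ≤
      ENNReal.ofReal ((√(1 + r)) ^ (2 * Fintype.card ι)) *
      ((∫⁻ ω, ENNReal.ofReal |(Matrix.of fun ℓ i : ι => (inner ℝ ((Submodule.span ℝ {f})ᗮ.starProjection
          (W (Pi.single i 1))) (ω ℓ) : ℝ)).det| ∂(stdGaussian (PiLp 2 (fun _ : ι => H)))) *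
       ∫⁻ ω, ENNReal.ofReal |(Matrix.of fun ℓ i : ι => (inner ℝ ((Submodule.span ℝ {g})ᗮ.starProjection
          (W' (Pi.single i 1))) (ω ℓ) : ℝ)).det| ∂(stdGaussian (PiLp 2 (fun _ : ι => H)))) := by
  set Q := (Submodule.span ℝ {f, g})ᗮ.starProjection with hQ
  set P := (Submodule.span ℝ {f})ᗮ.starProjection with hP
  set P' := (Submodule.span ℝ {g})ᗮ.starProjection with hP'
  let a : (ι × ι) ⊕ (ι × ι) → PiLp 2 (fun _ : ι => H) := Sum.elim
    (fun p => blockVec p.1 ((Q ∘L W) (Pi.single p.2 1)))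
    (fun p => blockVec p.1 ((Q ∘L W') (Pi.single p.2 1)))
  let b : (ι × ι) ⊕ (ι × ι) → WithLp 2 (PiLp 2 (fun _ : ι => H) × PiLp 2 (fun _ : ι => H)) := Sum.elim
    (fun p => WithLp.toLp 2 (blockVec p.1 ((P ∘L W) (Pi.single p.2 1)), 0))
    (fun p => WithLp.toLp 2 (0, blockVec p.1 ((P' ∘L W') (Pi.single p.2 1))))
  have ha : ∀ w : (ι × ι) ⊕ (ι × ι) → ℝ, ‖∑ k, w k • a k‖ ^ 2 =
      ∑ ℓ, ‖Q (W (fun i => w (Sum.inl (ℓ, i))) + W' (fun i => w (Sum.inr (ℓ, i))))‖ ^ 2 := by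
    intro w
    rw [Fintype.sum_sum_type]
    simp only [a, Sum.elim_inl, Sum.elim_inr]
    rw [sum_smul_blockVec (Q ∘L W) (fun p => w (Sum.inl p)),
      sum_smul_blockVec (Q ∘L W') (fun p => w (Sum.inr p)), PiLp.norm_sq_eq_of_L2]
    simp
  have hb : ∀ w : (ι × ι) ⊕ (ι × ι) → ℝ, ‖∑ k, w k • b k‖ ^ 2 =
      ∑ ℓ, (‖P (W (fun i => w (Sum.inl (ℓ, i))))‖ ^ 2 + ‖P' (W' (fun i => w (Sum.inr (ℓ, i))))‖ ^ 2) := by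
    intro w
    have : ∑ k, w k • b k = WithLp.toLp 2
        (∑ p, w (Sum.inl p) • blockVec p.1 ((P ∘L W) (Pi.single p.2 1)),
         ∑ p, w (Sum.inr p) • blockVec p.1 ((P' ∘L W') (Pi.single p.2 1))) := by
      rw [Fintype.sum_sum_type]
      simp only [b, Sum.elim_inl, Sum.elim_inr]
      apply (WithLp.equiv 2 _).injective
      ext1 <;> simp [Prod.fst_sum, Prod.snd_sum]
    rw [this, sum_smul_blockVec (P ∘L W) (fun p => w (Sum.inl p)),
      sum_smul_blockVec (P' ∘L W') (fun p => w (Sum.inr p)), WithLp.prod_norm_sq_eq_of_L2,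
      Finset.sum_add_distrib]
    simp [PiLp.norm_sq_eq_of_L2]
  have key := lintegral_inner_comparison a b (by
    intro w hw
    have h1 := hb w
    rw [hw, norm_zero, zero_pow two_ne_zero, eq_comm,
      Finset.sum_eq_zero_iff_of_nonneg (fun _ _ => by positivity)] at h1
    have h2 : ∀ ℓ, P (W (fun i => w (Sum.inl (ℓ, i)))) = 0 ∧ P' (W' (fun i => w (Sum.inr (ℓ, i)))) = 0 := by
      intro ℓ
      have := h1 ℓ (Finset.mem_univ _)
      rw [add_eq_zero_iff_of_nonneg (by positivity) (by positivity)] at this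
      simpa using this
    funext k
    rcases k with ⟨ℓ, i⟩ | ⟨ℓ, i⟩
    · exact congrFun (hW _ (h2 ℓ).1) i
    · exact congrFun (hW' _ (h2 ℓ).2) i) hr hr1 (by
    intro w
    rw [ha, hb, Finset.mul_sum]
    exact Finset.sum_le_sum fun ℓ _ => (projection_sum_comparison hr hr1.le (h _ _)).1) (by
    intro w
    rw [ha, hb, Finset.mul_sum]
    exact Finset.sum_le_sum fun ℓ _ => (projection_sum_comparison hr hr1.le (h _ _)).2)
    (h := fun u => ENNReal.ofReal (|(Matrix.of fun ℓ i : ι => u (Sum.inl (ℓ, i))).det| *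
      |(Matrix.of fun ℓ i : ι => u (Sum.inr (ℓ, i))).det|)) (by
      have h1 : Continuous fun u : (ι × ι) ⊕ (ι × ι) → ℝ =>
        (Matrix.of fun ℓ i : ι => u (Sum.inl (ℓ, i))).det := by
        refine Continuous.matrix_det ?_
        exact continuous_pi fun ℓ => continuous_pi fun i => continuous_apply _
      have h2 : Continuous fun u : (ι × ι) ⊕ (ι × ι) → ℝ =>
        (Matrix.of fun ℓ i : ι => u (Sum.inr (ℓ, i))).det := by
        refine Continuous.matrix_det ?_
        exact continuous_pi fun ℓ => continuous_pi fun i => continuous_apply _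
      exact (h1.abs.mul h2.abs).measurable.ennreal_ofReal)
  have hcard : Fintype.card ((ι × ι) ⊕ (ι × ι)) = 2 * Fintype.card ι ^ 2 := by
    simp; ring
  rw [hcard] at key
  simp only [a, b, Sum.elim_inl, Sum.elim_inr, inner_blockVec] at key
  refine key.trans (le_of_eq ?_)
  have hmeas : ∀ T : (ι → ℝ) →L[ℝ] H, Measurable fun ω : PiLp 2 (fun _ : ι => H) =>
      ENNReal.ofReal |(Matrix.of fun ℓ i : ι => (inner ℝ (T (Pi.single i 1)) (ω ℓ) : ℝ)).det| := by
    intro T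
    have h1 : Continuous fun ω : PiLp 2 (fun _ : ι => H) =>
        (Matrix.of fun ℓ i : ι => (inner ℝ (T (Pi.single i 1)) (ω ℓ) : ℝ)).det := by
      refine Continuous.matrix_det ?_
      refine continuous_pi fun ℓ => continuous_pi fun i => ?_
      simp only [Matrix.of_apply]
      fun_prop
    exact h1.abs.measurable.ennreal_ofReal
  have hsplit := lintegral_stdGaussian_prod (hmeas (P ∘L W)) (hmeas (P' ∘L W'))
  simp only [ContinuousLinearMap.comp_apply] at hsplit
  rw [← hsplit, ← lintegral_const_mul' _ _ ENNReal.ofReal_ne_top]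
  refine lintegral_congr fun p => ?_
  rw [← ENNReal.ofReal_mul (by positivity), ← ENNReal.ofReal_mul (by positivity)]
  congr 1
  have hdet : ∀ (c : ℝ) (A : ι → ι → ℝ), (Matrix.of fun ℓ i => c * A ℓ i).det =
      c ^ Fintype.card ι * (Matrix.of A).det := by
    intro c A
    rw [← Matrix.det_smul]; rfl
  simp only [WithLp.prod_inner_apply, inner_zero_left, add_zero, zero_add, inner_blockVec, hdet,
    abs_mul, abs_pow, ContinuousLinearMap.comp_apply, abs_of_nonneg (Real.sqrt_nonneg _),
    two_mul, pow_add, WithLp.ofLp_fst, WithLp.ofLp_snd]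
  ring
end

section
variable {ι : Type*} [Fintype ι] [DecidableEq ι]
variable {H : Type*} [NormedAddCommGroup H] [InnerProductSpace ℝ H]
variable {F : (ι → ℝ) → H} {F' : (ι → ℝ) → (ι → ℝ) →L[ℝ] H} {n : ℕ}

theorem hasDerivAt_dot (x v y : ι → ℝ) (k : ℕ) :
    HasDerivAt (fun t : ℝ => (1 + (x + t • v) ⬝ᵥ y) ^ (k + 1))
      ((k + 1) * (1 + x ⬝ᵥ y) ^ k * (v ⬝ᵥ y)) 0 := by
  have h1 : HasDerivAt (fun t : ℝ => 1 + (x + t • v) ⬝ᵥ y) (v ⬝ᵥ y) 0 := by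
    have : (fun t : ℝ => 1 + (x + t • v) ⬝ᵥ y) = fun t => (1 + x ⬝ᵥ y) + t * (v ⬝ᵥ y) := by
      funext t; rw [add_dotProduct, smul_dotProduct]; simp [add_assoc]
    rw [this]
    simpa using ((hasDerivAt_id (0 : ℝ)).mul_const (v ⬝ᵥ y)).const_add (1 + x ⬝ᵥ y)
  have := h1.fun_pow (k + 1)
  simpa using this

theorem inner_deriv_left (hF : ∀ x, HasFDerivAt F (F' x) x)
    (hk : ∀ x y, inner ℝ (F x) (F y) = (1 + x ⬝ᵥ y) ^ (n + 2)) (x v y : ι → ℝ) :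
    inner ℝ (F' x v) (F y) = (n + 2) * (1 + x ⬝ᵥ y) ^ (n + 1) * (v ⬝ᵥ y) := by
  have h1 : HasDerivAt (fun t : ℝ => F (x + t • v)) (F' x v) 0 := (hF x).hasLineDerivAt v
  have h2 : HasDerivAt (fun t : ℝ => inner ℝ (F (x + t • v)) (F y)) (inner ℝ (F' x v) (F y)) 0 := by
    simpa using h1.inner ℝ (hasDerivAt_const (0 : ℝ) (F y))
  simp_rw [hk] at h2
  rw [h2.unique (hasDerivAt_dot x v y (n + 1))]
  push_cast; ring

theorem inner_deriv_deriv (hF : ∀ x, HasFDerivAt F (F' x) x)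
    (hk : ∀ x y, inner ℝ (F x) (F y) = (1 + x ⬝ᵥ y) ^ (n + 2)) (x v y w : ι → ℝ) :
    inner ℝ (F' x v) (F' y w) = (n + 2) * ((n + 1) * (1 + x ⬝ᵥ y) ^ n * (v ⬝ᵥ y) * (x ⬝ᵥ w) +
      (1 + x ⬝ᵥ y) ^ (n + 1) * (v ⬝ᵥ w)) := by
  have h1 : HasDerivAt (fun t : ℝ => F (y + t • w)) (F' y w) 0 := (hF y).hasLineDerivAt w
  have h2 : HasDerivAt (fun t : ℝ => inner ℝ (F' x v) (F (y + t • w))) (inner ℝ (F' x v) (F' y w)) 0 := by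
    simpa using (hasDerivAt_const (0 : ℝ) (F' x v)).inner ℝ h1
  simp_rw [inner_deriv_left hF hk] at h2
  have h3 := hasDerivAt_dot y w x n
  have h4 : HasDerivAt (fun t : ℝ => v ⬝ᵥ (y + t • w)) (v ⬝ᵥ w) 0 := by
    simp_rw [dotProduct_add, dotProduct_smul, smul_eq_mul]
    simpa using ((hasDerivAt_id (0 : ℝ)).mul_const (v ⬝ᵥ w)).const_add (v ⬝ᵥ y)
  have h5 := (h3.const_mul ((n : ℝ) + 2)).mul h4
  simp_rw [dotProduct_comm _ x] at h5
  rw [h2.unique h5]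
  simp
  ring

/-- Jet estimate for normalised vectors in a Euclidean space. -/
theorem jet_inner_bound {E : Type*} [NormedAddCommGroup E] [InnerProductSpace ℝ E]
    {u v α β : E} (hu : ‖u‖ = 1) (hv : ‖v‖ = 1) {d : ℝ} (hd : 1 ≤ d) {q : ℝ}
    (hq : q = 1 - (inner ℝ u v) ^ 2) :
    |inner ℝ u v * inner ℝ α β + (d - 1) * (inner ℝ α v * inner ℝ β u)| ≤
      (1 + (1 + √(d * q)) ^ 2) * (√(‖α‖ ^ 2 + (d - 1) * inner ℝ α u ^ 2) *
        √(‖β‖ ^ 2 + (d - 1) * inner ℝ β v ^ 2)) := by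
  have hc : |inner ℝ u v| ≤ 1 := by
    have := abs_real_inner_le_norm u v
    rwa [hu, hv, one_mul] at this
  have hq0 : 0 ≤ q := by
    rw [hq]; have := (sq_le_one_iff_abs_le_one _).2 hc; linarith
  have aux : ∀ (a b ξ : E), ‖a‖ = 1 → ‖b‖ = 1 → q = 1 - (inner ℝ a b) ^ 2 →
      √d * |inner ℝ ξ b| ≤ (1 + √(d * q)) * √(‖ξ‖ ^ 2 + (d - 1) * inner ℝ ξ a ^ 2) := by
    intro a b ξ ha hb hqab
    have hab : |inner ℝ a b| ≤ 1 := by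
      have := abs_real_inner_le_norm a b
      rwa [ha, hb, one_mul] at this
    set p := inner ℝ ξ a with hp
    set ξ' := ξ - p • a with hξ'
    have h1 : ‖ξ‖ ^ 2 = p ^ 2 + ‖ξ'‖ ^ 2 := by
      rw [hξ', norm_sub_sq_real, inner_smul_right, norm_smul, ha, ← hp, mul_one, Real.norm_eq_abs, sq_abs]
      ring
    have h2 : inner ℝ ξ b = p * inner ℝ a b + inner ℝ ξ' (b - inner ℝ a b • a) := by
      have h3 : inner ℝ ξ' a = 0 := by
        rw [hξ', inner_sub_left, real_inner_smul_left, real_inner_self_eq_norm_sq, ha, ← hp]; ring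
      rw [inner_sub_right, inner_smul_right, h3, hξ', inner_sub_left, real_inner_smul_left]
      ring
    have h4 : ‖b - inner ℝ a b • a‖ = √q := by
      rw [eq_comm, Real.sqrt_eq_iff_mul_self_eq hq0 (norm_nonneg _), ← pow_two, norm_sub_sq_real,
        inner_smul_right, norm_smul, ha, hb, Real.norm_eq_abs, mul_one, sq_abs, real_inner_comm a b, hqab]
      ring
    have h5 : |inner ℝ ξ b| ≤ |p| + ‖ξ'‖ * √q := by
      rw [h2]
      refine (abs_add_le _ _).trans (add_le_add ?_ ?_)
      · rw [abs_mul]; exact mul_le_of_le_one_right (abs_nonneg _) hab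
      · rw [← h4]; exact abs_real_inner_le_norm _ _
    have h6 : ‖ξ‖ ^ 2 + (d - 1) * p ^ 2 = d * p ^ 2 + ‖ξ'‖ ^ 2 := by rw [h1]; ring
    rw [h6]
    have h7 : √d * |p| ≤ √(d * p ^ 2 + ‖ξ'‖ ^ 2) := by
      apply Real.le_sqrt_of_sq_le
      rw [mul_pow, Real.sq_sqrt (by linarith), sq_abs]
      nlinarith [sq_nonneg ‖ξ'‖]
    have h8 : ‖ξ'‖ ≤ √(d * p ^ 2 + ‖ξ'‖ ^ 2) := by
      apply Real.le_sqrt_of_sq_le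
      nlinarith [sq_nonneg p]
    calc √d * |inner ℝ ξ b| ≤ √d * (|p| + ‖ξ'‖ * √q) := by gcongr
      _ = √d * |p| + √(d * q) * ‖ξ'‖ := by rw [Real.sqrt_mul (by linarith)]; ring
      _ ≤ √(d * p ^ 2 + ‖ξ'‖ ^ 2) + √(d * q) * √(d * p ^ 2 + ‖ξ'‖ ^ 2) := by gcongr
      _ = _ := by ring
  have hα := aux u v α hu hv hq
  have hβ := aux v u β hv hu (by rw [hq, real_inner_comm])
  set N := √(‖α‖ ^ 2 + (d - 1) * inner ℝ α u ^ 2)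
  set M := √(‖β‖ ^ 2 + (d - 1) * inner ℝ β v ^ 2)
  have hαN : ‖α‖ ≤ N := Real.le_sqrt_of_sq_le (by nlinarith [sq_nonneg (inner ℝ α u)])
  have hβM : ‖β‖ ≤ M := Real.le_sqrt_of_sq_le (by nlinarith [sq_nonneg (inner ℝ β v)])
  have h9 : |inner ℝ u v * inner ℝ α β| ≤ N * M := by
    rw [abs_mul]
    calc |inner ℝ u v| * |inner ℝ α β| ≤ 1 * (‖α‖ * ‖β‖) := by
          gcongr; exact abs_real_inner_le_norm _ _
      _ ≤ N * M := by rw [one_mul]; gcongr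
  have h10 : |(d - 1) * (inner ℝ α v * inner ℝ β u)| ≤ (1 + √(d * q)) ^ 2 * (N * M) := by
    rw [abs_mul, abs_mul, abs_of_nonneg (by linarith : 0 ≤ d - 1)]
    calc (d - 1) * (|inner ℝ α v| * |inner ℝ β u|) ≤ d * (|inner ℝ α v| * |inner ℝ β u|) := by
          gcongr; linarith
      _ = (√d * |inner ℝ α v|) * (√d * |inner ℝ β u|) := by
          rw [mul_mul_mul_comm, Real.mul_self_sqrt (by linarith)]
      _ ≤ ((1 + √(d * q)) * N) * ((1 + √(d * q)) * M) := by gcongr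
      _ = _ := by ring
  calc _ ≤ N * M + (1 + √(d * q)) ^ 2 * (N * M) := (abs_add_le _ _).trans (add_le_add h9 h10)
    _ = _ := by ring
end

section
variable {ι : Type*} [Fintype ι] [DecidableEq ι]
variable {H : Type*} [NormedAddCommGroup H] [InnerProductSpace ℝ H]
variable {F : (ι → ℝ) → H} {F' : (ι → ℝ) → (ι → ℝ) →L[ℝ] H} {n : ℕ}

/-- The vector `(a, v)` of the Euclidean space with one more coordinate. -/
noncomputable def augment (a : ℝ) (v : ι → ℝ) : EuclideanSpace ℝ (Option ι) :=
  WithLp.toLp 2 fun o => o.elim a v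

theorem inner_augment (a b : ℝ) (v w : ι → ℝ) :
    inner ℝ (augment a v) (augment b w) = a * b + v ⬝ᵥ w := by
  simp [augment, PiLp.inner_apply, Fintype.sum_option, dotProduct, mul_comm]

/-- Cosine of the angle between `(1, x)` and `(1, y)`. -/
noncomputable def cosAngle (x y : ι → ℝ) : ℝ :=
  (1 + x ⬝ᵥ y) / (√(1 + x ⬝ᵥ x) * √(1 + y ⬝ᵥ y))

/-- Squared sine of the angle between `(1, x)` and `(1, y)`. -/
noncomputable def sinSq (x y : ι → ℝ) : ℝ := 1 - cosAngle x y ^ 2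

/-- Upper bound for the correlation of the first jets at `x` and `y` of the field with
covariance `(1 + x ⬝ᵥ y) ^ (n + 2)`. -/
noncomputable def jetCorrelation (n : ℕ) (x y : ι → ℝ) : ℝ :=
  |cosAngle x y| ^ n * (1 + (1 + √((n + 2) * sinSq x y)) ^ 2)

theorem one_le_one_add_dot (x : ι → ℝ) : 1 ≤ 1 + x ⬝ᵥ x := by
  have : 0 ≤ x ⬝ᵥ x := Finset.sum_nonneg fun i _ => mul_self_nonneg _
  linarith

theorem norm_augment (x : ι → ℝ) : ‖augment 1 x‖ = √(1 + x ⬝ᵥ x) := by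
  rw [norm_eq_sqrt_real_inner, inner_augment]; norm_num

theorem inner_jet (hF : ∀ x, HasFDerivAt F (F' x) x)
    (hk : ∀ x y, inner ℝ (F x) (F y) = (1 + x ⬝ᵥ y) ^ (n + 2)) (x y v w : ι → ℝ) (a b : ℝ) :
    inner ℝ (F' x v + a • F x) (F' y w + b • F y) =
      (n + 2) * (1 + x ⬝ᵥ y) ^ n * ((1 + x ⬝ᵥ y) *
        inner ℝ ((a / (n + 2)) • augment 1 x + augment 0 v) ((b / (n + 2)) • augment 1 y + augment 0 w)
        + (n + 1) * (inner ℝ ((a / (n + 2)) • augment 1 x + augment 0 v) (augment 1 y) *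
          inner ℝ ((b / (n + 2)) • augment 1 y + augment 0 w) (augment 1 x))) := by
  have hn : (n : ℝ) + 2 ≠ 0 := by positivity
  simp only [inner_add_left, inner_add_right, real_inner_smul_left, real_inner_smul_right,
    inner_augment, inner_deriv_deriv hF hk, inner_deriv_left hF hk, hk,
    real_inner_comm (F' y w) (F x)]
  rw [dotProduct_comm w x, dotProduct_comm y x]
  field_simp
  ring

theorem norm_jet (hF : ∀ x, HasFDerivAt F (F' x) x)
    (hk : ∀ x y, inner ℝ (F x) (F y) = (1 + x ⬝ᵥ y) ^ (n + 2)) (x v : ι → ℝ) (a : ℝ) :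
    ‖F' x v + a • F x‖ = √((n + 2) * (1 + x ⬝ᵥ x) ^ (n + 1)) *
      √(‖(a / (n + 2)) • augment 1 x + augment 0 v‖ ^ 2 + ((n + 2 : ℝ) - 1) *
        inner ℝ ((a / (n + 2)) • augment 1 x + augment 0 v)
          ((√(1 + x ⬝ᵥ x))⁻¹ • augment 1 x) ^ 2) := by
  have h0 := one_le_one_add_dot x
  rw [norm_eq_sqrt_real_inner, inner_jet hF hk, ← Real.sqrt_mul (by positivity)]
  congr 1
  rw [real_inner_smul_right, mul_pow, inv_pow, Real.sq_sqrt (by linarith), real_inner_self_eq_norm_sq]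
  have : (1 + x ⬝ᵥ x) ≠ 0 := by linarith
  field_simp
  ring

theorem jet_correlation_le (hF : ∀ x, HasFDerivAt F (F' x) x)
    (hk : ∀ x y, inner ℝ (F x) (F y) = (1 + x ⬝ᵥ y) ^ (n + 2)) (x y v w : ι → ℝ) (a b : ℝ) :
    |inner ℝ (F' x v + a • F x) (F' y w + b • F y)| ≤
      jetCorrelation n x y * (‖F' x v + a • F x‖ * ‖F' y w + b • F y‖) := by
  have hx := one_le_one_add_dot x
  have hy := one_le_one_add_dot y
  rw [norm_jet hF hk, norm_jet hF hk, inner_jet hF hk]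
  set α := (a / (n + 2)) • augment 1 x + augment 0 v
  set β := (b / (n + 2)) • augment 1 y + augment 0 w
  set kx := 1 + x ⬝ᵥ x
  set ky := 1 + y ⬝ᵥ y
  have hkx : 0 < √kx := Real.sqrt_pos.2 (by linarith)
  have hky : 0 < √ky := Real.sqrt_pos.2 (by linarith)
  set u := (√kx)⁻¹ • augment 1 x with hu
  set u' := (√ky)⁻¹ • augment 1 y with hu'
  have hu1 : ‖u‖ = 1 := by
    rw [hu, norm_smul, norm_augment, norm_inv, Real.norm_of_nonneg hkx.le, inv_mul_cancel₀ hkx.ne']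
  have hu1' : ‖u'‖ = 1 := by
    rw [hu', norm_smul, norm_augment, norm_inv, Real.norm_of_nonneg hky.le, inv_mul_cancel₀ hky.ne']
  have hc : inner ℝ u u' = cosAngle x y := by
    rw [hu, hu', real_inner_smul_left, real_inner_smul_right, inner_augment, cosAngle, one_mul]
    change _ = (1 + x ⬝ᵥ y) / (√kx * √ky)
    field_simp
  have key := jet_inner_bound (α := α) (β := β) hu1 hu1' (d := (n : ℝ) + 2)
    (by have : (0 : ℝ) ≤ n := by positivity
        linarith) (q := sinSq x y) (by rw [hc, sinSq])
  rw [hc] at key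
  set c := cosAngle x y with hcdef
  have hκ : 1 + x ⬝ᵥ y = c * (√kx * √ky) := by
    rw [hcdef, cosAngle]
    exact (div_mul_cancel₀ _ (mul_pos hkx hky).ne').symm
  have e1 : inner ℝ α (augment 1 y) = √ky * inner ℝ α u' := by
    rw [hu', real_inner_smul_right, mul_inv_cancel_left₀ hky.ne']
  have e2 : inner ℝ β (augment 1 x) = √kx * inner ℝ β u := by
    rw [hu, real_inner_smul_right, mul_inv_cancel_left₀ hkx.ne']
  have e3 : √((n + 2) * kx ^ (n + 1)) * √((n + 2) * ky ^ (n + 1)) = (n + 2) * (√kx * √ky) ^ (n + 1) := by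
    have ek : ∀ k : ℝ, 0 ≤ k → √((n + 2) * k ^ (n + 1)) = √(n + 2) * √k ^ (n + 1) := by
      intro k hk0
      rw [Real.sqrt_mul (by positivity)]
      congr 1
      rw [Real.sqrt_eq_iff_mul_self_eq (by positivity) (by positivity), ← mul_pow,
        Real.mul_self_sqrt hk0]
    rw [ek _ (by linarith), ek _ (by linarith), mul_pow]
    have := Real.mul_self_sqrt (show (0 : ℝ) ≤ n + 2 by positivity)
    linear_combination (√kx ^ (n + 1) * √ky ^ (n + 1)) * this
  rw [e1, e2, hκ]
  have e4 : (n + 2) * (c * (√kx * √ky)) ^ n * (c * (√kx * √ky) * inner ℝ α β +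
      (n + 1) * (√ky * inner ℝ α u' * (√kx * inner ℝ β u))) =
      (n + 2) * (√kx * √ky) ^ (n + 1) * c ^ n *
        (c * inner ℝ α β + ((n + 2 : ℝ) - 1) * (inner ℝ α u' * inner ℝ β u)) := by ring
  rw [e4, mul_mul_mul_comm, e3, abs_mul, abs_mul, abs_of_nonneg (by positivity : (0:ℝ) ≤ (n + 2) * (√kx * √ky) ^ (n + 1)), abs_pow]
  calc _ ≤ (n + 2) * (√kx * √ky) ^ (n + 1) * |c| ^ n * _ := mul_le_mul_of_nonneg_left key (by positivity)
    _ = _ := by rw [jetCorrelation]; ring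

/-- Norm of the projected derivative. -/
theorem norm_F (hk : ∀ x y, inner ℝ (F x) (F y) = (1 + x ⬝ᵥ y) ^ (n + 2)) (x : ι → ℝ) :
    ‖F x‖ ^ 2 = (1 + x ⬝ᵥ x) ^ (n + 2) := by
  rw [← hk, real_inner_self_eq_norm_sq]

theorem norm_sq_proj_deriv (hF : ∀ x, HasFDerivAt F (F' x) x)
    (hk : ∀ x y, inner ℝ (F x) (F y) = (1 + x ⬝ᵥ y) ^ (n + 2)) (x v : ι → ℝ) :
    ‖(Submodule.span ℝ {F x})ᗮ.starProjection (F' x v)‖ ^ 2 =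
      (n + 2) * (1 + x ⬝ᵥ x) ^ n * ((1 + x ⬝ᵥ x) * (v ⬝ᵥ v) - (v ⬝ᵥ x) ^ 2) := by
  have h0 := one_le_one_add_dot x
  rw [Submodule.starProjection_orthogonal_val, Submodule.starProjection_singleton,
    norm_sub_sq_real, inner_smul_right, real_inner_comm (F' x v) (F x), norm_smul, mul_pow,
    ← real_inner_self_eq_norm_sq (F' x v), inner_deriv_deriv hF hk, inner_deriv_left hF hk]
  simp only [RCLike.ofReal_real_eq_id, id, norm_F hk, Real.norm_eq_abs, sq_abs]
  rw [dotProduct_comm x v]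
  have : (1 + x ⬝ᵥ x) ≠ 0 := by linarith
  field_simp
  ring

theorem dot_sq_le (v x : ι → ℝ) : (v ⬝ᵥ x) ^ 2 ≤ (v ⬝ᵥ v) * (x ⬝ᵥ x) := by
  have := Finset.sum_mul_sq_le_sq_mul_sq Finset.univ v x
  simpa [dotProduct, pow_two] using this

theorem proj_deriv_eq_zero (hF : ∀ x, HasFDerivAt F (F' x) x)
    (hk : ∀ x y, inner ℝ (F x) (F y) = (1 + x ⬝ᵥ y) ^ (n + 2)) (x v : ι → ℝ)
    (h : (Submodule.span ℝ {F x})ᗮ.starProjection (F' x v) = 0) : v = 0 := by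
  have h0 := one_le_one_add_dot x
  have h1 := norm_sq_proj_deriv hF hk x v
  rw [h, norm_zero] at h1
  have h2 := dot_sq_le v x
  have h3 : (1 + x ⬝ᵥ x) * (v ⬝ᵥ v) - (v ⬝ᵥ x) ^ 2 = 0 := by
    have : (n + 2) * (1 + x ⬝ᵥ x) ^ n ≠ 0 := by positivity
    have h4 := h1.symm
    rw [zero_pow two_ne_zero] at h4
    exact (mul_eq_zero.1 h4).resolve_left this
  have h5 : v ⬝ᵥ v ≤ 0 := by nlinarith
  exact dotProduct_self_eq_zero.1 (le_antisymm h5 (Finset.sum_nonneg fun i _ => mul_self_nonneg _))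

theorem norm_sq_proj_deriv_le (hF : ∀ x, HasFDerivAt F (F' x) x)
    (hk : ∀ x y, inner ℝ (F x) (F y) = (1 + x ⬝ᵥ y) ^ (n + 2)) (x v : ι → ℝ) :
    ‖(Submodule.span ℝ {F x})ᗮ.starProjection (F' x v)‖ ^ 2 ≤
      (n + 2) * (1 + x ⬝ᵥ x) ^ (n + 1) * (v ⬝ᵥ v) := by
  have h0 := one_le_one_add_dot x
  rw [norm_sq_proj_deriv hF hk]
  calc _ ≤ (n + 2) * (1 + x ⬝ᵥ x) ^ n * ((1 + x ⬝ᵥ x) * (v ⬝ᵥ v)) := by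
        gcongr; nlinarith [sq_nonneg (v ⬝ᵥ x)]
    _ = _ := by ring
end

theorem one_add_pow_le_one_add_four_pow_mul {u : ℝ} (h0 : 0 ≤ u) (h2 : u ≤ 2) (N : ℕ) :
    (1 + u) ^ N ≤ 1 + 4 ^ N * u := by
  induction N with
  | zero => simpa using h0
  | succ k ih =>
    have h4 : (1 : ℝ) ≤ 4 ^ k := one_le_pow₀ (by norm_num)
    calc (1 + u) ^ (k + 1) ≤ (1 + 4 ^ k * u) * (1 + u) := by
          rw [pow_succ]; gcongr
      _ = 1 + (u + 4 ^ k * u + 4 ^ k * u * u) := by ring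
      _ ≤ 1 + (4 ^ k * u + 4 ^ k * u + 4 ^ k * u * 2) := by gcongr; nlinarith
      _ = 1 + 4 ^ (k + 1) * u := by ring

theorem correlation_factor_le {r : ℝ} (hr : 0 ≤ r) (hr1 : r ≤ 1 / 2) (m : ℕ) :
    (√(1 - r ^ 2) ^ m)⁻¹ * √(1 + r) ^ (2 * m) * (√((1 - r) / (1 + r)) ^ (2 * m ^ 2))⁻¹ ≤
      1 + 4 ^ (m ^ 2 + 2 * m + 1) * r := by
  have e1 : (√(1 - r ^ 2))⁻¹ ≤ 1 + 4 * r := by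
    rw [inv_le_comm₀ (Real.sqrt_pos.2 (by nlinarith)) (by positivity)]
    apply Real.le_sqrt_of_sq_le
    have h2 : (1 + 4 * r)⁻¹ ≤ 1 := inv_le_one_of_one_le₀ (by linarith)
    have h3 : (1 + 4 * r)⁻¹ ≤ 1 - r ^ 2 := by
      rw [inv_le_iff_one_le_mul₀ (by positivity)]
      nlinarith [mul_nonneg hr (show 0 ≤ 1/2 - r by linarith), mul_nonneg hr (mul_nonneg hr (show 0 ≤ 1/2 - r by linarith))]
    have h4 : 0 ≤ (1 + 4 * r)⁻¹ := by positivity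
    nlinarith
  have e2 : √(1 + r) ^ (2 * m) ≤ (1 + 4 * r) ^ m := by
    rw [pow_mul, Real.sq_sqrt (by linarith)]
    gcongr; linarith
  have e3 : (√((1 - r) / (1 + r)) ^ (2 * m ^ 2))⁻¹ ≤ (1 + 4 * r) ^ (m ^ 2) := by
    have hp : 0 < 1 - r := by linarith
    rw [pow_mul, Real.sq_sqrt (by positivity), ← inv_pow]
    gcongr
    rw [inv_div, div_le_iff₀ hp]
    nlinarith
  calc _ = ((√(1 - r ^ 2))⁻¹) ^ m * √(1 + r) ^ (2 * m) * (√((1 - r) / (1 + r)) ^ (2 * m ^ 2))⁻¹ := by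
        rw [inv_pow]
    _ ≤ (1 + 4 * r) ^ m * (1 + 4 * r) ^ m * (1 + 4 * r) ^ (m ^ 2) := by gcongr
    _ = (1 + 4 * r) ^ (m ^ 2 + 2 * m) := by ring
    _ ≤ 1 + 4 ^ (m ^ 2 + 2 * m) * (4 * r) :=
        one_add_pow_le_one_add_four_pow_mul (by linarith) (by linarith) _
    _ = _ := by ring

section
variable {ι : Type*} [Fintype ι] [DecidableEq ι]
variable {H : Type*} [NormedAddCommGroup H] [InnerProductSpace ℝ H] [FiniteDimensional ℝ H]
  [MeasurableSpace H] [BorelSpace H]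
variable {F : (ι → ℝ) → H} {F' : (ι → ℝ) → (ι → ℝ) →L[ℝ] H} {n : ℕ}

theorem jetCorrelation_nonneg (n : ℕ) (x y : ι → ℝ) : 0 ≤ jetCorrelation n x y := by
  unfold jetCorrelation; positivity

/-- Constant in the bound of the one-point intensity. -/
noncomputable def intensityConst (m : ℕ) : ENNReal :=
  (ENNReal.ofReal (√(2 * π)) ^ m)⁻¹ * (m ! * (m * gaussMoment m))

theorem ofReal_sqrt_two_pi_pow_ne_zero (m : ℕ) : ENNReal.ofReal (√(2 * π)) ^ m ≠ 0 := by
  apply pow_ne_zero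
  simpa using Real.pi_pos

theorem intensityConst_ne_top (m : ℕ) : intensityConst m ≠ ⊤ := by
  have := gaussMoment_ne_top m
  have h := ofReal_sqrt_two_pi_pow_ne_zero m
  unfold intensityConst
  finiteness

theorem norm_proj_deriv_single_le (hF : ∀ x, HasFDerivAt F (F' x) x)
    (hk : ∀ x y, inner ℝ (F x) (F y) = (1 + x ⬝ᵥ y) ^ (n + 2)) (x : ι → ℝ) (i : ι) :
    ‖(Submodule.span ℝ {F x})ᗮ.starProjection (F' x (Pi.single i 1))‖ ≤
      √((n + 2) * (1 + x ⬝ᵥ x) ^ (n + 1)) := by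
  apply Real.le_sqrt_of_sq_le
  have := norm_sq_proj_deriv_le hF hk x (Pi.single i 1)
  simpa using this

theorem intensityOne_le [Nonempty ι] (hF : ∀ x, HasFDerivAt F (F' x) x)
    (hk : ∀ x y, inner ℝ (F x) (F y) = (1 + x ⬝ᵥ y) ^ (n + 2)) (x : ι → ℝ) :
    intensityOne F F' x ≤ intensityConst (Fintype.card ι) *
      ENNReal.ofReal (√(n + 2) ^ Fintype.card ι) := by
  have h0 := one_le_one_add_dot x
  have h1 := lintegral_det_le
    (fun i : ι => (Submodule.span ℝ {F x})ᗮ.starProjection (F' x (Pi.single i 1)))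
  unfold intensityOne intensityConst
  calc _ ≤ ENNReal.ofReal ((‖F x‖ ^ Fintype.card ι)⁻¹) * (ENNReal.ofReal (√(2 * π)) ^ Fintype.card ι)⁻¹ *
        (((Fintype.card ι) ! * (Fintype.card ι * gaussMoment (Fintype.card ι))) *
      ENNReal.ofReal (√((n + 2) * (1 + x ⬝ᵥ x) ^ (n + 1)) ^ Fintype.card ι)) := by
        refine mul_le_mul_right (h1.trans (mul_le_mul_right (ENNReal.ofReal_le_ofReal ?_) _)) _
        calc _ ≤ ∏ i : ι, √((n + 2) * (1 + x ⬝ᵥ x) ^ (n + 1)) :=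
              Finset.prod_le_prod (fun _ _ => norm_nonneg _) fun i _ =>
                norm_proj_deriv_single_le hF hk x i
          _ = _ := by simp
    _ = (ENNReal.ofReal (√(2 * π)) ^ Fintype.card ι)⁻¹ *
        ((Fintype.card ι) ! * (Fintype.card ι * gaussMoment (Fintype.card ι))) *
        ENNReal.ofReal ((‖F x‖ ^ Fintype.card ι)⁻¹ * √((n + 2) * (1 + x ⬝ᵥ x) ^ (n + 1)) ^ Fintype.card ι) := by
        rw [ENNReal.ofReal_mul (by positivity)]; ring
    _ ≤ _ := by
        gcongr
        rw [← inv_pow, ← mul_pow]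
        gcongr
        have hn : ‖F x‖ = √((1 + x ⬝ᵥ x) ^ (n + 2)) := by
          rw [← norm_F hk, Real.sqrt_sq (norm_nonneg _)]
        rw [hn, inv_mul_le_iff₀ (Real.sqrt_pos.2 (by positivity)), ← Real.sqrt_mul (by positivity)]
        apply Real.sqrt_le_sqrt
        rw [mul_comm]
        exact mul_le_mul_of_nonneg_right (pow_le_pow_right₀ h0 (by omega)) (by positivity)

theorem intensityTwo_le_of_jetCorrelation_le [Nonempty ι] (hF : ∀ x, HasFDerivAt F (F' x) x)
    (hk : ∀ x y, inner ℝ (F x) (F y) = (1 + x ⬝ᵥ y) ^ (n + 2)) (x y : ι → ℝ)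
    (hr1 : jetCorrelation n x y ≤ 1 / 2) :
    intensityTwo F F' x y ≤ ENNReal.ofReal (1 + 4 ^ (Fintype.card ι ^ 2 + 2 * Fintype.card ι + 1) *
      jetCorrelation n x y) * (intensityOne F F' x * intensityOne F F' y) := by
  have hr := jetCorrelation_nonneg n x y
  have hA := correlation_factor_le hr hr1 (Fintype.card ι)
  have key := lintegral_det_mul_det_comparison (f := F x) (g := F y) (W := F' x) (W' := F' y) hr
    (by linarith) (fun v v' a b => jet_correlation_le hF hk x y v v' a b)
    (fun v hv => proj_deriv_eq_zero hF hk x v hv) (fun v hv => proj_deriv_eq_zero hF hk y v hv)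
  have hin : |inner ℝ (F x) (F y)| ≤ jetCorrelation n x y * (‖F x‖ * ‖F y‖) := by
    simpa using jet_correlation_le hF hk x y 0 0 1 1
  unfold intensityTwo intensityOne
  set m := Fintype.card ι
  set r := jetCorrelation n x y
  have hFx : 0 < ‖F x‖ := by
    have h0 := one_le_one_add_dot x
    have : 0 < ‖F x‖ ^ 2 := by rw [norm_F hk]; positivity
    refine lt_of_le_of_ne (norm_nonneg _) fun h => ?_
    rw [← h] at this; simp at this
  have hFy : 0 < ‖F y‖ := by
    have h0 := one_le_one_add_dot y
    have : 0 < ‖F y‖ ^ 2 := by rw [norm_F hk]; positivity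
    refine lt_of_le_of_ne (norm_nonneg _) fun h => ?_
    rw [← h] at this; simp at this
  have hr2 : 0 < 1 - r ^ 2 := by nlinarith
  have hdet : √(1 - r ^ 2) * (‖F x‖ * ‖F y‖) ≤ √(‖F x‖ ^ 2 * ‖F y‖ ^ 2 - inner ℝ (F x) (F y) ^ 2) := by
    apply Real.le_sqrt_of_sq_le
    rw [mul_pow, Real.sq_sqrt hr2.le]
    have : inner ℝ (F x) (F y) ^ 2 ≤ (r * (‖F x‖ * ‖F y‖)) ^ 2 := by
      rw [← sq_abs (inner ℝ (F x) (F y))]; gcongr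
    linarith [this, mul_pow r (‖F x‖ * ‖F y‖) 2, mul_pow ‖F x‖ ‖F y‖ 2]
  set I1 := (∫⁻ ω, ENNReal.ofReal |(Matrix.of fun ℓ i : ι => (inner ℝ ((Submodule.span ℝ {F x})ᗮ.starProjection
          (F' x (Pi.single i 1))) (ω ℓ) : ℝ)).det| ∂(stdGaussian (PiLp 2 (fun _ : ι => H))))
  set I1' := (∫⁻ ω, ENNReal.ofReal |(Matrix.of fun ℓ i : ι => (inner ℝ ((Submodule.span ℝ {F y})ᗮ.starProjection
          (F' y (Pi.single i 1))) (ω ℓ) : ℝ)).det| ∂(stdGaussian (PiLp 2 (fun _ : ι => H))))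
  set I2 := ∫⁻ ω, ENNReal.ofReal (
        |(Matrix.of fun ℓ i : ι => (inner ℝ ((Submodule.span ℝ {F x, F y})ᗮ.starProjection
          (F' x (Pi.single i 1))) (ω ℓ) : ℝ)).det| *
        |(Matrix.of fun ℓ i : ι => (inner ℝ ((Submodule.span ℝ {F x, F y})ᗮ.starProjection
          (F' y (Pi.single i 1))) (ω ℓ) : ℝ)).det|) ∂(stdGaussian (PiLp 2 (fun _ : ι => H)))
  set s := √((1 - r) / (1 + r)) ^ (2 * m ^ 2)
  have hs : 0 < s := by
    apply pow_pos (Real.sqrt_pos.2 (div_pos (by linarith) (by linarith)))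
  have hI2 : I2 ≤ ENNReal.ofReal (√(1 + r) ^ (2 * m) * s⁻¹) * (I1 * I1') := by
    have h1 : ENNReal.ofReal s⁻¹ * ENNReal.ofReal s = 1 := by
      rw [← ENNReal.ofReal_mul (by positivity), inv_mul_cancel₀ hs.ne', ENNReal.ofReal_one]
    calc I2 = ENNReal.ofReal s⁻¹ * (ENNReal.ofReal s * I2) := by rw [← mul_assoc, h1, one_mul]
      _ ≤ ENNReal.ofReal s⁻¹ * (ENNReal.ofReal (√(1 + r) ^ (2 * m)) * (I1 * I1')) := by gcongr
      _ = _ := by rw [ENNReal.ofReal_mul (by positivity)]; ring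
  have hG : (√(‖F x‖ ^ 2 * ‖F y‖ ^ 2 - inner ℝ (F x) (F y) ^ 2) ^ m)⁻¹ ≤
      (√(1 - r ^ 2) ^ m)⁻¹ * ((‖F x‖ ^ m)⁻¹ * (‖F y‖ ^ m)⁻¹) := by
    rw [← mul_inv, ← mul_inv, ← mul_pow ‖F x‖ ‖F y‖ m, ← mul_pow _ _ m]
    have : 0 < √(1 - r ^ 2) := Real.sqrt_pos.2 hr2
    gcongr
  have hp : (ENNReal.ofReal (√(2 * π)) ^ (2 * m))⁻¹ =
      (ENNReal.ofReal (√(2 * π)) ^ m)⁻¹ * (ENNReal.ofReal (√(2 * π)) ^ m)⁻¹ := by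
    rw [two_mul m, pow_add, ENNReal.mul_inv]
    · exact Or.inl (ofReal_sqrt_two_pi_pow_ne_zero m)
    · exact Or.inl (by finiteness)
  calc _ ≤ ENNReal.ofReal ((√(1 - r ^ 2) ^ m)⁻¹ * ((‖F x‖ ^ m)⁻¹ * (‖F y‖ ^ m)⁻¹)) *
        (ENNReal.ofReal (√(2 * π)) ^ (2 * m))⁻¹ *
        (ENNReal.ofReal (√(1 + r) ^ (2 * m) * s⁻¹) * (I1 * I1')) := by gcongr
    _ = ENNReal.ofReal ((√(1 - r ^ 2) ^ m)⁻¹ * √(1 + r) ^ (2 * m) * s⁻¹) *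
        (ENNReal.ofReal ((‖F x‖ ^ m)⁻¹) * (ENNReal.ofReal (√(2 * π)) ^ m)⁻¹ * I1 *
          (ENNReal.ofReal ((‖F y‖ ^ m)⁻¹) * (ENNReal.ofReal (√(2 * π)) ^ m)⁻¹ * I1')) := by
        rw [hp, mul_assoc ((√(1 - r ^ 2) ^ m)⁻¹), ENNReal.ofReal_mul (by positivity),
          ENNReal.ofReal_mul (p := (‖F x‖ ^ m)⁻¹) (by positivity),
          ENNReal.ofReal_mul (p := (√(1 - r ^ 2) ^ m)⁻¹) (by positivity)]
        ring
    _ ≤ _ := mul_le_mul' (ENNReal.ofReal_le_ofReal hA) le_rfl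

theorem intensityTwo_le_add_of_jetCorrelation_le [Nonempty ι] (hF : ∀ x, HasFDerivAt F (F' x) x)
    (hk : ∀ x y, inner ℝ (F x) (F y) = (1 + x ⬝ᵥ y) ^ (n + 2)) (x y : ι → ℝ)
    (hr1 : jetCorrelation n x y ≤ 1 / 2) :
    intensityTwo F F' x y ≤ intensityOne F F' x * intensityOne F F' y +
      ENNReal.ofReal (4 ^ (Fintype.card ι ^ 2 + 2 * Fintype.card ι + 1) * jetCorrelation n x y) *
      (intensityConst (Fintype.card ι) ^ 2 * ENNReal.ofReal ((n + 2) ^ Fintype.card ι)) := by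
  have hr := jetCorrelation_nonneg n x y
  refine (intensityTwo_le_of_jetCorrelation_le hF hk x y hr1).trans ?_
  rw [ENNReal.ofReal_add zero_le_one (by positivity), ENNReal.ofReal_one, add_mul, one_mul]
  refine add_le_add le_rfl (mul_le_mul' le_rfl ?_)
  calc _ ≤ _ := mul_le_mul' (intensityOne_le hF hk x) (intensityOne_le hF hk y)
    _ = _ := by
      have : ((n : ℝ) + 2) ^ Fintype.card ι = √(n + 2) ^ Fintype.card ι * √(n + 2) ^ Fintype.card ι := by
        rw [← mul_pow, Real.mul_self_sqrt (by positivity)]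
      rw [this, ENNReal.ofReal_mul (by positivity)]
      ring
end

section
variable {ι : Type*} [Fintype ι] [DecidableEq ι]

theorem sinSq_mul (x y : ι → ℝ) : sinSq x y * ((1 + x ⬝ᵥ x) * (1 + y ⬝ᵥ y)) =
    (1 + x ⬝ᵥ x) * (1 + y ⬝ᵥ y) - (1 + x ⬝ᵥ y) ^ 2 := by
  have hx := one_le_one_add_dot x
  have hy := one_le_one_add_dot y
  have hx' : 1 + x ⬝ᵥ x ≠ 0 := by positivity
  have hy' : 1 + y ⬝ᵥ y ≠ 0 := by positivity
  rw [sinSq, cosAngle, div_pow, mul_pow, Real.sq_sqrt (by positivity), Real.sq_sqrt (by positivity)]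
  field_simp

theorem sub_dot_sub (x y : ι → ℝ) : (x - y) ⬝ᵥ (x - y) = x ⬝ᵥ x - 2 * (x ⬝ᵥ y) + y ⬝ᵥ y := by
  rw [sub_dotProduct, dotProduct_sub, dotProduct_sub, dotProduct_comm y x]; ring

theorem sub_dot_le (x y : ι → ℝ) :
    (x - y) ⬝ᵥ (x - y) ≤ sinSq x y * ((1 + x ⬝ᵥ x) * (1 + y ⬝ᵥ y)) := by
  rw [sinSq_mul, sub_dot_sub]
  have := dot_sq_le x y
  nlinarith

theorem sinSq_le (x y : ι → ℝ) : sinSq x y ≤ (x - y) ⬝ᵥ (x - y) := by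
  have hx := one_le_one_add_dot x
  have hy := one_le_one_add_dot y
  have h0 : 0 ≤ (x - y) ⬝ᵥ (x - y) := by have := one_le_one_add_dot (x - y); linarith
  have h1 : sinSq x y * ((1 + x ⬝ᵥ x) * (1 + y ⬝ᵥ y)) ≤ (1 + x ⬝ᵥ x) * ((x - y) ⬝ᵥ (x - y)) := by
    rw [sinSq_mul, sub_dot_sub]
    nlinarith [sq_nonneg ((1 + x ⬝ᵥ y) - (1 + x ⬝ᵥ x))]
  have h2 : sinSq x y * (1 + y ⬝ᵥ y) ≤ (x - y) ⬝ᵥ (x - y) := by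
    have : (1 + x ⬝ᵥ x) * (sinSq x y * (1 + y ⬝ᵥ y)) ≤ (1 + x ⬝ᵥ x) * ((x - y) ⬝ᵥ (x - y)) := by
      linarith
    exact le_of_mul_le_mul_left this (by linarith)
  by_contra! h
  nlinarith

theorem sinSq_comm (x y : ι → ℝ) : sinSq x y = sinSq y x := by
  rw [sinSq, sinSq, cosAngle, cosAngle, dotProduct_comm, mul_comm (√_)]

theorem sinSq_le_one (x y : ι → ℝ) : sinSq x y ≤ 1 := by
  rw [sinSq]; nlinarith [sq_nonneg (cosAngle x y)]

theorem sinSq_nonneg (x y : ι → ℝ) : 0 ≤ sinSq x y := by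
  have hx := one_le_one_add_dot x
  have hy := one_le_one_add_dot y
  have h := sub_dot_le x y
  have h0 := one_le_one_add_dot (x - y)
  by_contra! h'
  nlinarith [mul_neg_of_neg_of_pos h' (show 0 < (1 + x ⬝ᵥ x) * (1 + y ⬝ᵥ y) by positivity)]

theorem one_add_dot_le {x : ι → ℝ} (hx : ‖x‖ ≤ 1) : 1 + x ⬝ᵥ x ≤ Fintype.card ι + 1 := by
  have : x ⬝ᵥ x ≤ ∑ _i : ι, (1 : ℝ) := by
    refine Finset.sum_le_sum fun i _ => ?_
    have h1 := (norm_le_pi_norm x i).trans hx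
    rw [Real.norm_eq_abs] at h1
    rw [← pow_two]
    exact (sq_le_one_iff_abs_le_one _).2 h1
  simp at this
  linarith

theorem dot_self_le (z : ι → ℝ) : z ⬝ᵥ z ≤ Fintype.card ι * ‖z‖ ^ 2 := by
  have : z ⬝ᵥ z ≤ ∑ _i : ι, ‖z‖ ^ 2 := by
    refine Finset.sum_le_sum fun i _ => ?_
    have h1 := norm_le_pi_norm z i
    rw [← pow_two, ← sq_abs, ← Real.norm_eq_abs]
    gcongr
  simpa using this

theorem norm_sq_le_dot_self (z : ι → ℝ) : ‖z‖ ^ 2 ≤ z ⬝ᵥ z := by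
  have : ‖z‖ ≤ √(z ⬝ᵥ z) := by
    refine (pi_norm_le_iff_of_nonneg (Real.sqrt_nonneg _)).2 fun i => ?_
    rw [Real.norm_eq_abs]
    apply Real.abs_le_sqrt
    rw [pow_two]
    exact Finset.single_le_sum (f := fun i => z i * z i) (fun i _ => mul_self_nonneg _) (Finset.mem_univ i)
  calc ‖z‖ ^ 2 ≤ √(z ⬝ᵥ z) ^ 2 := by gcongr
    _ = _ := Real.sq_sqrt (by have := one_le_one_add_dot z; linarith)

theorem sinSq_le_norm (x y : ι → ℝ) : sinSq x y ≤ Fintype.card ι * ‖x - y‖ ^ 2 :=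
  (sinSq_le x y).trans (dot_self_le _)

theorem norm_sq_le_sinSq {x y : ι → ℝ} (hx : ‖x‖ ≤ 1) (hy : ‖y‖ ≤ 1) :
    ‖x - y‖ ^ 2 ≤ (Fintype.card ι + 1) ^ 2 * sinSq x y := by
  have h1 := (norm_sq_le_dot_self _).trans (sub_dot_le x y)
  have hx := one_add_dot_le hx
  have hy := one_add_dot_le hy
  have hx' := one_le_one_add_dot x
  have hy' := one_le_one_add_dot y
  calc _ ≤ _ := h1
    _ ≤ sinSq x y * ((Fintype.card ι + 1) * (Fintype.card ι + 1)) := by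
      gcongr; exact sinSq_nonneg _ _
    _ = _ := by ring

theorem norm_sub_mul_sqrt_le {x y : ι → ℝ} (hx : ‖x‖ ≤ 1) (hy : ‖y‖ ≤ 1) (d : ℝ) (hd : 0 ≤ d) :
    √d * ‖x - y‖ ≤ (Fintype.card ι + 1) * √(d * sinSq x y) := by
  rw [Real.sqrt_mul hd]
  have : ‖x - y‖ ≤ (Fintype.card ι + 1) * √(sinSq x y) := by
    rw [← Real.sqrt_sq (by positivity : (0 : ℝ) ≤ Fintype.card ι + 1), ← Real.sqrt_mul (by positivity)]
    exact Real.le_sqrt_of_sq_le (norm_sq_le_sinSq hx hy)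
  calc _ ≤ √d * ((Fintype.card ι + 1) * √(sinSq x y)) := by gcongr
    _ = _ := by ring

theorem jetCorrelation_le_exp {n : ℕ} {x y : ι → ℝ} (ht : 200 ≤ (n + 2) * sinSq x y) :
    jetCorrelation n x y ≤ exp (-((n + 2) * sinSq x y / 4)) * (5 * ((n + 2) * sinSq x y)) := by
  set t := (n + 2) * sinSq x y with htdef
  have hq1 := sinSq_le_one x y
  have hn : 198 ≤ (n : ℝ) := by nlinarith
  have hc : |cosAngle x y| ≤ exp (-(sinSq x y / 2)) := by
    refine abs_le_of_sq_le_sq ?_ (exp_pos _).le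
    rw [← Real.exp_nat_mul]
    have := Real.add_one_le_exp (-(sinSq x y))
    have e : ((2 : ℕ) : ℝ) * -(sinSq x y / 2) = - sinSq x y := by push_cast; ring
    rw [e]
    have : cosAngle x y ^ 2 = 1 - sinSq x y := by rw [sinSq]; ring
    linarith
  have hcn : |cosAngle x y| ^ n ≤ exp (-(t / 4)) := by
    calc _ ≤ exp (-(sinSq x y / 2)) ^ n := by gcongr
      _ = exp (n * -(sinSq x y / 2)) := by rw [Real.exp_nat_mul]
      _ ≤ _ := by
        apply Real.exp_le_exp.2
        have := sinSq_nonneg x y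
        rw [htdef]; nlinarith
  unfold jetCorrelation
  rw [← htdef]
  gcongr
  have := Real.sq_sqrt (show 0 ≤ t by linarith)
  nlinarith [sq_nonneg (√t - 1)]

theorem jetCorrelation_le_half {n : ℕ} {x y : ι → ℝ} (ht : 200 ≤ (n + 2) * sinSq x y) :
    jetCorrelation n x y ≤ 1 / 2 := by
  refine (jetCorrelation_le_exp ht).trans ?_
  set t := (n + 2) * sinSq x y
  rw [Real.exp_neg, inv_mul_le_iff₀ (exp_pos _)]
  have := Real.pow_div_factorial_le_exp (t / 4) (by linarith) 3
  norm_num [Nat.factorial] at this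
  nlinarith [mul_nonneg (show 0 ≤ t by linarith) (mul_self_nonneg (t - 200)), mul_nonneg (show 0 ≤ t by linarith) (show 0 ≤ t - 200 by linarith)]

theorem jetCorrelation_decay {n : ℕ} {x y : ι → ℝ} (hx : ‖x‖ ≤ 1) (hy : ‖y‖ ≤ 1)
    (ht : 200 ≤ (n + 2) * sinSq x y) :
    jetCorrelation n x y ≤ (5 * (2 * (Fintype.card ι + 1)) ^ (Fintype.card ι + 1) *
      (4 ^ (Fintype.card ι + 2) * (Fintype.card ι + 2)!)) *
      ((1 + √(n + 2) * ‖x - y‖) ^ (Fintype.card ι + 1))⁻¹ := by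
  rw [← div_eq_mul_inv, le_div_iff₀ (by positivity)]
  have h1 := jetCorrelation_le_exp ht
  have h2 := norm_sub_mul_sqrt_le hx hy ((n : ℝ) + 2) (by positivity)
  have h0 := jetCorrelation_nonneg n x y
  set t := (n + 2) * sinSq x y
  set m := Fintype.card ι
  have hm : (0 : ℝ) ≤ m := by positivity
  have hst : √t ≤ t := by
    rw [Real.sqrt_le_left (by linarith)]; nlinarith
  have h3 : 1 + √(n + 2) * ‖x - y‖ ≤ 2 * (m + 1) * t := by
    have : ((m : ℝ) + 1) * √t ≤ (m + 1) * t := by gcongr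
    nlinarith
  have h4 := Real.pow_div_factorial_le_exp (t / 4) (by linarith) (m + 2)
  rw [div_le_iff₀ (by positivity), div_pow, div_le_iff₀ (by positivity)] at h4
  calc _ ≤ (exp (-(t / 4)) * (5 * t)) * (2 * (m + 1) * t) ^ (m + 1) := by gcongr
    _ = 5 * (2 * (m + 1)) ^ (m + 1) * (exp (-(t / 4)) * t ^ (m + 2)) := by
      rw [mul_pow _ t]; ring
    _ ≤ 5 * (2 * (m + 1)) ^ (m + 1) * (exp (-(t / 4)) * (exp (t / 4) * (m + 2)! * 4 ^ (m + 2))) := by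
      gcongr
    _ = _ := by
      have : exp (-(t / 4)) * exp (t / 4) = 1 := by rw [← Real.exp_add]; simp
      linear_combination 5 * (2 * ((m : ℝ) + 1)) ^ (m + 1) * ((m + 2)! * 4 ^ (m + 2)) * this
end

section
variable {ι : Type*} [Fintype ι] [DecidableEq ι]
variable {H : Type*} [NormedAddCommGroup H] [InnerProductSpace ℝ H] [FiniteDimensional ℝ H]
  [MeasurableSpace H] [BorelSpace H]
variable {F : (ι → ℝ) → H} {F' : (ι → ℝ) → (ι → ℝ) →L[ℝ] H} {n : ℕ}

/-- Projecting off both values makes the derivative in the direction `y - x` of second order. -/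
theorem norm_sq_proj_deriv_sub_le (hF : ∀ x, HasFDerivAt F (F' x) x)
    (hk : ∀ x y, inner ℝ (F x) (F y) = (1 + x ⬝ᵥ y) ^ (n + 2)) (x y : ι → ℝ)
    (hq : 0 < sinSq x y) :
    ‖(Submodule.span ℝ {F x, F y})ᗮ.starProjection (F' x (y - x))‖ ^ 2 ≤
      (n + 2) * (1 + x ⬝ᵥ x) ^ (n + 1) * (1 + y ⬝ᵥ y) * sinSq x y * ((n + 2) * sinSq x y) := by
  have hx := one_le_one_add_dot x
  have hy := one_le_one_add_dot y
  have hS := sinSq_mul x y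
  have hq1 := sinSq_le_one x y
  have i1 : inner ℝ (F' x (y - x)) (F' x (y - x)) = (n + 2) * ((n + 1) * (1 + x ⬝ᵥ x) ^ n *
      ((1 + x ⬝ᵥ y) - (1 + x ⬝ᵥ x)) ^ 2 +
      (1 + x ⬝ᵥ x) ^ (n + 1) * ((1 + x ⬝ᵥ x) + (1 + y ⬝ᵥ y) - 2 * (1 + x ⬝ᵥ y))) := by
    rw [inner_deriv_deriv hF hk]
    simp only [sub_dotProduct, dotProduct_sub, dotProduct_comm y x]
    ring
  have i2 : inner ℝ (F' x (y - x)) (F x) = (n + 2) * (1 + x ⬝ᵥ x) ^ (n + 1) * ((1 + x ⬝ᵥ y) - (1 + x ⬝ᵥ x)) := by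
    rw [inner_deriv_left hF hk, sub_dotProduct, dotProduct_comm y x]; ring
  have i3 : inner ℝ (F' x (y - x)) (F y) = (n + 2) * (1 + x ⬝ᵥ y) ^ (n + 1) * ((1 + y ⬝ᵥ y) - (1 + x ⬝ᵥ y)) := by
    rw [inner_deriv_left hF hk, sub_dotProduct]; ring
  have j1 := hk x x
  have j2 := hk x y
  have j3 := hk y y
  set w := F' x (y - x)
  set kx := 1 + x ⬝ᵥ x
  set ky := 1 + y ⬝ᵥ y
  set k := 1 + x ⬝ᵥ y
  set q := sinSq x y
  clear_value w kx ky k q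
  have hx0 : kx ≠ 0 := by positivity
  have hy0 : ky ≠ 0 := by positivity
  have hsq : k ^ 2 = kx * ky * (1 - q) := by linarith
  set ψ := w - ((n + 2) * (k - kx) / kx) • F x with hψ
  set β := F y - (k / kx) ^ (n + 2) • F x with hβ
  have e1 : inner ℝ ψ ψ = (n + 2) * kx ^ (n + 1) * ky * q := by
    simp only [hψ, inner_sub_left, inner_sub_right, real_inner_smul_left, real_inner_smul_right,
      real_inner_comm w (F x), i1, i2, j1]
    field_simp
    linear_combination kx ^ (n + 2) * (-hS)
  have e2 : inner ℝ ψ β = (n + 2) * k ^ (n + 1) * ky * q := by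
    simp only [hψ, hβ, inner_sub_left, inner_sub_right, real_inner_smul_left, real_inner_smul_right,
      i2, i3, j1, j2, div_pow]
    field_simp
    linear_combination k ^ (n + 1) * kx ^ (n + 2) * (-hS)
  have e3 : inner ℝ β β = ky ^ (n + 2) * (1 - (1 - q) ^ (n + 2)) := by
    have hsq' : k ^ (n + 2) * k ^ (n + 2) = kx ^ (n + 2) * ky ^ (n + 2) * (1 - q) ^ (n + 2) := by
      rw [← mul_pow, ← mul_pow, ← mul_pow, ← hsq, pow_two]
    simp only [hβ, inner_sub_left, inner_sub_right, real_inner_smul_left, real_inner_smul_right,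
      real_inner_comm (F x) (F y), j1, j2, j3, div_pow]
    field_simp
    linear_combination - hsq'
  have bern : 1 - (1 - q) ^ (n + 2) ≤ (n + 2) * q := by
    have := one_add_mul_le_pow (show (-2 : ℝ) ≤ -q by linarith) (n + 2)
    push_cast at this
    rw [← sub_eq_add_neg] at this
    linarith
  have bern' : 1 - (1 - q) ^ (n + 1) ≤ (n + 2) * q := by
    have := one_add_mul_le_pow (show (-2 : ℝ) ≤ -q by linarith) (n + 1)
    push_cast at this
    rw [← sub_eq_add_neg] at this
    linarith
  set lam := inner ℝ ψ β / (ky ^ (n + 2) * ((n + 2) * q)) with hlam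
  have hle : ‖(Submodule.span ℝ {F x, F y})ᗮ.starProjection w‖ ≤ ‖ψ - lam • β‖ := by
    apply norm_orthogonal_le_of_sub_mem
    have hfx : F x ∈ Submodule.span ℝ {F x, F y} := Submodule.subset_span (by simp)
    have hfy : F y ∈ Submodule.span ℝ {F x, F y} := Submodule.subset_span (by simp)
    have : w - (ψ - lam • β) = ((n + 2) * (k - kx) / kx) • F x +
        lam • (F y - (k / kx) ^ (n + 2) • F x) := by rw [hψ, hβ]; module
    rw [this]
    exact Submodule.add_mem _ (Submodule.smul_mem _ _ hfx)
      (Submodule.smul_mem _ _ (Submodule.sub_mem _ hfy (Submodule.smul_mem _ _ hfx)))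
  have hn : ‖ψ - lam • β‖ ^ 2 = inner ℝ ψ ψ - 2 * lam * inner ℝ ψ β + lam ^ 2 * inner ℝ β β := by
    rw [norm_sub_sq_real, real_inner_smul_right, norm_smul, mul_pow, Real.norm_eq_abs, sq_abs,
      real_inner_self_eq_norm_sq, real_inner_self_eq_norm_sq]
    ring
  have hD : 0 < ky ^ (n + 2) * ((n + 2) * q) := by positivity
  calc _ ≤ ‖ψ - lam • β‖ ^ 2 := by gcongr
    _ = inner ℝ ψ ψ - 2 * lam * inner ℝ ψ β + lam ^ 2 * inner ℝ β β := hn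
    _ ≤ inner ℝ ψ ψ - 2 * lam * inner ℝ ψ β + lam ^ 2 * (ky ^ (n + 2) * ((n + 2) * q)) := by
      rw [e3]; gcongr
    _ = inner ℝ ψ ψ - inner ℝ ψ β ^ 2 / (ky ^ (n + 2) * ((n + 2) * q)) := by
      rw [hlam]; field_simp; ring
    _ = (n + 2) * kx ^ (n + 1) * ky * q * (1 - (1 - q) ^ (n + 1)) := by
      have hsq' : k ^ (n + 1) * k ^ (n + 1) = kx ^ (n + 1) * ky ^ (n + 1) * (1 - q) ^ (n + 1) := by
        rw [← mul_pow, ← mul_pow, ← mul_pow, ← hsq, pow_two]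
      rw [e1, e2]
      field_simp
      linear_combination -ky * hsq'
    _ ≤ _ := by gcongr

theorem abs_det_eq_update {Q : H →L[ℝ] H} {W : (ι → ℝ) →L[ℝ] H} {v : ι → ℝ} {i : ι} (hv : v i = 1)
    (ω : ι → H) :
    (Matrix.of fun ℓ j : ι => (inner ℝ (Q (W (Pi.single j 1))) (ω ℓ) : ℝ)).det =
    (Matrix.of fun ℓ j : ι => (inner ℝ (Function.update (fun j => Q (W (Pi.single j 1))) i (Q (W v)) j)
      (ω ℓ) : ℝ)).det := by
  have h := Matrix.det_updateCol_sum
    (Matrix.of fun ℓ j : ι => (inner ℝ (Q (W (Pi.single j 1))) (ω ℓ) : ℝ)) i v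
  rw [hv, one_smul] at h
  rw [← h]
  congr 1
  ext ℓ j
  by_cases hj : j = i
  · subst hj
    have : v = ∑ j, v j • Pi.single j (1 : ℝ) := by
      ext k; simp [Finset.sum_apply, Pi.single_apply]
    conv_rhs => rw [Matrix.of_apply, Function.update_self, this]
    simp [Matrix.updateCol_self, map_sum, sum_inner, real_inner_smul_left]
  · simp [Matrix.updateCol_ne hj, Function.update_of_ne hj]

theorem prod_norm_update_le [Nonempty ι] (hF : ∀ x, HasFDerivAt F (F' x) x)
    (hk : ∀ x y, inner ℝ (F x) (F y) = (1 + x ⬝ᵥ y) ^ (n + 2)) {x y : ι → ℝ} (hy : ‖y‖ ≤ 1)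
    {i : ι} (hi : ‖x - y‖ = |x i - y i|) (hne : x ≠ y) (hq : 0 < sinSq x y) {Q : H →L[ℝ] H}
    (hQ : Q = (Submodule.span ℝ {F x, F y})ᗮ.starProjection) :
    ∏ j, ‖Function.update (fun j => Q (F' x (Pi.single j 1))) i
      (Q (F' x ((y i - x i)⁻¹ • (y - x)))) j‖ ≤
    √((n + 2) * (1 + x ⬝ᵥ x) ^ (n + 1)) ^ Fintype.card ι *
      √((Fintype.card ι + 1) * Fintype.card ι * ((n + 2) * sinSq x y)) := by
  have hx0 := one_le_one_add_dot x
  have hy0 := one_le_one_add_dot y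
  have hh : 0 < |y i - x i| := by
    rw [abs_sub_comm, ← hi]; exact norm_pos_iff.2 (sub_ne_zero.2 hne)
  have h1 : ∀ j, ‖Q (F' x (Pi.single j 1))‖ ≤ √((n + 2) * (1 + x ⬝ᵥ x) ^ (n + 1)) := by
    intro j
    refine le_trans ?_ (norm_proj_deriv_single_le hF hk x j)
    rw [hQ]
    apply norm_orthogonal_le_of_sub_mem
    have : F' x (Pi.single j 1) - (Submodule.span ℝ {F x})ᗮ.starProjection (F' x (Pi.single j 1)) ∈
        Submodule.span ℝ {F x} := by
      rw [Submodule.starProjection_orthogonal_val, sub_sub_cancel]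
      exact Submodule.starProjection_apply_mem _ _
    exact Submodule.span_mono (by simp) this
  have h2 : ‖Q (F' x ((y i - x i)⁻¹ • (y - x)))‖ ≤ √((n + 2) * (1 + x ⬝ᵥ x) ^ (n + 1)) *
      √((Fintype.card ι + 1) * Fintype.card ι * ((n + 2) * sinSq x y)) := by
    rw [← Real.sqrt_mul (by positivity)]
    apply Real.le_sqrt_of_sq_le
    have h3 := norm_sq_proj_deriv_sub_le hF hk x y hq
    have h4 := sinSq_le_norm x y
    have h5 := one_add_dot_le hy
    rw [map_smul, map_smul, norm_smul, mul_pow, norm_inv, inv_pow, Real.norm_eq_abs,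
      inv_mul_le_iff₀ (by positivity), hQ]
    rw [hi, abs_sub_comm] at h4
    calc _ ≤ _ := h3
      _ ≤ (n + 2) * (1 + x ⬝ᵥ x) ^ (n + 1) * (Fintype.card ι + 1) *
          (Fintype.card ι * |y i - x i| ^ 2) * ((n + 2) * sinSq x y) := by gcongr
      _ = _ := by ring
  rw [Finset.prod_eq_mul_prod_sdiff_singleton_of_mem (Finset.mem_univ i)]
  have h6 : ∏ j ∈ Finset.univ \ {i}, ‖Function.update (fun j => Q (F' x (Pi.single j 1))) i
      (Q (F' x ((y i - x i)⁻¹ • (y - x)))) j‖ ≤ √((n + 2) * (1 + x ⬝ᵥ x) ^ (n + 1)) ^ (Fintype.card ι - 1) := by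
    calc _ ≤ ∏ j ∈ Finset.univ \ {i}, √((n + 2) * (1 + x ⬝ᵥ x) ^ (n + 1)) := by
          refine Finset.prod_le_prod (fun _ _ => norm_nonneg _) fun j hj => ?_
          have : j ≠ i := by simpa using hj
          rw [Function.update_of_ne this]
          exact h1 j
      _ = _ := by
        rw [Finset.prod_const, Finset.card_sdiff]
        simp
  rw [Function.update_self]
  calc _ ≤ _ := mul_le_mul h2 h6 (Finset.prod_nonneg fun _ _ => norm_nonneg _) (by positivity)
    _ = _ := by
      obtain ⟨k, hk⟩ : ∃ k, Fintype.card ι = k + 1 :=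
        Nat.exists_eq_succ_of_ne_zero Fintype.card_ne_zero
      rw [hk, Nat.add_sub_cancel, pow_succ]
      ring
end

/-- Radial profile dominating the excess of the two-point intensity. -/
noncomputable def pairProfile (m : ℕ) (s : ℝ) : ℝ :=
  (if s ≤ 15 * (m + 1) then (s ^ (m - 1))⁻¹ else 0) + ((1 + s) ^ (m + 1))⁻¹

theorem pairProfile_nonneg (m : ℕ) {s : ℝ} (hs : 0 ≤ s) : 0 ≤ pairProfile m s := by
  unfold pairProfile
  split_ifs <;> positivity

/-- Constant for pairs of points at small distance. -/
noncomputable def nearConst (m : ℕ) : ENNReal :=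
  (ENNReal.ofReal (√(2 * π)) ^ (2 * m))⁻¹ * detMoment m *
    ENNReal.ofReal ((m + 1) * m * 15 ^ (m + 1) * (m + 1) ^ (m - 1))

/-- Constant for pairs of points at large distance. -/
noncomputable def farConst (m : ℕ) : ENNReal :=
  ENNReal.ofReal (4 ^ (m ^ 2 + 2 * m + 1) * (5 * (2 * (m + 1)) ^ (m + 1) *
      (4 ^ (m + 2) * (m + 2)!))) * intensityConst m ^ 2

theorem nearConst_ne_top (m : ℕ) : nearConst m ≠ ⊤ := by
  have := detMoment_ne_top m
  have h := ofReal_sqrt_two_pi_pow_ne_zero (2 * m)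
  unfold nearConst
  finiteness

theorem farConst_ne_top (m : ℕ) : farConst m ≠ ⊤ := by
  have := intensityConst_ne_top m
  unfold farConst
  finiteness

theorem near_factor_le {m : ℕ} (hm : m ≠ 0) {t W : ℝ} (ht : 0 < t) (ht' : t ≤ 200) (hW : 0 < W)
    (hWt : W ≤ (m + 1) * √t) :
    t * (√(1 + t) / √t) ^ m ≤ 15 ^ (m + 1) * (m + 1) ^ (m - 1) * (W ^ (m - 1))⁻¹ := by
  obtain ⟨k, rfl⟩ := Nat.exists_eq_succ_of_ne_zero hm
  have h1 : √(1 + t) ≤ 15 := by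
    rw [Real.sqrt_le_left (by norm_num)]; linarith
  have h2 : √t ≤ 15 := by
    rw [Real.sqrt_le_left (by norm_num)]; linarith
  have hs : 0 < √t := Real.sqrt_pos.2 ht
  have h3 : (√t)⁻¹ ≤ (((k + 1 : ℕ) : ℝ) + 1) * W⁻¹ := by
    rw [← div_eq_mul_inv, le_div_iff₀ hW, inv_mul_le_iff₀ hs]
    linarith
  simp only [Nat.succ_eq_add_one, Nat.add_sub_cancel] at *
  have e : t = √t * √t := (Real.mul_self_sqrt ht.le).symm
  calc t * (√(1 + t) / √t) ^ (k + 1) = √t * √(1 + t) ^ (k + 1) * ((√t)⁻¹) ^ k := by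
        nth_rewrite 1 [e]
        rw [div_eq_mul_inv, mul_pow, pow_succ (√t)⁻¹]
        linear_combination √t * √(1 + t) ^ (k + 1) * (√t)⁻¹ ^ k * (mul_inv_cancel₀ hs.ne')
    _ ≤ 15 * 15 ^ (k + 1) * ((((k + 1 : ℕ) : ℝ) + 1) * W⁻¹) ^ k := by gcongr
    _ = _ := by rw [mul_pow, inv_pow]; ring

section
variable {ι : Type*} [Fintype ι] [DecidableEq ι]
variable {H : Type*} [NormedAddCommGroup H] [InnerProductSpace ℝ H] [FiniteDimensional ℝ H]
  [MeasurableSpace H] [BorelSpace H]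
variable {F : (ι → ℝ) → H} {F' : (ι → ℝ) → (ι → ℝ) →L[ℝ] H} {n : ℕ}

theorem gram_lower_bound (hk : ∀ x y, inner ℝ (F x) (F y) = (1 + x ⬝ᵥ y) ^ (n + 2)) (x y : ι → ℝ)
    (hq : 0 < sinSq x y) :
    √((n + 2) * (1 + x ⬝ᵥ x) ^ (n + 1)) * √((n + 2) * (1 + y ⬝ᵥ y) ^ (n + 1)) ≤
      (n + 2) * (√(1 + (n + 2) * sinSq x y) / √((n + 2) * sinSq x y)) *
      √(‖F x‖ ^ 2 * ‖F y‖ ^ 2 - inner ℝ (F x) (F y) ^ 2) := by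
  have hx := one_le_one_add_dot x
  have hy := one_le_one_add_dot y
  have hS := sinSq_mul x y
  have hq1 := sinSq_le_one x y
  rw [norm_F hk, norm_F hk, hk]
  set kx := 1 + x ⬝ᵥ x
  set ky := 1 + y ⬝ᵥ y
  set k := 1 + x ⬝ᵥ y
  set q := sinSq x y
  clear_value kx ky k q
  set t := (n + 2) * q with ht
  have ht0 : 0 < t := by positivity
  have hsq : k ^ 2 = kx * ky * (1 - q) := by linarith
  have e : kx ^ (n + 2) * ky ^ (n + 2) - (k ^ (n + 2)) ^ 2 =
      kx ^ (n + 2) * ky ^ (n + 2) * (1 - (1 - q) ^ (n + 2)) := by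
    rw [← pow_mul, mul_comm (n + 2) 2, pow_mul, hsq, mul_pow, mul_pow]; ring
  have h1 : t / (1 + t) ≤ 1 - (1 - q) ^ (n + 2) := by
    have h2 : (1 - q) ^ (n + 2) ≤ exp (-q) ^ (n + 2) := by
      have := Real.add_one_le_exp (-q)
      exact pow_le_pow_left₀ (by linarith) (by linarith) _
    have h3 : exp (-q) ^ (n + 2) = (exp t)⁻¹ := by
      rw [← Real.exp_nat_mul, ← Real.exp_neg, ht]; congr 1; push_cast; ring
    have h4 : (exp t)⁻¹ ≤ (1 + t)⁻¹ := by
      gcongr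
      have := Real.add_one_le_exp t; linarith
    have h5 : t / (1 + t) = 1 - (1 + t)⁻¹ := by field_simp; ring
    linarith
  have h6 : kx ^ (n + 1) * ky ^ (n + 1) * (t / (1 + t)) ≤ kx ^ (n + 2) * ky ^ (n + 2) - (k ^ (n + 2)) ^ 2 := by
    rw [e]
    have h7 := pow_le_pow_right₀ hx (show n + 1 ≤ n + 2 by omega)
    have h8 := pow_le_pow_right₀ hy (show n + 1 ≤ n + 2 by omega)
    gcongr
  calc _ = (n + 2) * (√(1 + t) / √t) * √(kx ^ (n + 1) * ky ^ (n + 1) * (t / (1 + t))) := by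
        clear_value t
        rw [Real.sqrt_mul (by positivity) (kx ^ (n + 1)), Real.sqrt_mul (by positivity) (ky ^ (n + 1)),
          Real.sqrt_mul (by positivity) (t / (1 + t)), Real.sqrt_mul (by positivity) (ky ^ (n + 1)),
          Real.sqrt_div (by positivity)]
        have h9 := Real.mul_self_sqrt (show (0 : ℝ) ≤ n + 2 by positivity)
        have h10 : √t ≠ 0 := (Real.sqrt_pos.2 ht0).ne'
        have h11 : √(1 + t) ≠ 0 := (Real.sqrt_pos.2 (by positivity)).ne'
        field_simp
        linear_combination h9
    _ ≤ _ := by gcongr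

theorem intensityTwo_near_le [Nonempty ι] (hF : ∀ x, HasFDerivAt F (F' x) x)
    (hk : ∀ x y, inner ℝ (F x) (F y) = (1 + x ⬝ᵥ y) ^ (n + 2)) {x y : ι → ℝ} (hx : ‖x‖ ≤ 1)
    (hy : ‖y‖ ≤ 1) (hne : x ≠ y) (ht : (n + 2) * sinSq x y ≤ 200) :
    intensityTwo F F' x y ≤ nearConst (Fintype.card ι) * ENNReal.ofReal ((n + 2) ^ Fintype.card ι *
      ((√(n + 2) * ‖x - y‖) ^ (Fintype.card ι - 1))⁻¹) := by
  have hxy : 0 < ‖x - y‖ := norm_pos_iff.2 (sub_ne_zero.2 hne)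
  have hq : 0 < sinSq x y := by
    have := norm_sq_le_sinSq hx hy
    have h2 : 0 < ‖x - y‖ ^ 2 := by positivity
    by_contra! h
    nlinarith [mul_nonneg (show (0 : ℝ) ≤ (Fintype.card ι + 1) ^ 2 by positivity) (neg_nonneg.2 h)]
  obtain ⟨i, hi⟩ : ∃ i, ‖x - y‖ = |x i - y i| := by
    obtain ⟨i, hi⟩ := Finite.exists_max fun i => ‖(x - y) i‖
    exact ⟨i, le_antisymm ((pi_norm_le_iff_of_nonneg (norm_nonneg _)).2 hi) (norm_le_pi_norm (x - y) i)⟩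
  have hyx : y i - x i ≠ 0 := by
    intro h
    rw [hi, abs_sub_comm, h, abs_zero] at hxy
    exact hxy.false
  have hW := norm_sub_mul_sqrt_le hx hy ((n : ℝ) + 2) (by positivity)
  have hfac := near_factor_le (m := Fintype.card ι) Fintype.card_ne_zero
    (t := (n + 2) * sinSq x y) (by positivity) ht (W := √(n + 2) * ‖x - y‖) (by positivity) hW
  have hgram := gram_lower_bound (F := F) hk x y hq
  have hp1 := prod_norm_update_le hF hk hy hi hne hq rfl
  have hp2 := prod_norm_update_le (x := y) (y := x) hF hk hx (i := i)
    (by rw [norm_sub_rev, hi, abs_sub_comm]) hne.symm (by rwa [sinSq_comm]) rfl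
  rw [Set.pair_comm, sinSq_comm] at hp2
  unfold intensityTwo
  set Q := (Submodule.span ℝ {F x, F y})ᗮ.starProjection
  set t := (n + 2) * sinSq x y with htdef
  have ht0 : 0 < t := by positivity
  have hI2 := lintegral_det_mul_det_le
    (Function.update (fun j => Q (F' x (Pi.single j 1))) i (Q (F' x ((y i - x i)⁻¹ • (y - x)))))
    (Function.update (fun j => Q (F' y (Pi.single j 1))) i (Q (F' y ((x i - y i)⁻¹ • (x - y)))))
  have e1 : ∀ ω : PiLp 2 (fun _ : ι => H), _ := fun ω => abs_det_eq_update (Q := Q) (W := F' x)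
    (v := (y i - x i)⁻¹ • (y - x)) (i := i) (by simp [hyx]) ω
  have e2 : ∀ ω : PiLp 2 (fun _ : ι => H), _ := fun ω => abs_det_eq_update (Q := Q) (W := F' y)
    (v := (x i - y i)⁻¹ • (x - y)) (i := i)
    (by rw [← neg_sub] at hyx; simpa using inv_mul_cancel₀ (neg_ne_zero.1 hyx)) ω
  simp_rw [e1, e2]
  set m := Fintype.card ι
  set G := √(‖F x‖ ^ 2 * ‖F y‖ ^ 2 - inner ℝ (F x) (F y) ^ 2)
  set A := √((n + 2) * (1 + x ⬝ᵥ x) ^ (n + 1))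
  set A' := √((n + 2) * (1 + y ⬝ᵥ y) ^ (n + 1))
  have hx1 := one_le_one_add_dot x
  have hy1 := one_le_one_add_dot y
  have hG : 0 < G := by
    have hAA : 0 < A * A' := by positivity
    by_contra! h
    have : G = 0 := le_antisymm h (Real.sqrt_nonneg _)
    rw [this, mul_zero] at hgram
    exact absurd hAA (not_lt.2 hgram)
  set P1 := ∏ j, ‖Function.update (fun j => Q (F' x (Pi.single j 1))) i
      (Q (F' x ((y i - x i)⁻¹ • (y - x)))) j‖
  set P2 := ∏ j, ‖Function.update (fun j => Q (F' y (Pi.single j 1))) i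
      (Q (F' y ((x i - y i)⁻¹ • (x - y)))) j‖
  have hP2 : 0 ≤ P2 := Finset.prod_nonneg fun _ _ => norm_nonneg _
  have hreal : (G ^ m)⁻¹ * (P1 * P2) ≤ ((m + 1) * m * 15 ^ (m + 1) * (m + 1) ^ (m - 1)) *
      ((n + 2) ^ m * ((√(n + 2) * ‖x - y‖) ^ (m - 1))⁻¹) := by
    rw [inv_mul_le_iff₀ (by positivity)]
    calc P1 * P2 ≤ (A ^ m * √((m + 1) * m * t)) * (A' ^ m * √((m + 1) * m * t)) := by gcongr
      _ = (A * A') ^ m * ((m + 1) * m * t) := by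
        have := Real.mul_self_sqrt (show 0 ≤ ((m : ℝ) + 1) * m * t by positivity)
        rw [mul_pow]; linear_combination A ^ m * A' ^ m * this
      _ ≤ ((n + 2) * (√(1 + t) / √t) * G) ^ m * ((m + 1) * m * t) := by gcongr
      _ = G ^ m * ((m + 1) * m * (n + 2) ^ m * (t * (√(1 + t) / √t) ^ m)) := by
        rw [mul_pow, mul_pow]; ring
      _ ≤ G ^ m * ((m + 1) * m * (n + 2) ^ m * (15 ^ (m + 1) * (m + 1) ^ (m - 1) *
          ((√(n + 2) * ‖x - y‖) ^ (m - 1))⁻¹)) := by gcongr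
      _ = _ := by ring
  calc _ ≤ ENNReal.ofReal ((G ^ m)⁻¹) * (ENNReal.ofReal (√(2 * π)) ^ (2 * m))⁻¹ *
        (detMoment m * ENNReal.ofReal (P1 * P2)) := mul_le_mul' le_rfl hI2
    _ = (ENNReal.ofReal (√(2 * π)) ^ (2 * m))⁻¹ * detMoment m * ENNReal.ofReal ((G ^ m)⁻¹ * (P1 * P2)) := by
        rw [ENNReal.ofReal_mul (p := (G ^ m)⁻¹) (by positivity)]; ring
    _ ≤ _ := by
        rw [nearConst, mul_assoc _ (ENNReal.ofReal ((m + 1) * m * 15 ^ (m + 1) * (m + 1) ^ (m - 1))),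
          ← ENNReal.ofReal_mul (by positivity)]
        exact mul_le_mul' le_rfl (ENNReal.ofReal_le_ofReal hreal)

theorem intensityTwo_le [Nonempty ι] (hF : ∀ x, HasFDerivAt F (F' x) x)
    (hk : ∀ x y, inner ℝ (F x) (F y) = (1 + x ⬝ᵥ y) ^ (n + 2)) {x y : ι → ℝ} (hx : ‖x‖ ≤ 1)
    (hy : ‖y‖ ≤ 1) (hne : x ≠ y) :
    intensityTwo F F' x y ≤ intensityOne F F' x * intensityOne F F' y +
      (nearConst (Fintype.card ι) + farConst (Fintype.card ι)) *
      ENNReal.ofReal ((n + 2) ^ Fintype.card ι * pairProfile (Fintype.card ι) (√(n + 2) * ‖x - y‖)) := by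
  set m := Fintype.card ι
  set W := √(n + 2) * ‖x - y‖ with hWdef
  have hW0 : 0 ≤ W := by positivity
  rcases le_total ((n + 2) * sinSq x y) 200 with ht | ht
  · refine (intensityTwo_near_le hF hk hx hy hne ht).trans (le_trans ?_ le_add_self)
    refine mul_le_mul' le_self_add (ENNReal.ofReal_le_ofReal ?_)
    gcongr
    unfold pairProfile
    have hW := norm_sub_mul_sqrt_le hx hy ((n : ℝ) + 2) (by positivity)
    have h2 : √((n + 2) * sinSq x y) ≤ 15 := by
      rw [Real.sqrt_le_left (by norm_num)]; linarith
    have : W ≤ 15 * (m + 1) := by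
      calc W ≤ _ := hW
        _ ≤ (m + 1) * 15 := by gcongr
        _ = _ := by ring
    rw [if_pos this]
    have : 0 ≤ ((1 + W) ^ (m + 1))⁻¹ := by positivity
    linarith
  · refine (intensityTwo_le_add_of_jetCorrelation_le hF hk x y (jetCorrelation_le_half ht)).trans ?_
    refine add_le_add le_rfl ?_
    have hd := jetCorrelation_decay hx hy ht
    calc _ ≤ ENNReal.ofReal (4 ^ (m ^ 2 + 2 * m + 1) * ((5 * (2 * (m + 1)) ^ (m + 1) *
            (4 ^ (m + 2) * (m + 2)!)) * pairProfile m W)) *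
          (intensityConst m ^ 2 * ENNReal.ofReal ((n + 2) ^ m)) := by
          refine mul_le_mul' (ENNReal.ofReal_le_ofReal ?_) le_rfl
          gcongr
          refine hd.trans ?_
          gcongr
          unfold pairProfile
          have : 0 ≤ (if W ≤ 15 * (m + 1) then (W ^ (m - 1))⁻¹ else 0) := by
            split_ifs <;> positivity
          linarith
      _ = farConst m * ENNReal.ofReal ((n + 2) ^ m * pairProfile m W) := by
          have := pairProfile_nonneg m hW0
          rw [← mul_assoc (4 ^ (m ^ 2 + 2 * m + 1) : ℝ) _ (pairProfile m W),
            ENNReal.ofReal_mul (q := pairProfile m W) (by positivity), farConst,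
            ENNReal.ofReal_mul (p := ((n : ℝ) + 2) ^ m) (by positivity)]
          ring
      _ ≤ _ := mul_le_mul' le_add_self le_rfl
end

theorem measurable_pairProfile (m : ℕ) : Measurable (pairProfile m) := by
  unfold pairProfile
  refine Measurable.add ?_ (by fun_prop)
  exact Measurable.ite measurableSet_Iic (by fun_prop) measurable_const

theorem integrable_pairProfile_norm {ι : Type*} [Fintype ι] [Nonempty ι] :
    Integrable (fun w : ι → ℝ => pairProfile (Fintype.card ι) ‖w‖) := by
  set m := Fintype.card ι
  unfold pairProfile
  refine Integrable.add ?_ ?_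
  · rw [integrable_fun_norm_addHaar (E := ι → ℝ) volume
      (f := fun s : ℝ => if s ≤ 15 * (m + 1) then (s ^ (m - 1))⁻¹ else 0)]
    have h : IntegrableOn (Set.indicator (Set.Ioc 0 (15 * ((m : ℝ) + 1))) fun _ => (1 : ℝ))
        (Set.Ioi 0) := by
      refine Integrable.integrableOn ?_
      rw [integrable_indicator_iff measurableSet_Ioc]
      simp
      finiteness
    refine h.congr_fun (fun y hy => ?_) measurableSet_Ioi
    have hy' : (0 : ℝ) < y := hy
    simp only [Module.finrank_fintype_fun_eq_card, smul_eq_mul, Set.indicator_apply, Set.mem_Ioc, hy',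
      true_and]
    split_ifs
    · rw [mul_inv_cancel₀ (by positivity)]
    · simp
  · have := integrable_one_add_norm (E := ι → ℝ) (μ := volume) (r := ((m + 1 : ℕ) : ℝ)) (by
      simp [m])
    refine this.congr (Eventually.of_forall fun x => ?_)
    simp only
    rw [Real.rpow_neg (by positivity), Real.rpow_natCast]

/-- Total mass of the radial profile. -/
noncomputable def profileMass (m : ℕ) : ENNReal :=
  ∫⁻ w : Fin m → ℝ, ENNReal.ofReal (pairProfile m ‖w‖)

theorem profileMass_ne_top {m : ℕ} (hm : m ≠ 0) : profileMass m ≠ ⊤ := by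
  have : Nonempty (Fin m) := Fin.pos_iff_nonempty.1 (Nat.pos_of_ne_zero hm)
  have h := integrable_pairProfile_norm (ι := Fin m)
  rw [Fintype.card_fin] at h
  exact ((hasFiniteIntegral_iff_ofReal (Eventually.of_forall fun w =>
    pairProfile_nonneg m (norm_nonneg w))).1 h.2).ne

theorem lintegral_pairProfile_scaled (m n : ℕ) (x : Fin m → ℝ) :
    ∫⁻ y, ENNReal.ofReal ((n + 2) ^ m * pairProfile m (√(n + 2) * ‖x - y‖)) =
      ENNReal.ofReal (√(n + 2) ^ m) * profileMass m := by
  have hs : 0 < √((n : ℝ) + 2) := Real.sqrt_pos.2 (by positivity)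
  have hmeas : Measurable fun w : Fin m → ℝ => ENNReal.ofReal (pairProfile m ‖w‖) :=
    ((measurable_pairProfile m).comp measurable_norm).ennreal_ofReal
  have h1 : ∀ y : Fin m → ℝ, ENNReal.ofReal ((n + 2) ^ m * pairProfile m (√(n + 2) * ‖x - y‖)) =
      ENNReal.ofReal ((n + 2) ^ m) * ENNReal.ofReal (pairProfile m ‖√((n : ℝ) + 2) • (x - y)‖) := by
    intro y
    rw [norm_smul, Real.norm_of_nonneg hs.le, ENNReal.ofReal_mul (by positivity)]
  simp_rw [h1]
  rw [lintegral_const_mul' _ _ ENNReal.ofReal_ne_top,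
    lintegral_sub_left_eq_self (fun z : Fin m → ℝ => ENNReal.ofReal (pairProfile m ‖√((n : ℝ) + 2) • z‖)) x,
    ← lintegral_map (μ := volume) hmeas (measurable_const_smul (√((n : ℝ) + 2))),
    Measure.map_addHaar_smul _ hs.ne', lintegral_smul_measure, profileMass, smul_eq_mul, ← mul_assoc,
    ← ENNReal.ofReal_mul (by positivity)]
  congr 2
  rw [Module.finrank_fin_fun, abs_of_nonneg (by positivity)]
  have : ((n : ℝ) + 2) ^ m = √(n + 2) ^ m * √(n + 2) ^ m := by
    rw [← mul_pow, Real.mul_self_sqrt (by positivity)]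
  rw [this]
  field_simp

/-- A nonnegative extended random variable whose second moment is controlled by its mean. -/
theorem variance_toReal_le {Ω : Type*} [MeasurableSpace Ω] {μ : Measure Ω} [IsProbabilityMeasure μ]
    {X : Ω → ENNReal} (hX : AEMeasurable X μ) {M R : ENNReal} (hM : M ≠ ⊤) (hR : R ≠ ⊤)
    (h1 : ∫⁻ ω, X ω ∂μ = M) (h2 : ∫⁻ ω, X ω ^ 2 ∂μ ≤ M ^ 2 + R) :
    MemLp (fun ω => (X ω).toReal) 2 μ ∧ variance (fun ω => (X ω).toReal) μ ≤ R.toReal := by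
  have hfin : ∀ᵐ ω ∂μ, X ω < ⊤ := ae_lt_top' hX (h1 ▸ hM)
  have hfin2 : ∀ᵐ ω ∂μ, X ω ^ 2 < ⊤ := hfin.mono fun ω h => by finiteness
  have hS : ∫⁻ ω, X ω ^ 2 ∂μ ≠ ⊤ := ne_top_of_le_ne_top (by finiteness) h2
  have hmem : MemLp (fun ω => (X ω).toReal) 2 μ := by
    rw [memLp_two_iff_integrable_sq hX.ennreal_toReal.aestronglyMeasurable]
    refine (integrable_toReal_of_lintegral_ne_top (hX.pow_const 2) hS).congr ?_
    exact Eventually.of_forall fun ω => by simp [ENNReal.toReal_pow]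
  refine ⟨hmem, ?_⟩
  rw [variance_eq_sub hmem]
  have e1 : ∫ ω, (X ω).toReal ∂μ = M.toReal := by rw [integral_toReal hX hfin, h1]
  have e2 : ∫ ω, ((fun ω => (X ω).toReal) ^ 2) ω ∂μ = (∫⁻ ω, X ω ^ 2 ∂μ).toReal := by
    rw [← integral_toReal (hX.pow_const 2) hfin2]
    simp [ENNReal.toReal_pow]
  rw [e1, e2]
  have := ENNReal.toReal_mono (by finiteness) h2
  rw [ENNReal.toReal_add (by finiteness) hR, ENNReal.toReal_pow] at this
  linarith

/-- Pairs of points of `B` whose first distinct coordinate is the `i`-th one. -/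
def separatedPairs {m : ℕ} (B : Set (Fin m → ℝ)) (i : Fin m) : Set ((Fin m → ℝ) × (Fin m → ℝ)) :=
  {p | p ∈ B ×ˢ B ∧ p.1 i ≠ p.2 i ∧ ∀ j, j < i → p.1 j = p.2 j}

theorem measurableSet_separatedPairs {m : ℕ} {B : Set (Fin m → ℝ)} (hB : MeasurableSet B) (i : Fin m) :
    MeasurableSet (separatedPairs B i) := by
  unfold separatedPairs
  refine (hB.prod hB).inter (MeasurableSet.inter ?_ ?_)
  · exact (measurableSet_eq_fun (by fun_prop) (by fun_prop)).compl
  · have : {p : (Fin m → ℝ) × (Fin m → ℝ) | ∀ j, j < i → p.1 j = p.2 j} =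
        ⋂ j, ⋂ _ : j < i, {p | p.1 j = p.2 j} := by ext; simp
    change MeasurableSet {p : (Fin m → ℝ) × (Fin m → ℝ) | ∀ j, j < i → p.1 j = p.2 j}
    rw [this]
    exact MeasurableSet.iInter fun j => MeasurableSet.iInter fun _ =>
      measurableSet_eq_fun (by fun_prop) (by fun_prop)

theorem pairwise_disjoint_separatedPairs {m : ℕ} (B : Set (Fin m → ℝ)) :
    Pairwise (Function.onFun Disjoint (separatedPairs B)) := by
  intro i j hij
  refine Set.disjoint_left.2 fun p hp hq => ?_
  rcases lt_or_gt_of_ne hij with h | h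
  · exact hp.2.1 (hq.2.2 i h)
  · exact hq.2.1 (hp.2.2 j h)

theorem exists_mem_separatedPairs {m : ℕ} {B : Set (Fin m → ℝ)} {p : (Fin m → ℝ) × (Fin m → ℝ)}
    (hp : p ∈ B ×ˢ B) (hne : p.1 ≠ p.2) : ∃ i, p ∈ separatedPairs B i := by
  have hex : ∃ i, p.1 i ≠ p.2 i := Function.ne_iff.1 hne
  let s : Finset (Fin m) := Finset.univ.filter fun i => p.1 i ≠ p.2 i
  have hs : s.Nonempty := by
    obtain ⟨i, hi⟩ := hex
    exact ⟨i, by simp [s, hi]⟩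
  refine ⟨s.min' hs, hp, (Finset.mem_filter.1 (s.min'_mem hs)).2, fun j hj => ?_⟩
  by_contra h
  exact absurd (s.min'_le j (by simp [s, h])) (not_le.2 hj)

theorem encard_iUnion_le_sum {α β : Type*} [Fintype β] (s : β → Set α) :
    (⋃ i, s i).encard ≤ ∑ i, (s i).encard := by
  classical
  have : ∀ t : Finset β, (⋃ i ∈ t, s i).encard ≤ ∑ i ∈ t, (s i).encard := by
    intro t
    induction t using Finset.induction with
    | empty => simp
    | insert a t ha ih =>
      rw [Finset.set_biUnion_insert, Finset.sum_insert ha]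
      exact (Set.encard_union_le _ _).trans (add_le_add le_rfl ih)
  simpa using this Finset.univ

theorem encard_sq_le {m : ℕ} (B Z : Set (Fin m → ℝ)) :
    ((B ∩ Z).encard : ENNReal) ^ 2 ≤ ((B ∩ Z).encard : ENNReal) +
      ∑ i, ((separatedPairs B i ∩ Z ×ˢ Z).encard : ENNReal) := by
  have h : (B ∩ Z) ×ˢ (B ∩ Z) ⊆
      (fun x => (x, x)) '' (B ∩ Z) ∪ ⋃ i, separatedPairs B i ∩ Z ×ˢ Z := by
    rintro ⟨x, y⟩ ⟨hx, hy⟩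
    by_cases hxy : x = y
    · exact Or.inl ⟨x, hx, by simp [hxy]⟩
    · obtain ⟨i, hi⟩ := exists_mem_separatedPairs (B := B) (p := (x, y)) ⟨hx.1, hy.1⟩ hxy
      exact Or.inr (Set.mem_iUnion.2 ⟨i, hi, hx.2, hy.2⟩)
  have h2 : (B ∩ Z).encard * (B ∩ Z).encard ≤ (B ∩ Z).encard +
      ∑ i, (separatedPairs B i ∩ Z ×ˢ Z).encard := by
    rw [← Set.encard_prod]
    refine (Set.encard_le_encard h).trans ((Set.encard_union_le _ _).trans ?_)
    refine add_le_add (le_of_eq ?_) (encard_iUnion_le_sum _)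
    exact Set.InjOn.encard_image fun a _ b _ hab => (Prod.mk.inj hab).1
  have h3 := ENat.toENNReal_le.2 h2
  rw [ENat.toENNReal_mul, ENat.toENNReal_add] at h3
  rw [sq]
  exact h3.trans_eq (congrArg _ (map_sum ENat.toENNRealRingHom _ _))

section
variable {m : ℕ}
variable {H : Type*} [NormedAddCommGroup H] [InnerProductSpace ℝ H] [FiniteDimensional ℝ H]
  [MeasurableSpace H] [BorelSpace H]
variable {F : (Fin m → ℝ) → H} {F' : (Fin m → ℝ) → (Fin m → ℝ) →L[ℝ] H} {n : ℕ}

/-- Constant in the variance bound on a chart. -/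
noncomputable def chartConst (m : ℕ) : ENNReal :=
  intensityConst m + (nearConst m + farConst m) * profileMass m

theorem chartConst_ne_top (hm : m ≠ 0) : chartConst m ≠ ⊤ := by
  have := profileMass_ne_top hm
  have := intensityConst_ne_top m
  have := nearConst_ne_top m
  have := farConst_ne_top m
  unfold chartConst
  finiteness

theorem lintegral_intensityTwo_le (hm : m ≠ 0) (hF : ∀ x, HasFDerivAt F (F' x) x)
    (hk : ∀ x y, inner ℝ (F x) (F y) = (1 + x ⬝ᵥ y) ^ (n + 2))
    {B : Set (Fin m → ℝ)} (hB : MeasurableSet B) (hB1 : ∀ x ∈ B, ‖x‖ ≤ 1)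
    (hM : ∫⁻ x in B, intensityOne F F' x ≠ ⊤) :
    ∑ i, ∫⁻ p in separatedPairs B i, intensityTwo F F' p.1 p.2 ≤
      (∫⁻ x in B, intensityOne F F' x) ^ 2 +
        (nearConst m + farConst m) * profileMass m * ENNReal.ofReal (√(n + 2) ^ m) * volume B := by
  have : Nonempty (Fin m) := Fin.pos_iff_nonempty.1 (Nat.pos_of_ne_zero hm)
  set c := nearConst m + farConst m
  have hc : c ≠ ⊤ := ENNReal.add_ne_top.2 ⟨nearConst_ne_top m, farConst_ne_top m⟩
  let κ : (Fin m → ℝ) × (Fin m → ℝ) → ENNReal := fun p =>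
    c * ENNReal.ofReal ((n + 2) ^ m * pairProfile m (√(n + 2) * ‖p.1 - p.2‖))
  have hκ : Measurable κ := by
    have := measurable_pairProfile m
    fun_prop
  have hI : ∀ x, intensityOne F F' x ≠ ⊤ := fun x =>
    ne_top_of_le_ne_top (ENNReal.mul_ne_top (intensityConst_ne_top _) ENNReal.ofReal_ne_top)
      (intensityOne_le hF hk x)
  let g : (Fin m → ℝ) × (Fin m → ℝ) → ENNReal := fun p =>
    intensityOne F F' p.1 * intensityOne F F' p.2
  have hpt : ∀ i, ∀ p ∈ separatedPairs B i, intensityTwo F F' p.1 p.2 ≤ g p + κ p := by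
    intro i p hp
    have := intensityTwo_le hF hk (hB1 _ hp.1.1) (hB1 _ hp.1.2) (fun h => hp.2.1 (by rw [h]))
    simpa only [Fintype.card_fin] using this
  calc ∑ i, ∫⁻ p in separatedPairs B i, intensityTwo F F' p.1 p.2
      ≤ ∑ i, ∫⁻ p in separatedPairs B i, (g p + κ p) :=
        Finset.sum_le_sum fun i _ => setLIntegral_mono' (measurableSet_separatedPairs hB i) (hpt i)
    _ = ∫⁻ p in ⋃ i, separatedPairs B i, (g p + κ p) := by
        rw [lintegral_iUnion (measurableSet_separatedPairs hB) (pairwise_disjoint_separatedPairs B),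
          tsum_fintype]
    _ ≤ ∫⁻ p in B ×ˢ B, (g p + κ p) :=
        lintegral_mono_set (Set.iUnion_subset fun i p hp => hp.1)
    _ = (∫⁻ p in B ×ˢ B, g p) + ∫⁻ p in B ×ˢ B, κ p := lintegral_add_right _ hκ
    _ ≤ _ := by
        rw [Measure.volume_eq_prod, ← Measure.prod_restrict]
        refine add_le_add ((lintegral_prod_le _).trans (le_of_eq ?_)) ((lintegral_prod_le _).trans ?_)
        · simp only [g]
          simp_rw [lintegral_const_mul' _ _ (hI _)]
          rw [sq]
          rw [lintegral_mul_const' _ _ hM]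
        · calc ∫⁻ x in B, ∫⁻ y in B, κ (x, y) ≤
                ∫⁻ x in B, c * (ENNReal.ofReal (√(n + 2) ^ m) * profileMass m) := by
                refine lintegral_mono fun x => ?_
                rw [← lintegral_pairProfile_scaled m n x, ← lintegral_const_mul' _ _ hc]
                exact setLIntegral_le_lintegral _ _
            _ = _ := by rw [lintegral_const]; simp; ring

theorem chart_variance (hm : m ≠ 0) (hF : ∀ x, HasFDerivAt F (F' x) x) (hF' : Continuous F')
    (hk : ∀ x y, inner ℝ (F x) (F y) = (1 + x ⬝ᵥ y) ^ (n + 2))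
    {B : Set (Fin m → ℝ)} (hB : MeasurableSet B) (hB1 : ∀ x ∈ B, ‖x‖ ≤ 1) :
    MemLp (fun ω => ((B ∩ zeroSet F ω).ncard : ℝ)) 2
        (stdGaussian (PiLp 2 (fun _ : Fin m => H))) ∧
      (∀ᵐ ω ∂stdGaussian (PiLp 2 (fun _ : Fin m => H)), (B ∩ zeroSet F ω).Finite) ∧
      variance (fun ω => ((B ∩ zeroSet F ω).ncard : ℝ))
        (stdGaussian (PiLp 2 (fun _ : Fin m => H))) ≤
      (chartConst m).toReal * √(n + 2) ^ m * (volume B).toReal := by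
  have : Nonempty (Fin m) := Fin.pos_iff_nonempty.1 (Nat.pos_of_ne_zero hm)
  have e0 : ∀ x, inner ℝ (F x) (F 0) = 1 := fun x => by simp [hk]
  have e1 : ∀ x i, inner ℝ (F x) (((n : ℝ) + 2)⁻¹ • F' 0 (Pi.single i 1)) = x i := by
    intro x i
    rw [inner_smul_right, real_inner_comm, inner_deriv_left hF hk]
    have : (n : ℝ) + 2 ≠ 0 := by positivity
    simp [this]
  obtain ⟨hM1, h1⟩ := one_point_kac_rice hF hF' hB (F 0) (fun x _ => by rw [e0]; exact one_ne_zero)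
  have h2 := fun i => two_point_kac_rice hF hF' (measurableSet_separatedPairs hB i) (F 0)
    (((n : ℝ) + 2)⁻¹ • F' 0 (Pi.single i 1)) (fun p hp => by
      rw [e0, e0, e1, e1]
      have := hp.2.1
      intro h
      exact this (by linarith))
  have hvol : volume B ≠ ⊤ := by
    refine ne_top_of_le_ne_top ?_ (measure_mono (t := Metric.closedBall 0 1) fun x hx => by
      simpa using hB1 x hx)
    exact measure_closedBall_lt_top.ne
  have hMle : ∫⁻ x in B, intensityOne F F' x ≤ intensityConst m * ENNReal.ofReal (√(n + 2) ^ m) * volume B := by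
    calc _ ≤ ∫⁻ x in B, intensityConst m * ENNReal.ofReal (√(n + 2) ^ m) :=
          lintegral_mono fun x => by simpa only [Fintype.card_fin] using intensityOne_le hF hk x
      _ = _ := by simp
  have hMtop : ∫⁻ x in B, intensityOne F F' x ≠ ⊤ := by
    have := intensityConst_ne_top m
    exact ne_top_of_le_ne_top (by finiteness) hMle
  have hC := chartConst_ne_top hm
  have key := variance_toReal_le (μ := stdGaussian (PiLp 2 (fun _ : Fin m => H)))
    (R := chartConst m * ENNReal.ofReal (√(n + 2) ^ m) * volume B) hM1 hMtop (by finiteness) h1 (by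
      calc _ ≤ ∫⁻ ω, (((B ∩ zeroSet F ω).encard : ENNReal) + ∑ i,
              ((separatedPairs B i ∩ zeroSet F ω ×ˢ zeroSet F ω).encard : ENNReal)) ∂(stdGaussian _) :=
            lintegral_mono fun ω => encard_sq_le _ _
        _ = (∫⁻ x in B, intensityOne F F' x) +
            ∑ i, ∫⁻ p in separatedPairs B i, intensityTwo F F' p.1 p.2 := by
            rw [lintegral_add_left' hM1, h1, lintegral_finsetSum' _ fun i _ => (h2 i).1]
            simp_rw [fun i => (h2 i).2]
        _ ≤ intensityConst m * ENNReal.ofReal (√(n + 2) ^ m) * volume B +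
            ((∫⁻ x in B, intensityOne F F' x) ^ 2 +
        (nearConst m + farConst m) * profileMass m * ENNReal.ofReal (√(n + 2) ^ m) * volume B) :=
            add_le_add hMle (lintegral_intensityTwo_le hm hF hk hB hB1 hMtop)
        _ = _ := by rw [chartConst]; ring)
  have hcard : ∀ ω : PiLp 2 (fun _ : Fin m => H),
      ((B ∩ zeroSet F ω).encard : ENNReal).toReal = ((B ∩ zeroSet F ω).ncard : ℝ) := by
    intro ω
    rw [Set.ncard]
    cases (B ∩ zeroSet F ω).encard <;> simp
  simp_rw [hcard] at key
  refine ⟨key.1, ?_, key.2.trans_eq ?_⟩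
  · filter_upwards [ae_lt_top' hM1 (by rw [h1]; exact hMtop)] with ω hω
    exact Set.encard_lt_top_iff.1 (ENat.toENNReal_lt_top.1 hω)
  rw [ENNReal.toReal_mul, ENNReal.toReal_mul, ENNReal.toReal_ofReal (by positivity)]
end

/-- Multi-indices of degree `d`. -/
abbrev multiIndex (m d : ℕ) := {j : Fin (m + 1) → Fin (d + 1) // (∑ k, (j k : ℕ)) = d}

/-- Standard deviation of the coefficient of index `j`. -/
noncomputable def coeffStd (m d : ℕ) (j : multiIndex m d) : ℝ :=
  √((d ! : ℝ) / ((∏ k, ((j.1 k : ℕ))! : ℕ) : ℝ))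

/-- Space of normalized coefficients. -/
abbrev coeffSpace (m d : ℕ) := PiLp 2 (fun _ : Fin m => EuclideanSpace ℝ (multiIndex m d))

/-- Coefficients of the field in terms of standard Gaussian variables. -/
noncomputable def coeffMap (m d : ℕ) (w : coeffSpace m d) : hkssIndex m d → ℝ :=
  fun i => coeffStd m d i.2 * w i.1 i.2

theorem coeffStd_sq (m d : ℕ) (i : hkssIndex m d) : coeffStd m d i.2 ^ 2 = hkssVar m d i := by
  rw [coeffStd, Real.sq_sqrt (by positivity), hkssVar]
  push_cast
  rfl

theorem measurable_coeffMap (m d : ℕ) : Measurable (coeffMap m d) := by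
  unfold coeffMap
  fun_prop

theorem map_coeffMap (m d : ℕ) :
    (stdGaussian (coeffSpace m d)).map (coeffMap m d) = hkssMeasure m d := by
  let e : EuclideanSpace ℝ (hkssIndex m d) ≃ₗᵢ[ℝ] coeffSpace m d :=
    (LinearIsometryEquiv.piLpCongrLeft 2 ℝ ℝ
      (Equiv.sigmaEquivProd (Fin m) (multiIndex m d)).symm).trans
      (LinearIsometryEquiv.piLpCurry ℝ 2 fun _ _ => ℝ)
  have he : ∀ v, coeffMap m d (e v) = fun i => coeffStd m d i.2 * v i := by
    intro v
    rfl
  rw [← stdGaussian_map e, Measure.map_map (measurable_coeffMap m d) e.continuous.measurable,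
    ← map_pi_eq_stdGaussian, Measure.map_map ((measurable_coeffMap m d).comp e.continuous.measurable)
      (by fun_prop)]
  have h2 : (coeffMap m d ∘ ⇑e) ∘ WithLp.toLp 2 = fun x i => coeffStd m d i.2 * x i := by
    funext x
    exact he _
  rw [h2, hkssMeasure]
  have h3 : ∀ i : hkssIndex m d, (gaussianReal 0 1).map (fun y => coeffStd m d i.2 * y) =
      gaussianReal 0 (hkssVar m d i) := by
    intro i
    rw [gaussianReal_map_const_mul, mul_zero, mul_one]
    congr 1
    exact NNReal.eq (coeffStd_sq m d i)
  rw [Measure.pi_map_pi (f := fun (i : hkssIndex m d) y => coeffStd m d i.2 * y)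
    (fun i => by fun_prop)]
  simp_rw [h3]

/-- Feature map of the homogeneous field. -/
noncomputable def homFeature (m d : ℕ) (t : Fin (m + 1) → ℝ) : EuclideanSpace ℝ (multiIndex m d) :=
  WithLp.toLp 2 fun j => coeffStd m d j * ∏ k, t k ^ (j.1 k : ℕ)

theorem hkssPoly_coeffMap (m d : ℕ) (w : coeffSpace m d) (ℓ : Fin m) (t : Fin (m + 1) → ℝ) :
    hkssPoly m d (coeffMap m d w) ℓ t = inner ℝ (homFeature m d t) (w ℓ) := by
  simp only [hkssPoly, coeffMap, homFeature, PiLp.inner_apply, RCLike.inner_apply, conj_trivial]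
  refine Finset.sum_congr rfl fun j _ => ?_
  ring

theorem inner_homFeature (m d : ℕ) (t s : Fin (m + 1) → ℝ) :
    inner ℝ (homFeature m d t) (homFeature m d s) = (t ⬝ᵥ s) ^ d := by
  rw [dotProduct, Finset.sum_pow_eq_sum_piAntidiag]
  simp only [homFeature, PiLp.inner_apply, RCLike.inner_apply, conj_trivial]
  refine Finset.sum_bij (fun j _ k => (j.1 k : ℕ)) ?_ ?_ ?_ ?_
  · intro j _
    simpa using j.2
  · intro j _ j' _ h
    exact Subtype.ext (funext fun k => Fin.ext (congrFun h k))
  · intro f hf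
    have hs := (Finset.mem_piAntidiag.1 hf).1
    refine ⟨⟨fun k => ⟨f k, Nat.lt_succ_of_le ?_⟩, hs⟩, Finset.mem_univ _, rfl⟩
    rw [← hs]
    exact Finset.single_le_sum (f := f) (fun _ _ => Nat.zero_le _) (Finset.mem_univ k)
  · intro j _
    have h1 := Nat.multinomial_spec Finset.univ fun k => (j.1 k : ℕ)
    rw [j.2] at h1
    have h2 : ((∏ k, ((j.1 k : ℕ))! : ℕ) : ℝ) ≠ 0 := by
      exact_mod_cast Finset.prod_ne_zero_iff.2 fun k _ => Nat.factorial_ne_zero _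
    have h3 : coeffStd m d j ^ 2 = Nat.multinomial Finset.univ fun k => (j.1 k : ℕ) := by
      rw [coeffStd, Real.sq_sqrt (by positivity), div_eq_iff h2, ← h1]
      push_cast; ring
    rw [← h3]
    simp_rw [mul_pow]
    rw [Finset.prod_mul_distrib]
    ring

/-- Feature map in the affine chart `t_i = 1`. -/
noncomputable def chartFeature (m d : ℕ) (i : Fin (m + 1)) (x : Fin m → ℝ) :
    EuclideanSpace ℝ (multiIndex m d) :=
  homFeature m d (i.insertNth 1 x)

theorem inner_chartFeature (m d : ℕ) (i : Fin (m + 1)) (x y : Fin m → ℝ) :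
    inner ℝ (chartFeature m d i x) (chartFeature m d i y) = (1 + x ⬝ᵥ y) ^ d := by
  rw [chartFeature, chartFeature, inner_homFeature]
  simp [dotProduct, Fin.sum_univ_succAbove _ i]

theorem contDiff_chartFeature (m d : ℕ) (i : Fin (m + 1)) : ContDiff ℝ 1 (chartFeature m d i) := by
  unfold chartFeature homFeature
  rw [contDiff_euclidean]
  intro j
  simp only
  refine contDiff_const.mul (contDiff_prod fun k _ => ContDiff.pow ?_ _)
  rcases Fin.eq_self_or_eq_succAbove i k with rfl | ⟨l, rfl⟩
  · simpa using contDiff_const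
  · simpa using contDiff_apply ℝ ℝ l

theorem homFeature_smul (m d : ℕ) (c : ℝ) (t : Fin (m + 1) → ℝ) :
    homFeature m d (c • t) = c ^ d • homFeature m d t := by
  ext j
  simp only [homFeature, Pi.smul_apply, smul_eq_mul, mul_pow, Finset.prod_mul_distrib,
    Finset.prod_pow_eq_pow_sum, j.2, PiLp.smul_apply]
  ring

/-- The sign attached to a Boolean. -/
def boolSign (b : Bool) : ℝ := if b then 1 else -1

theorem boolSign_mul_self (b : Bool) : boolSign b * boolSign b = 1 := by
  cases b <;> simp [boolSign]

theorem abs_boolSign (b : Bool) : |boolSign b| = 1 := by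
  cases b <;> simp [boolSign]

section
variable {m : ℕ}

/-- The point of the affine hyperplane `t_i = 1` with remaining coordinates `x`. -/
noncomputable def affinePoint (i : Fin (m + 1)) (x : Fin m → ℝ) : EuclideanSpace ℝ (Fin (m + 1)) :=
  WithLp.toLp 2 (i.insertNth 1 x)

theorem one_le_norm_affinePoint (i : Fin (m + 1)) (x : Fin m → ℝ) : 1 ≤ ‖affinePoint i x‖ := by
  have := PiLp.norm_apply_le (affinePoint i x) i
  simpa [affinePoint] using this

/-- Central projection of the hyperplane `t_i = 1` on a half-sphere. -/
noncomputable def sphereChart (i : Fin (m + 1)) (b : Bool) (x : Fin m → ℝ) :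
    EuclideanSpace ℝ (Fin (m + 1)) :=
  (boolSign b * ‖affinePoint i x‖⁻¹) • affinePoint i x

/-- Affine coordinates of a point off the hyperplane `t_i = 0`. -/
noncomputable def affineCoord (i : Fin (m + 1)) (t : EuclideanSpace ℝ (Fin (m + 1))) : Fin m → ℝ :=
  fun k => t (i.succAbove k) / t i

/-- Part of the space where the `i`-th coordinate is the first of largest modulus and has the
given sign. -/
def chartPiece (i : Fin (m + 1)) (b : Bool) : Set (EuclideanSpace ℝ (Fin (m + 1))) :=
  {t | (∀ k, |t k| ≤ |t i|) ∧ (∀ k, k < i → |t k| < |t i|) ∧ 0 < boolSign b * t i}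

theorem measurableSet_chartPiece (i : Fin (m + 1)) (b : Bool) : MeasurableSet (chartPiece i b) := by
  have : chartPiece i b = (⋂ k, {t : EuclideanSpace ℝ (Fin (m + 1)) | |t k| ≤ |t i|}) ∩
      ((⋂ k, ⋂ _ : k < i, {t : EuclideanSpace ℝ (Fin (m + 1)) | |t k| < |t i|}) ∩
        {t : EuclideanSpace ℝ (Fin (m + 1)) | 0 < boolSign b * t i}) := by
    ext t; simp [chartPiece]
  rw [this]
  refine (MeasurableSet.iInter fun k => measurableSet_le (by fun_prop) (by fun_prop)).inter
    ((MeasurableSet.iInter fun k => MeasurableSet.iInter fun _ =>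
      measurableSet_lt (by fun_prop) (by fun_prop)).inter
      (measurableSet_lt (by fun_prop) (by fun_prop)))

theorem exists_mem_chartPiece {t : EuclideanSpace ℝ (Fin (m + 1))} (ht : t ≠ 0) :
    ∃ i b, t ∈ chartPiece i b := by
  obtain ⟨i₀, hi₀⟩ := Finite.exists_max fun k => |t k|
  let s : Finset (Fin (m + 1)) := Finset.univ.filter fun i => ∀ k, |t k| ≤ |t i|
  have hs : s.Nonempty := ⟨i₀, by simpa [s] using hi₀⟩
  set i := s.min' hs with hi
  have hmax : ∀ k, |t k| ≤ |t i| := (Finset.mem_filter.1 (s.min'_mem hs)).2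
  have hne : t i ≠ 0 := by
    intro h
    refine ht (PiLp.ext fun k => ?_)
    have := hmax k
    rw [h, abs_zero] at this
    exact abs_eq_zero.1 (le_antisymm this (abs_nonneg _))
  have hlt : ∀ k, k < i → |t k| < |t i| := by
    intro k hk
    by_contra! h
    have : k ∈ s := by
      simp only [s, Finset.mem_filter, Finset.mem_univ, true_and]
      exact fun l => (hmax l).trans h
    exact absurd (s.min'_le k this) (not_le.2 hk)
  rcases lt_or_gt_of_ne hne with h | h
  · exact ⟨i, false, hmax, hlt, by simpa [boolSign] using h⟩
  · exact ⟨i, true, hmax, hlt, by simpa [boolSign] using h⟩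

theorem chartPiece_unique {t : EuclideanSpace ℝ (Fin (m + 1))} {i i' : Fin (m + 1)} {b b' : Bool}
    (h : t ∈ chartPiece i b) (h' : t ∈ chartPiece i' b') : i = i' ∧ b = b' := by
  have hi : i = i' := by
    rcases lt_trichotomy i i' with hlt | heq | hgt
    · exact absurd (h.1 i') (not_le.2 (h'.2.1 i hlt))
    · exact heq
    · exact absurd (h'.1 i) (not_le.2 (h.2.1 i' hgt))
  subst hi
  refine ⟨rfl, ?_⟩
  have h1 := h.2.2
  have h2 := h'.2.2
  cases b <;> cases b' <;> simp [boolSign] at h1 h2 ⊢ <;> linarith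

theorem affineCoord_sphereChart (i : Fin (m + 1)) (b : Bool) (x : Fin m → ℝ) :
    affineCoord i (sphereChart i b x) = x := by
  funext k
  have h1 : ‖affinePoint i x‖ ≠ 0 := (zero_lt_one.trans_le (one_le_norm_affinePoint i x)).ne'
  have h2 : boolSign b ≠ 0 := by cases b <;> simp [boolSign]
  have h3 : affinePoint i x i = 1 := by simp [affinePoint]
  have h4 : affinePoint i x (i.succAbove k) = x k := by simp [affinePoint]
  simp only [affineCoord, sphereChart, PiLp.smul_apply, smul_eq_mul, h3, h4]
  field_simp

theorem sphereChart_affineCoord {i : Fin (m + 1)} {b : Bool} {t : EuclideanSpace ℝ (Fin (m + 1))}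
    (ht : ‖t‖ = 1) (hb : 0 < boolSign b * t i) : sphereChart i b (affineCoord i t) = t := by
  have hti : t i ≠ 0 := by rintro h; simp [h] at hb
  have e : affinePoint i (affineCoord i t) = (t i)⁻¹ • t := by
    ext k
    rcases Fin.eq_self_or_eq_succAbove i k with rfl | ⟨l, rfl⟩
    · simp [affinePoint, hti]
    · simp [affinePoint, affineCoord, div_eq_inv_mul]
  have h1 : |t i| = boolSign b * t i := by
    rw [← abs_of_pos hb, abs_mul, abs_boolSign, one_mul]
  rw [sphereChart, e, norm_smul, ht, norm_inv, Real.norm_eq_abs, mul_one, inv_inv, h1, smul_smul,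
    ← mul_assoc, boolSign_mul_self, one_mul, mul_inv_cancel₀ hti, one_smul]

theorem norm_affineCoord_le_one {i : Fin (m + 1)} {b : Bool} {t : EuclideanSpace ℝ (Fin (m + 1))}
    (ht : t ∈ chartPiece i b) : ‖affineCoord i t‖ ≤ 1 := by
  refine (pi_norm_le_iff_of_nonneg zero_le_one).2 fun k => ?_
  rw [affineCoord, Real.norm_eq_abs, abs_div]
  exact div_le_one_of_le₀ (ht.1 _) (abs_nonneg _)

theorem one_le_mul_abs_coord {i : Fin (m + 1)} {b : Bool} {t : EuclideanSpace ℝ (Fin (m + 1))}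
    (ht : t ∈ chartPiece i b) (hn : ‖t‖ = 1) : 1 ≤ (m + 1) * |t i| := by
  have h1 : ‖t‖ ^ 2 = ∑ k, |t k| ^ 2 := by
    rw [EuclideanSpace.norm_sq_eq]; simp
  have h2 : ∑ k, |t k| ^ 2 ≤ ∑ k : Fin (m + 1), |t i| * 1 := by
    refine Finset.sum_le_sum fun k _ => ?_
    rw [sq]
    have h3 : |t k| ≤ 1 := by
      have := PiLp.norm_apply_le t k
      rwa [hn] at this
    exact mul_le_mul (ht.1 k) h3 (abs_nonneg _) (abs_nonneg _)
  rw [← h1, hn] at h2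
  simpa using h2

theorem lipschitzOnWith_affineCoord (i : Fin (m + 1)) (b : Bool) :
    LipschitzOnWith (2 * (m + 1)) (affineCoord i)
      (Metric.sphere (0 : EuclideanSpace ℝ (Fin (m + 1))) 1 ∩ chartPiece i b) := by
  refine LipschitzOnWith.of_dist_le_mul fun t ht s hs => ?_
  have htn : ‖t‖ = 1 := by simpa using ht.1
  have hsn : ‖s‖ = 1 := by simpa using hs.1
  refine (dist_pi_le_iff (by positivity)).2 fun k => ?_
  have h1 := one_le_mul_abs_coord hs.2 hsn
  have hsi : 0 < |s i| := by
    by_contra! h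
    have : (m + 1 : ℝ) * |s i| ≤ 0 := mul_nonpos_of_nonneg_of_nonpos (by positivity) h
    linarith
  have hti : 0 < |t i| := by
    have h := ht.2.2.2
    exact abs_pos.2 (by rintro h0; simp [h0] at h)
  set l := i.succAbove k
  have h2 : |t i - s i| ≤ dist t s := by
    have := PiLp.norm_apply_le (t - s) i
    rwa [← dist_eq_norm] at this
  have h3 : |t l - s l| ≤ dist t s := by
    have := PiLp.norm_apply_le (t - s) l
    rwa [← dist_eq_norm] at this
  have e : t l / t i - s l / s i = (t i * (t l - s l) - t l * (t i - s i)) / (t i * s i) := by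
    field_simp [abs_pos.1 hti, abs_pos.1 hsi]
    ring
  rw [Real.dist_eq, affineCoord, affineCoord, e, abs_div, abs_mul, div_le_iff₀ (by positivity)]
  calc |t i * (t l - s l) - t l * (t i - s i)|
      ≤ |t i| * |t l - s l| + |t l| * |t i - s i| := by
        rw [← abs_mul, ← abs_mul]; exact abs_sub _ _
    _ ≤ |t i| * dist t s + |t i| * dist t s := by
        exact add_le_add (mul_le_mul_of_nonneg_left h3 (abs_nonneg _))
          (mul_le_mul (ht.2.1 l) h2 (abs_nonneg _) (abs_nonneg _))
    _ = 2 * 1 * |t i| * dist t s := by ring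
    _ ≤ 2 * ((m + 1) * |s i|) * |t i| * dist t s := by gcongr
    _ = _ := by push_cast; ring

theorem lipschitzWith_sphereChart (i : Fin (m + 1)) (b : Bool) :
    ∃ K, LipschitzWith K (sphereChart (m := m) i b) := by
  have h1 : LipschitzWith 1 (fun x : Fin m → ℝ => (i.insertNth 1 x : Fin (m + 1) → ℝ)) := by
    refine LipschitzWith.of_dist_le_mul fun x y => ?_
    simp only [NNReal.coe_one, one_mul]
    refine (dist_pi_le_iff dist_nonneg).2 fun k => ?_
    rcases Fin.eq_self_or_eq_succAbove i k with rfl | ⟨l, rfl⟩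
    · simp
    · simpa using dist_le_pi_dist x y l
  obtain ⟨K, h2⟩ : ∃ K, LipschitzWith K (affinePoint (m := m) i) :=
    ⟨_, (PiLp.lipschitzWith_toLp 2 (fun _ : Fin (m + 1) => ℝ)).comp h1⟩
  have h3 : ∀ u v : EuclideanSpace ℝ (Fin (m + 1)), 1 ≤ ‖u‖ → 1 ≤ ‖v‖ →
      ‖‖u‖⁻¹ • u - ‖v‖⁻¹ • v‖ ≤ 2 * ‖u - v‖ := by
    intro u v hu hv
    have hu0 : ‖u‖ ≠ 0 := by positivity
    have hv0 : ‖v‖ ≠ 0 := by positivity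
    have e : ‖u‖⁻¹ • u - ‖v‖⁻¹ • v = ‖u‖⁻¹ • (u - v) + (‖u‖⁻¹ * (‖v‖ - ‖u‖)) • (‖v‖⁻¹ • v) := by
      rw [smul_sub, smul_smul, sub_add_eq_add_sub, sub_eq_sub_iff_add_eq_add, add_assoc, ← sub_eq_zero]
      have : ‖u‖⁻¹ * (‖v‖ - ‖u‖) * ‖v‖⁻¹ = ‖u‖⁻¹ - ‖v‖⁻¹ := by field_simp
      rw [this]
      module
    rw [e]
    refine (norm_add_le _ _).trans ?_
    rw [norm_smul, norm_smul, norm_smul, norm_mul, norm_inv, norm_norm, norm_inv, norm_norm,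
      inv_mul_cancel₀ hv0, mul_one]
    have h5 : ‖u‖⁻¹ ≤ 1 := inv_le_one_of_one_le₀ hu
    have h6 : ‖‖v‖ - ‖u‖‖ ≤ ‖u - v‖ := by
      rw [Real.norm_eq_abs, norm_sub_rev]; exact abs_norm_sub_norm_le v u
    calc _ ≤ 1 * ‖u - v‖ + 1 * ‖u - v‖ := by gcongr
      _ = _ := by ring
  refine ⟨2 * K, LipschitzWith.of_dist_le_mul fun x y => ?_⟩
  have h4 := h3 _ _ (one_le_norm_affinePoint i x) (one_le_norm_affinePoint i y)
  rw [dist_eq_norm, sphereChart, sphereChart, mul_smul, mul_smul, ← smul_sub, norm_smul,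
    Real.norm_eq_abs, abs_boolSign, one_mul]
  refine h4.trans ?_
  rw [← dist_eq_norm]
  have := h2.dist_le_mul x y
  rw [NNReal.coe_mul, mul_assoc]
  exact mul_le_mul_of_nonneg_left this (by positivity)

end

section
variable {m : ℕ}

/-- The part of `G` in a chart piece, in affine coordinates. -/
def chartDomain (G : Set (EuclideanSpace ℝ (Fin (m + 1)))) (p : Fin (m + 1) × Bool) :
    Set (Fin m → ℝ) :=
  sphereChart p.1 p.2 ⁻¹' (G ∩ chartPiece p.1 p.2)

variable {G : Set (EuclideanSpace ℝ (Fin (m + 1)))}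

theorem measurableSet_chartDomain (hG : MeasurableSet G) (p : Fin (m + 1) × Bool) :
    MeasurableSet (chartDomain G p) := by
  obtain ⟨K, hK⟩ := lipschitzWith_sphereChart (m := m) p.1 p.2
  exact hK.continuous.measurable (hG.inter (measurableSet_chartPiece _ _))

theorem norm_le_one_of_mem_chartDomain {p : Fin (m + 1) × Bool} {x : Fin m → ℝ}
    (hx : x ∈ chartDomain G p) : ‖x‖ ≤ 1 := by
  rw [← affineCoord_sphereChart p.1 p.2 x]
  exact norm_affineCoord_le_one hx.2

theorem image_chartDomain (hG : G ⊆ Metric.sphere 0 1) (p : Fin (m + 1) × Bool) :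
    sphereChart p.1 p.2 '' chartDomain G p = G ∩ chartPiece p.1 p.2 := by
  refine Set.image_preimage_eq_of_subset fun t ht => ?_
  have hn : ‖t‖ = 1 := by simpa using hG ht.1
  exact ⟨_, sphereChart_affineCoord hn ht.2.2.2⟩

theorem affineCoord_image (hG : G ⊆ Metric.sphere 0 1) (p : Fin (m + 1) × Bool) :
    affineCoord p.1 '' (G ∩ chartPiece p.1 p.2) = chartDomain G p := by
  rw [← image_chartDomain hG p, Set.image_image]
  simp [affineCoord_sphereChart]

theorem iUnion_chartPiece (hG : G ⊆ Metric.sphere 0 1) :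
    ⋃ p : Fin (m + 1) × Bool, G ∩ chartPiece p.1 p.2 = G := by
  rw [← Set.inter_iUnion, Set.inter_eq_left]
  intro t ht
  have hn : ‖t‖ = 1 := by simpa using hG ht
  obtain ⟨i, b, h⟩ := exists_mem_chartPiece (t := t) (by rintro rfl; simp at hn)
  exact Set.mem_iUnion.2 ⟨(i, b), h⟩

theorem hausdorffMeasure_lt_top (hG : G ⊆ Metric.sphere 0 1) : μH[(m : ℝ)] G < ⊤ := by
  rw [← iUnion_chartPiece hG]
  refine (measure_iUnion_fintype_le _ _).trans_lt (ENNReal.sum_lt_top.2 fun p _ => ?_)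
  rw [← image_chartDomain hG p]
  obtain ⟨K, hK⟩ := lipschitzWith_sphereChart (m := m) p.1 p.2
  refine (hK.hausdorffMeasure_image_le (Nat.cast_nonneg m) _).trans_lt ?_
  have e : (μH[(m : ℝ)] : Measure (Fin m → ℝ)) = volume := by
    simpa using hausdorffMeasure_pi_real (ι := Fin m)
  rw [e]
  refine ENNReal.mul_lt_top (by finiteness) ((measure_mono (t := Metric.closedBall 0 1)
    fun x hx => by simpa using norm_le_one_of_mem_chartDomain hx).trans_lt measure_closedBall_lt_top)

theorem volume_chartDomain_le (hG : G ⊆ Metric.sphere 0 1) (p : Fin (m + 1) × Bool) :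
    (volume (chartDomain G p)).toReal ≤ (2 * (m + 1)) ^ m * (μH[(m : ℝ)] G).toReal := by
  have e : (μH[(m : ℝ)] : Measure (Fin m → ℝ)) = volume := by
    simpa using hausdorffMeasure_pi_real (ι := Fin m)
  have h1 := ((lipschitzOnWith_affineCoord p.1 p.2).mono
    (Set.inter_subset_inter_left (chartPiece p.1 p.2) hG)).hausdorffMeasure_image_le
    (Nat.cast_nonneg m)
  rw [affineCoord_image hG, e] at h1
  have h2 := h1.trans (mul_le_mul' le_rfl (measure_mono Set.inter_subset_left))
  have h3 := ENNReal.toReal_mono (ENNReal.mul_ne_top (by finiteness) (hausdorffMeasure_lt_top hG).ne) h2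
  have h4 : ((m : ENNReal) + 1).toReal = m + 1 := by
    rw [ENNReal.toReal_add (by simp) (by simp)]
    simp
  simpa [h4] using h3

/-- Zeros of the field in a subset of the sphere. -/
def sphereZeros (d : ℕ) (G : Set (EuclideanSpace ℝ (Fin (m + 1)))) (w : coeffSpace m d) :
    Set (EuclideanSpace ℝ (Fin (m + 1))) :=
  {t | t ∈ G ∧ ∀ ℓ, hkssPoly m d (coeffMap m d w) ℓ (fun k => t k) = 0}

theorem hkssPoly_sphereChart_eq_zero_iff (d : ℕ) (i : Fin (m + 1)) (b : Bool) (w : coeffSpace m d)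
    (ℓ : Fin m) (x : Fin m → ℝ) :
    hkssPoly m d (coeffMap m d w) ℓ (fun k => sphereChart i b x k) = 0 ↔
      inner ℝ (chartFeature m d i x) (w ℓ) = 0 := by
  set c := boolSign b * ‖affinePoint i x‖⁻¹ with hc
  have hc0 : c ≠ 0 := by
    have h1 : ‖affinePoint i x‖ ≠ 0 := (zero_lt_one.trans_le (one_le_norm_affinePoint i x)).ne'
    have h2 : boolSign b ≠ 0 := by cases b <;> simp [boolSign]
    exact mul_ne_zero h2 (inv_ne_zero h1)
  have e : (fun k => sphereChart i b x k) = c • (i.insertNth 1 x : Fin (m + 1) → ℝ) := rfl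
  rw [hkssPoly_coeffMap, e, homFeature_smul, inner_smul_left, chartFeature]
  simp [hc0]

theorem image_zeroSet (hG : G ⊆ Metric.sphere 0 1) (d : ℕ) (w : coeffSpace m d)
    (p : Fin (m + 1) × Bool) :
    sphereChart p.1 p.2 '' (chartDomain G p ∩ zeroSet (chartFeature m d p.1) w) =
      sphereZeros d (G ∩ chartPiece p.1 p.2) w := by
  ext t
  constructor
  · rintro ⟨x, ⟨hx, hz⟩, rfl⟩
    exact ⟨hx, fun ℓ => (hkssPoly_sphereChart_eq_zero_iff d p.1 p.2 w ℓ x).2 (hz ℓ)⟩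
  · rintro ⟨ht, hz⟩
    rw [← image_chartDomain hG] at ht
    obtain ⟨x, hx, rfl⟩ := ht
    exact ⟨x, ⟨hx, fun ℓ => (hkssPoly_sphereChart_eq_zero_iff d p.1 p.2 w ℓ x).1 (hz ℓ)⟩, rfl⟩

theorem injective_sphereChart (i : Fin (m + 1)) (b : Bool) :
    Function.Injective (sphereChart (m := m) i b) :=
  Function.LeftInverse.injective (affineCoord_sphereChart i b)

theorem hkssCountIn_eq_sum (hG : G ⊆ Metric.sphere 0 1) (d : ℕ) (w : coeffSpace m d)
    (hfin : ∀ p : Fin (m + 1) × Bool,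
      (chartDomain G p ∩ zeroSet (chartFeature m d p.1) w).Finite) :
    hkssCountIn m d G (coeffMap m d w) =
      ∑ p : Fin (m + 1) × Bool, (chartDomain G p ∩ zeroSet (chartFeature m d p.1) w).ncard := by
  have e : sphereZeros d G w =
      ⋃ p : Fin (m + 1) × Bool, sphereZeros d (G ∩ chartPiece p.1 p.2) w := by
    ext t
    have : t ∈ G ↔ ∃ p : Fin (m + 1) × Bool, t ∈ G ∩ chartPiece p.1 p.2 := by
      conv_lhs => rw [← iUnion_chartPiece hG]
      exact Set.mem_iUnion
    simp only [sphereZeros, Set.mem_iUnion]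
    change t ∈ G ∧ _ ↔ ∃ p : Fin (m + 1) × Bool, t ∈ G ∩ chartPiece p.1 p.2 ∧ _
    rw [this, exists_and_right]
  change (sphereZeros d G w).ncard = _
  rw [e, Set.ncard_iUnion_of_finite]
  · rw [finsum_eq_sum_of_fintype]
    refine Finset.sum_congr rfl fun p _ => ?_
    rw [← image_zeroSet hG, Set.ncard_image_of_injective _ (injective_sphereChart p.1 p.2)]
  · intro p
    rw [← image_zeroSet hG]
    exact (hfin p).image _
  · intro p q hpq
    refine Set.disjoint_left.2 fun t hp hq => hpq ?_
    obtain ⟨h1, h2⟩ := chartPiece_unique hp.1.2 hq.1.2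
    exact Prod.ext h1 h2

end

theorem variance_add_le_two_mul {Ω : Type*} [MeasurableSpace Ω] {μ : Measure Ω} [IsProbabilityMeasure μ]
    {X Y : Ω → ℝ} (hX : MemLp X 2 μ) (hY : MemLp Y 2 μ) :
    variance (X + Y) μ ≤ 2 * (variance X μ + variance Y μ) := by
  have h1 := variance_add hX hY
  have h2 := variance_sub hX hY
  have h3 := variance_nonneg (X - Y) μ
  linarith

theorem variance_sum_le {Ω ι : Type*} [MeasurableSpace Ω] {μ : Measure Ω} [IsProbabilityMeasure μ]
    {X : ι → Ω → ℝ} {c : ℝ} (hc0 : 0 ≤ c) (s : Finset ι) (hX : ∀ i, MemLp (X i) 2 μ)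
    (hc : ∀ i, variance (X i) μ ≤ c) :
    variance (∑ i ∈ s, X i) μ ≤ 4 ^ s.card * c := by
  classical
  induction s using Finset.induction with
  | empty =>
    simpa using hc0
  | insert a s ha ih =>
    rw [Finset.sum_insert ha, Finset.card_insert_of_notMem ha]
    have h1 := variance_add_le_two_mul (hX a) (memLp_finsetSum' s fun i _ => hX i)
    have h2 : c ≤ 4 ^ s.card * c := le_mul_of_one_le_left hc0 (one_le_pow₀ (by norm_num))
    have h3 := hc a
    rw [pow_succ]
    linarith

theorem coeffStd_pos (m d : ℕ) (j : multiIndex m d) : 0 < coeffStd m d j := by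
  refine Real.sqrt_pos.2 (div_pos (by positivity) ?_)
  exact_mod_cast Finset.prod_pos fun k _ => Nat.factorial_pos _

/-- The linear change of variables between normalized coefficients and coefficients. -/
noncomputable def coeffEquiv (m d : ℕ) : coeffSpace m d ≃ᵐ (hkssIndex m d → ℝ) where
  toFun := coeffMap m d
  invFun a := WithLp.toLp 2 fun ℓ => WithLp.toLp 2 fun j => (coeffStd m d j)⁻¹ * a (ℓ, j)
  left_inv w := by
    ext ℓ j
    simp [coeffMap, (coeffStd_pos m d j).ne']
  right_inv a := by
    funext i
    simp [coeffMap, (coeffStd_pos m d i.2).ne']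
  measurable_toFun := measurable_coeffMap m d
  measurable_invFun := by
    change Measurable fun a : hkssIndex m d → ℝ => (WithLp.toLp 2 fun ℓ => WithLp.toLp 2 fun j => (coeffStd m d j)⁻¹ * a (ℓ, j) : coeffSpace m d)
    fun_prop

theorem variance_hkssCountIn_le {m n : ℕ} (hm : m ≠ 0) {G : Set (EuclideanSpace ℝ (Fin (m + 1)))}
    (hG : G ⊆ Metric.sphere 0 1) (hGm : MeasurableSet G) :
    variance (fun ω => (hkssCountIn m (n + 2) G ω : ℝ)) (hkssMeasure m (n + 2)) ≤
      4 ^ (Fintype.card (Fin (m + 1) × Bool)) * ((chartConst m).toReal * √(n + 2) ^ m *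
        ((2 * (m + 1)) ^ m * (μH[(m : ℝ)] G).toReal)) := by
  have hchart := fun p : Fin (m + 1) × Bool => chart_variance (n := n) hm
    (fun x => ((contDiff_chartFeature m (n + 2) p.1).differentiable one_ne_zero x).hasFDerivAt)
    ((contDiff_chartFeature m (n + 2) p.1).continuous_fderiv one_ne_zero)
    (inner_chartFeature m (n + 2) p.1) (measurableSet_chartDomain hGm p)
    (fun x hx => norm_le_one_of_mem_chartDomain hx)
  rw [← map_coeffMap]
  change variance _ ((stdGaussian (coeffSpace m (n + 2))).map (coeffEquiv m (n + 2))) ≤ _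
  rw [variance_map_equiv]
  have hae : (fun ω => (hkssCountIn m (n + 2) G ω : ℝ)) ∘ coeffEquiv m (n + 2)
      =ᵐ[stdGaussian (coeffSpace m (n + 2))] ∑ p : Fin (m + 1) × Bool, fun w =>
        ((chartDomain G p ∩ zeroSet (chartFeature m (n + 2) p.1) w).ncard : ℝ) := by
    filter_upwards [ae_all_iff.2 fun p => (hchart p).2.1] with w hw
    have := hkssCountIn_eq_sum hG (n + 2) w hw
    rw [Finset.sum_apply, ← Nat.cast_sum, ← this]
    rfl
  rw [variance_congr hae]
  refine variance_sum_le (by positivity) _ (fun p => (hchart p).1) fun p => (hchart p).2.2.trans ?_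
  exact mul_le_mul_of_nonneg_left (volume_chartDomain_le hG p) (by positivity)

/-- For every `m ≥ 1` there is a constant `K > 0` such that for every degree `d > 1`
and every Borel subset `G` of the sphere `S^m`,
`Var(N_{Y_d}(G)) - E(N_{Y_d}(G)) ≤ K · Vol(G) · d^{m/2}`,
where `Vol(G)` is the `m`-dimensional (Hausdorff) surface measure of `G`. -/
theorem hkss_variance_subset_bound (m : ℕ) (hm : 1 ≤ m) :
    ∃ K : ℝ, 0 < K ∧
      ∀ d : ℕ, 1 < d →
        ∀ G : Set (EuclideanSpace ℝ (Fin (m + 1))),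
          G ⊆ Metric.sphere (0 : EuclideanSpace ℝ (Fin (m + 1))) 1 →
          MeasurableSet G →
          variance (fun ω => (hkssCountIn m d G ω : ℝ)) (hkssMeasure m d)
              - ∫ ω, (hkssCountIn m d G ω : ℝ) ∂(hkssMeasure m d)
            ≤ K * (μH[(m : ℝ)] G).toReal * (d : ℝ) ^ ((m : ℝ) / 2) := by
  set C : ℝ := 4 ^ (Fintype.card (Fin (m + 1) × Bool)) * (chartConst m).toReal * (2 * (m + 1)) ^ m
  refine ⟨C + 1, by positivity, fun d hd G hG hGm => ?_⟩
  obtain ⟨n, rfl⟩ : ∃ n, d = n + 2 := ⟨d - 2, by omega⟩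
  have h1 := variance_hkssCountIn_le (n := n) (by omega) hG hGm
  have h2 : 0 ≤ ∫ ω, (hkssCountIn m (n + 2) G ω : ℝ) ∂(hkssMeasure m (n + 2)) :=
    integral_nonneg fun ω => Nat.cast_nonneg _
  have h3 : √((n : ℝ) + 2) ^ m = ((n + 2 : ℕ) : ℝ) ^ ((m : ℝ) / 2) := by
    rw [Real.sqrt_eq_rpow, ← Real.rpow_natCast, ← Real.rpow_mul (by positivity)]
    push_cast
    congr 1
    ring
  rw [h3] at h1
  have h4 : 0 ≤ (μH[(m : ℝ)] G).toReal * ((n + 2 : ℕ) : ℝ) ^ ((m : ℝ) / 2) := by positivity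
  refine (sub_le_self _ h2).trans (h1.trans ?_)
  calc _ = C * ((μH[(m : ℝ)] G).toReal * ((n + 2 : ℕ) : ℝ) ^ ((m : ℝ) / 2)) := by simp only [C]; ring
    _ ≤ (C + 1) * ((μH[(m : ℝ)] G).toReal * ((n + 2 : ℕ) : ℝ) ^ ((m : ℝ) / 2)) :=
        mul_le_mul_of_nonneg_right (by linarith) h4
    _ = _ := by ring
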